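/- Let m ∈ (m_s, 1) and let u be a radial energy solution of the fast diffusion equation with exponent m and extinction time T > 0. Then there exists a constant C > 0, depending only on m and N, such that C (T − t)^{1/(1−m)} ≤ ‖u(·,t)‖_{m+1} ≤ (1 − t/T)^{1/(1−m)} ‖u_0‖_{m+1} for all t ∈ (0,T); moreover the function t ↦ ‖∂_r(u^m)(·,t)‖_2 / ‖u(·,t)‖_{m+1}^m is nonincreasing on (0,T). -/

import Mathlib

open MeasureTheory Set Filter Topology

/-- Membership in the radial energy space `H¹_rad` on hyperbolic space `ℍ^N`:
`v` is locally absolutely continuous on `(0,∞)` (expressed via the fundamental theorem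
of calculus for its a.e. derivative) and both `v` and `v'` are square-integrable with
respect to the weight `(sinh s)^(N-1)`. -/
def MemH1rad (N : ℕ) (v : ℝ → ℝ) : Prop :=
  (∀ a b : ℝ, 0 < a → a ≤ b → v b - v a = ∫ s in a..b, deriv v s) ∧
  MeasureTheory.IntegrableOn (fun s => (v s) ^ 2 * Real.sinh s ^ (N - 1)) (Set.Ioi 0) ∧
  MeasureTheory.IntegrableOn (fun s => (deriv v s) ^ 2 * Real.sinh s ^ (N - 1)) (Set.Ioi 0)

/-- The squared `H¹` norm `‖v‖_2² + ‖v'‖_2²` with weight `(sinh s)^(N-1)`. -/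
noncomputable def H1normSq (N : ℕ) (v : ℝ → ℝ) : ℝ :=
  (∫ s in Set.Ioi (0:ℝ), (v s) ^ 2 * Real.sinh s ^ (N - 1)) +
  (∫ s in Set.Ioi (0:ℝ), (deriv v s) ^ 2 * Real.sinh s ^ (N - 1))

/-- A radial energy solution of the fast diffusion equation `u_t = Δ(u^m)` on `ℍ^N`,
with exponent `m`, extinction time `T` (initial datum `u(·,0)`). -/
structure IsRadialEnergySolution (N : ℕ) (m T : ℝ) (u : ℝ → ℝ → ℝ) : Prop where
  continuousOn : ContinuousOn (fun p : ℝ × ℝ => u p.1 p.2) (Set.Ici 0 ×ˢ Set.Icc 0 T)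
  nonneg : ∀ r ∈ Set.Ici (0:ℝ), ∀ t ∈ Set.Icc (0:ℝ) T, 0 ≤ u r t
  smooth : ContDiffOn ℝ (⊤ : ℕ∞) (fun p : ℝ × ℝ => u p.1 p.2) (Set.Ici 0 ×ˢ Set.Ioo 0 T)
  pos : ∀ r ∈ Set.Ici (0:ℝ), ∀ t ∈ Set.Ioo (0:ℝ) T, 0 < u r t
  pde : ∀ r > (0:ℝ), ∀ t ∈ Set.Ioo (0:ℝ) T,
    deriv (fun τ => u r τ) t
      = deriv (deriv (fun ρ => u ρ t ^ m)) r
        + ((N : ℝ) - 1) * (Real.cosh r / Real.sinh r) * deriv (fun ρ => u ρ t ^ m) r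
  neumann : ∀ t ∈ Set.Ioo (0:ℝ) T, deriv (fun ρ => u ρ t ^ m) 0 = 0
  extinction : ∀ r ∈ Set.Ici (0:ℝ), u r T = 0
  energy : ∀ t ∈ Set.Ioo (0:ℝ) T, MemH1rad N (fun ρ => u ρ t ^ m)
  energy_bdd : ∀ ε ∈ Set.Ioo (0:ℝ) T, ∃ C : ℝ, ∀ t ∈ Set.Ico ε T,
    H1normSq N (fun ρ => u ρ t ^ m) ≤ C
  init_bdd : ∃ M : ℝ, ∀ r ∈ Set.Ici (0:ℝ), u r 0 ≤ M
  init_nonzero : ∃ r ∈ Set.Ici (0:ℝ), u r 0 ≠ 0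
  init_energy : MemH1rad N (fun ρ => u ρ 0 ^ m)

/-- The weighted `L^p` norm `(∫_0^∞ |v(s)|^p (sinh s)^(N-1) ds)^(1/p)`. -/
noncomputable def LpNormRad (N : ℕ) (p : ℝ) (v : ℝ → ℝ) : ℝ :=
  (∫ s in Set.Ioi (0:ℝ), |v s| ^ p * Real.sinh s ^ (N - 1)) ^ (1 / p)

lemma hasDerivAt_param {F F' : ℝ → ℝ → ℝ} {a b : ℝ} (hab : a ≤ b)
    (hF : ∀ r > 0, ∀ τ ∈ Icc a b, HasDerivAt (fun ρ => F ρ τ) (F' r τ) r)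
    (hFc : ContinuousOn (fun p : ℝ × ℝ => F p.1 p.2) (Ioi 0 ×ˢ Icc a b))
    (hFc' : ContinuousOn (fun p : ℝ × ℝ => F' p.1 p.2) (Ioi 0 ×ˢ Icc a b))
    {r : ℝ} (hr : 0 < r) :
    HasDerivAt (fun ρ => ∫ τ in a..b, F ρ τ) (∫ τ in a..b, F' r τ) r := by
  have hsec : ∀ {G : ℝ → ℝ → ℝ}, ContinuousOn (fun p : ℝ × ℝ => G p.1 p.2) (Ioi 0 ×ˢ Icc a b) →
      ∀ x > 0, ContinuousOn (G x) (Icc a b) := by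
    intro G hG x hx
    exact hG.comp (f := fun τ : ℝ => (x, τ)) (by fun_prop) (fun τ hτ => ⟨hx, hτ⟩)
  have hcomp : IsCompact (Icc (r/2) (r+1) ×ˢ Icc a b) := isCompact_Icc.prod isCompact_Icc
  obtain ⟨M, hM⟩ := hcomp.exists_bound_of_continuousOn (hFc'.mono (by
    rintro ⟨x, τ⟩ ⟨hx, hτ⟩
    refine ⟨?_, hτ⟩
    have := hx.1
    simp only [mem_Ioi] at *
    linarith))
  have hu : uIoc a b = Ioc a b := uIoc_of_le hab
  have hpos : ∀ x ∈ Icc (r/2) (r+1), (0:ℝ) < x := fun x hx => by linarith [hx.1]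
  refine (intervalIntegral.hasDerivAt_integral_of_dominated_loc_of_deriv_le (bound := fun _ => M)
    (s := Icc (r/2) (r+1)) (Icc_mem_nhds (by linarith) (by linarith)) ?_ ?_ ?_ ?_ ?_ ?_).2
  · filter_upwards [Ioi_mem_nhds hr] with x hx
    rw [hu]
    exact ((hsec hFc x hx).mono Ioc_subset_Icc_self).aestronglyMeasurable measurableSet_Ioc
  · apply ContinuousOn.intervalIntegrable
    rw [uIcc_of_le hab]
    exact hsec hFc r hr
  · rw [hu]
    exact ((hsec hFc' r hr).mono Ioc_subset_Icc_self).aestronglyMeasurable measurableSet_Ioc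
  · refine Eventually.of_forall fun τ hτ x hx => ?_
    rw [hu] at hτ
    exact hM (x, τ) ⟨hx, Ioc_subset_Icc_self hτ⟩
  · simp
  · refine Eventually.of_forall fun τ hτ x hx => ?_
    rw [hu] at hτ
    exact hF x (hpos x hx) τ (Ioc_subset_Icc_self hτ)

lemma cont_at_zero_param {F : ℝ → ℝ → ℝ} {a b : ℝ} (hab : a ≤ b)
    (hb : ∃ K, ∀ r ∈ Icc (0:ℝ) 1, ∀ τ ∈ Icc a b, |F r τ| ≤ K * Real.sinh r) :
    ContinuousWithinAt (fun ρ => ∫ τ in a..b, F ρ τ) (Ici 0) 0 ∧ (∫ τ in a..b, F 0 τ) = 0 := by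
  obtain ⟨K, hK⟩ := hb
  have key : ∀ r ∈ Icc (0:ℝ) 1, |∫ τ in a..b, F r τ| ≤ K * Real.sinh r * |b - a| := by
    intro r hr
    rw [← Real.norm_eq_abs]
    refine intervalIntegral.norm_integral_le_of_norm_le_const (C := K * Real.sinh r) ?_
    intro τ hτ
    rw [uIoc_of_le hab] at hτ
    exact hK r hr τ (Ioc_subset_Icc_self hτ)
  have h0 : (∫ τ in a..b, F 0 τ) = 0 := by
    have := key 0 (by simp)
    simpa using this
  refine ⟨?_, h0⟩
  unfold ContinuousWithinAt
  beta_reduce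
  rw [h0]
  refine squeeze_zero_norm' (a := fun r => K * Real.sinh r * |b - a|) ?_ ?_
  · have : Icc (0:ℝ) 1 ∈ 𝓝[Ici 0] (0:ℝ) := Icc_mem_nhdsGE (by norm_num)
    filter_upwards [this] with r hr using key r hr
  · have : Continuous (fun r => K * Real.sinh r * |b - a|) := by fun_prop
    have h := this.tendsto 0
    simp only [Real.sinh_zero, mul_zero, zero_mul] at h
    exact h.mono_left nhdsWithin_le_nhds

lemma div_lemma {F F' : ℝ → ℝ → ℝ} {a b : ℝ} (hab : a ≤ b)
    (hF : ∀ r > 0, ∀ τ ∈ Icc a b, HasDerivAt (fun ρ => F ρ τ) (F' r τ) r)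
    (hFc : ContinuousOn (fun p : ℝ × ℝ => F p.1 p.2) (Ioi 0 ×ˢ Icc a b))
    (hFc' : ContinuousOn (fun p : ℝ × ℝ => F' p.1 p.2) (Ioi 0 ×ˢ Icc a b))
    (hb : ∃ K, ∀ r ∈ Icc (0:ℝ) 1, ∀ τ ∈ Icc a b, |F r τ| ≤ K * Real.sinh r)
    (hint : Integrable (fun p : ℝ × ℝ => F p.1 p.2)
      ((volume.restrict (Ioi 0)).prod (volume.restrict (Ioc a b))))
    (hint' : IntegrableOn (fun r => ∫ τ in a..b, F' r τ) (Ioi 0)) :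
    ∫ r in Ioi (0:ℝ), ∫ τ in a..b, F' r τ = 0 := by
  obtain ⟨hc, h0⟩ := cont_at_zero_param hab hb
  have hd : ∀ x ∈ Ioi (0:ℝ), HasDerivAt (fun ρ => ∫ τ in a..b, F ρ τ) (∫ τ in a..b, F' x τ) x :=
    fun x hx => hasDerivAt_param hab hF hFc hFc' hx
  have hi : IntegrableOn (fun ρ => ∫ τ in a..b, F ρ τ) (Ioi 0) := by
    have := hint.integral_prod_left
    simp_rw [intervalIntegral.integral_of_le hab]
    exact this
  rw [integral_Ioi_of_hasDerivAt_of_tendsto hc hd hint'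
    (tendsto_zero_of_hasDerivAt_of_integrableOn_Ioi hd hint' hi), h0]
  simp

lemma div_lemma_compact {F F' : ℝ → ℝ → ℝ} {a b R : ℝ} (hab : a ≤ b) (hR : 0 < R)
    (hF : ∀ r > 0, ∀ τ ∈ Icc a b, HasDerivAt (fun ρ => F ρ τ) (F' r τ) r)
    (hFc : ContinuousOn (fun p : ℝ × ℝ => F p.1 p.2) (Ioi 0 ×ˢ Icc a b))
    (hFc' : ContinuousOn (fun p : ℝ × ℝ => F' p.1 p.2) (Ioi 0 ×ˢ Icc a b))
    (hb : ∃ K, ∀ r ∈ Icc (0:ℝ) 1, ∀ τ ∈ Icc a b, |F r τ| ≤ K * Real.sinh r)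
    (hend : ∀ τ ∈ Icc a b, F R τ = 0)
    (hint' : IntervalIntegrable (fun r => ∫ τ in a..b, F' r τ) volume 0 R) :
    ∫ r in (0:ℝ)..R, ∫ τ in a..b, F' r τ = 0 := by
  obtain ⟨hc, h0⟩ := cont_at_zero_param hab hb
  have hd : ∀ x ∈ Ioi (0:ℝ), HasDerivAt (fun ρ => ∫ τ in a..b, F ρ τ) (∫ τ in a..b, F' x τ) x :=
    fun x hx => hasDerivAt_param hab hF hFc hFc' hx
  rw [intervalIntegral.integral_eq_sub_of_hasDerivAt_of_le (f := fun ρ => ∫ τ in a..b, F ρ τ)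
    hR.le ?_ (fun x hx => hd x hx.1) hint', h0]
  · have : ∫ τ in a..b, F R τ = ∫ τ in a..b, (0:ℝ) := by
      apply intervalIntegral.integral_congr
      intro τ hτ
      rw [uIcc_of_le hab] at hτ
      exact hend τ hτ
    rw [this]; simp
  · intro x hx
    rcases hx.1.eq_or_lt with h | h
    · subst h; exact hc.mono Icc_subset_Ici_self
    · exact (hd x h).continuousAt.continuousWithinAt

lemma order_lemma {f ρ : ℝ → ℝ} {a b : ℝ} (hab : a ≤ b)
    (hf : LowerSemicontinuousOn f (Icc a b)) (hf0 : ∀ x ∈ Icc a b, 0 ≤ f x)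
    (hρ : ∀ x ∈ Icc a b, 0 < ρ x)
    (h1 : IntervalIntegrable (fun x => f x * ρ x) volume a b)
    (h2 : IntervalIntegrable (fun x => f x ^ 2 * ρ x) volume a b)
    (h : ∀ t ∈ Ico a b, ∫ x in t..b, f x ^ 2 * ρ x ≤ f t * ∫ x in t..b, f x * ρ x) :
    f b ≤ f a := by
  obtain ⟨x0, hx0, hmin⟩ := hf.exists_isMinOn (nonempty_Icc.2 hab) isCompact_Icc
  rw [isMinOn_iff] at hmin
  obtain ⟨V, hV, hVeq⟩ := lowerSemicontinuousOn_iff_preimage_Iic.1 hf (f x0)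
  have hK : IsCompact (Icc a b ∩ f ⁻¹' Iic (f x0)) := by
    rw [hVeq]; exact isCompact_Icc.inter_right hV
  obtain ⟨c, hc, hcmax⟩ := hK.exists_isGreatest ⟨x0, hx0, le_refl (f x0)⟩
  have hcx : f c ≤ f x0 := hc.2
  rcases hc.1.2.eq_or_lt with hcb | hcb
  · rw [← hcb]; exact hcx.trans (hmin a (left_mem_Icc.2 hab))
  exfalso
  have hgt : ∀ x ∈ Ioc c b, f c < f x := by
    intro x hx
    by_contra hle
    push Not at hle
    have : x ≤ c := hcmax ⟨⟨hc.1.1.trans hx.1.le, hx.2⟩, hle.trans hcx⟩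
    linarith [hx.1]
  have hsub : uIcc c b ⊆ uIcc a b := by
    rw [uIcc_of_le hcb.le, uIcc_of_le hab]; exact Icc_subset_Icc_left hc.1.1
  have h1' := h1.mono_set hsub
  have h2' := h2.mono_set hsub
  have hp : 0 < ∫ x in c..b, (f x ^ 2 * ρ x - f c * (f x * ρ x)) := by
    refine intervalIntegral.intervalIntegral_pos_of_pos_on (h2'.sub (h1'.const_mul _)) ?_ hcb
    intro x hx
    have e := hgt x ⟨hx.1, hx.2.le⟩
    have e0 := hf0 c hc.1
    have e1 := hρ x ⟨hc.1.1.trans hx.1.le, hx.2.le⟩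
    have : f x ^ 2 * ρ x - f c * (f x * ρ x) = f x * (f x - f c) * ρ x := by ring
    rw [this]
    have : 0 < f x := lt_of_le_of_lt e0 e
    have : 0 < f x - f c := by linarith
    positivity
  rw [intervalIntegral.integral_sub h2' (h1'.const_mul _), intervalIntegral.integral_const_mul] at hp
  linarith [h c ⟨hc.1.1, hcb⟩]

lemma cs_lemma {X : Type*} [MeasurableSpace X] {μ : Measure X} {a b w : X → ℝ} (hw : ∀ᵐ x ∂μ, 0 ≤ w x)
    (ha : Integrable (fun x => a x ^ 2 * w x) μ) (hb : Integrable (fun x => b x ^ 2 * w x) μ)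
    (hab : Integrable (fun x => a x * b x * w x) μ) :
    ∫ x, a x * b x * w x ∂μ ≤ Real.sqrt (∫ x, a x ^ 2 * w x ∂μ) * Real.sqrt (∫ x, b x ^ 2 * w x ∂μ) := by
  set A := ∫ x, a x ^ 2 * w x ∂μ
  set B := ∫ x, b x ^ 2 * w x ∂μ
  set D := ∫ x, a x * b x * w x ∂μ
  have hA : 0 ≤ A := integral_nonneg_of_ae (hw.mono fun x hx => by positivity)
  have hB : 0 ≤ B := integral_nonneg_of_ae (hw.mono fun x hx => by positivity)
  have q : ∀ t : ℝ, 0 ≤ A * (t * t) + (2 * D) * t + B := by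
    intro t
    have : 0 ≤ ∫ x, (t * a x + b x) ^ 2 * w x ∂μ :=
      integral_nonneg_of_ae (hw.mono fun x hx => by positivity)
    have e : (fun x => (t * a x + b x) ^ 2 * w x)
      = fun x => (t * t) * (a x ^ 2 * w x) + (2 * t) * (a x * b x * w x) + b x ^ 2 * w x := by
      funext x; ring
    have hi : Integrable (fun x => (t * t) * (a x ^ 2 * w x) + (2 * t) * (a x * b x * w x)) μ :=
      (ha.const_mul _).add (hab.const_mul _)
    rw [e, integral_add hi hb,
      integral_add (ha.const_mul _) (hab.const_mul _), integral_const_mul, integral_const_mul] at this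
    change 0 ≤ t * t * A + 2 * t * D + B at this
    linarith
  have hd := discrim_le_zero q
  unfold discrim at hd
  rw [← Real.sqrt_mul hA]
  apply Real.le_sqrt_of_sq_le
  nlinarith

/-- The regularity facts used below. -/
structure CoreSol (N : ℕ) (m T : ℝ) (u vr ut : ℝ → ℝ → ℝ) : Prop where
  hd_v : ∀ r > 0, ∀ t ∈ Ioo 0 T, HasDerivAt (fun ρ => u ρ t ^ m) (vr r t) r
  hd_flux : ∀ r > 0, ∀ t ∈ Ioo 0 T,
    HasDerivAt (fun ρ => Real.sinh ρ ^ (N - 1) * vr ρ t) (Real.sinh r ^ (N - 1) * ut r t) r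
  hd_t : ∀ r > 0, ∀ t ∈ Ioo 0 T, HasDerivAt (fun τ => u r τ) (ut r t) t
  c_vr : ContinuousOn (fun p : ℝ × ℝ => vr p.1 p.2) (Ioi 0 ×ˢ Ioo 0 T)
  c_ut : ContinuousOn (fun p : ℝ × ℝ => ut p.1 p.2) (Ioi 0 ×ˢ Ioo 0 T)
  c_u : ContinuousOn (fun p : ℝ × ℝ => u p.1 p.2) (Ici 0 ×ˢ Icc 0 T)
  c_v : ContinuousOn (fun p : ℝ × ℝ => u p.1 p.2 ^ m) (Ici 0 ×ˢ Icc 0 T)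
  bd0 : ∀ a b, 0 < a → b < T → ∃ M, ∀ r ∈ Ioc (0:ℝ) 1, ∀ τ ∈ Icc a b, |vr r τ| ≤ M
  nonneg : ∀ r ∈ Ici (0:ℝ), ∀ t ∈ Icc (0:ℝ) T, 0 ≤ u r t
  pos : ∀ r ∈ Ici (0:ℝ), ∀ t ∈ Ioo (0:ℝ) T, 0 < u r t
  ext : ∀ r ∈ Ici (0:ℝ), u r T = 0
  int_v : ∀ t ∈ Ioo 0 T, IntegrableOn (fun r => (u r t ^ m) ^ 2 * Real.sinh r ^ (N - 1)) (Ioi 0)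
  int_vr : ∀ t ∈ Ioo 0 T, IntegrableOn (fun r => (vr r t) ^ 2 * Real.sinh r ^ (N - 1)) (Ioi 0)
  bdd : ∀ ε ∈ Ioo 0 T, ∃ C : ℝ, ∀ t ∈ Ico ε T,
    (∫ r in Ioi (0:ℝ), (u r t ^ m) ^ 2 * Real.sinh r ^ (N - 1)) ≤ C ∧
    (∫ r in Ioi (0:ℝ), (vr r t) ^ 2 * Real.sinh r ^ (N - 1)) ≤ C
  init_int : IntegrableOn (fun r => u r 0 ^ (m + 1) * Real.sinh r ^ (N - 1)) (Ioi 0)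

lemma coreSol_of {N : ℕ} (hN : 2 ≤ N) {m T : ℝ} (hm0 : 0 < m) (hm1 : m < 1) (hT : 0 < T)
    {u : ℝ → ℝ → ℝ}
    (h : IsRadialEnergySolution N m T u) :
    CoreSol N m T u (fun r t => deriv (fun ρ => u ρ t ^ m) r) (fun r t => deriv (fun τ => u r τ) t) := by
  set O : Set (ℝ × ℝ) := Ioi 0 ×ˢ Ioo 0 T with hO
  set S : Set (ℝ × ℝ) := Ici 0 ×ˢ Ioo 0 T with hS
  have hOo : IsOpen O := isOpen_Ioi.prod isOpen_Ioo
  have hOS : O ⊆ S := prod_mono Ioi_subset_Ici_self le_rfl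
  have hSu : UniqueDiffOn ℝ S := (uniqueDiffOn_Ici 0).prod (uniqueDiffOn_Ioo 0 T)
  set U : ℝ × ℝ → ℝ := fun p => u p.1 p.2 with hU
  set g : ℝ × ℝ → ℝ := fun p => u p.1 p.2 ^ m with hg
  have gS : ContDiffOn ℝ (⊤ : ℕ∞) g S :=
    h.smooth.rpow_const_of_ne (fun p hp => (h.pos p.1 hp.1 p.2 hp.2).ne')
  have gO := gS.mono hOS
  have uO := h.smooth.mono hOS
  -- gradient
  have gd : ∀ p ∈ O, HasFDerivAt g (fderiv ℝ g p) p := fun p hp =>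
    ((gO.contDiffAt (hOo.mem_nhds hp)).differentiableAt (by simp)).hasFDerivAt
  have ud : ∀ p ∈ O, HasFDerivAt U (fderiv ℝ U p) p := fun p hp =>
    ((uO.contDiffAt (hOo.mem_nhds hp)).differentiableAt (by simp)).hasFDerivAt
  have dg : ContDiffOn ℝ (⊤ : ℕ∞) (fderiv ℝ g) O := gO.fderiv_of_isOpen hOo (by simp)
  have du : ContDiffOn ℝ (⊤ : ℕ∞) (fderiv ℝ U) O := uO.fderiv_of_isOpen hOo (by simp)
  have inl : ∀ r t : ℝ, HasDerivAt (fun ρ : ℝ => (ρ, t)) ((1:ℝ), (0:ℝ)) r := fun r t =>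
    (hasDerivAt_id r).prodMk (hasDerivAt_const r t)
  have inr : ∀ r t : ℝ, HasDerivAt (fun τ : ℝ => (r, τ)) ((0:ℝ), (1:ℝ)) t := fun r t =>
    (hasDerivAt_const t r).prodMk (hasDerivAt_id t)
  have hv : ∀ p ∈ O, HasDerivAt (fun ρ => u ρ p.2 ^ m) (fderiv ℝ g p (1, 0)) p.1 := fun p hp =>
    (gd p hp).comp_hasDerivAt (f := fun ρ : ℝ => (ρ, p.2)) p.1 (inl p.1 p.2)
  have ht : ∀ p ∈ O, HasDerivAt (fun τ => u p.1 τ) (fderiv ℝ U p (0, 1)) p.2 := fun p hp =>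
    (ud p hp).comp_hasDerivAt (f := fun τ : ℝ => (p.1, τ)) p.2 (inr p.1 p.2)
  have cv : ContDiffOn ℝ (⊤ : ℕ∞) (fun p => fderiv ℝ g p (1, 0)) O := dg.clm_apply contDiffOn_const
  have ct : ContDiffOn ℝ (⊤ : ℕ∞) (fun p => fderiv ℝ U p (0, 1)) O := du.clm_apply contDiffOn_const
  have hvt : ∀ p ∈ O, deriv (fun ρ => u ρ p.2 ^ m) p.1 = fderiv ℝ g p (1, 0) :=
    fun p hp => (hv p hp).deriv
  have hdd : ∀ r > 0, ∀ t ∈ Ioo 0 T, DifferentiableAt ℝ (deriv (fun ρ => u ρ t ^ m)) r := by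
    intro r hr t htt
    have hp : (r, t) ∈ O := ⟨hr, htt⟩
    have h1 : DifferentiableAt ℝ (fun ρ : ℝ => fderiv ℝ g (ρ, t) (1, 0)) r := by
      have := ((cv.contDiffAt (hOo.mem_nhds hp)).differentiableAt (by simp)).hasFDerivAt
      exact (this.comp_hasDerivAt (f := fun ρ : ℝ => (ρ, t)) r (inl r t)).differentiableAt
    refine h1.congr_of_eventuallyEq ?_
    filter_upwards [Ioi_mem_nhds hr] with ρ hρ
    exact hvt (ρ, t) ⟨hρ, htt⟩
  refine ⟨?_, ?_, ?_, ?_, ?_, h.continuousOn, ?_, ?_, h.nonneg, h.pos, h.extinction, ?_, ?_, ?_, ?_⟩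
  · intro r hr t htt
    exact (hv (r, t) ⟨hr, htt⟩).differentiableAt.hasDerivAt
  · intro r hr t htt
    have hs : 0 < Real.sinh r := Real.sinh_pos_iff.2 hr
    have h1 := ((Real.hasDerivAt_sinh r).pow (N - 1)).mul (hdd r hr t htt).hasDerivAt
    refine h1.congr_deriv ?_
    rw [h.pde r hr t htt]
    obtain ⟨n, rfl⟩ : ∃ n, N = n + 2 := ⟨N - 2, by omega⟩
    simp only [show n + 2 - 1 = n + 1 from rfl, Nat.add_sub_cancel]
    push_cast
    simp only [Pi.pow_apply]
    field_simp
    ring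
  · intro r hr t htt
    exact (ht (r, t) ⟨hr, htt⟩).differentiableAt.hasDerivAt
  · exact cv.continuousOn.congr (fun p hp => hvt p hp)
  · exact ct.continuousOn.congr (fun p hp => (ht p hp).deriv)
  · exact h.continuousOn.rpow_const (fun p hp => Or.inr hm0.le)
  · intro a b ha hb
    have hsub : Icc (0:ℝ) 1 ×ˢ Icc a b ⊆ S := prod_mono Icc_subset_Ici_self
      (fun x hx => ⟨ha.trans_le hx.1, hx.2.trans_lt hb⟩)
    have hc : ContinuousOn (fun p => fderivWithin ℝ g S p (1, 0)) S :=
      (gS.continuousOn_fderivWithin hSu (by simp)).clm_apply continuousOn_const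
    obtain ⟨M, hM⟩ := (isCompact_Icc.prod isCompact_Icc).exists_bound_of_continuousOn (hc.mono hsub)
    refine ⟨M, fun r hr τ hτ => ?_⟩
    have hp : (r, τ) ∈ O := ⟨hr.1, (hsub ⟨Ioc_subset_Icc_self hr, hτ⟩).2⟩
    have e : fderivWithin ℝ g S (r, τ) = fderiv ℝ g (r, τ) :=
      fderivWithin_of_mem_nhds (mem_of_superset (hOo.mem_nhds hp) hOS)
    have := hM (r, τ) ⟨Ioc_subset_Icc_self hr, hτ⟩
    rw [e, ← hvt _ hp] at this
    exact this
  · intro t htt; exact (h.energy t htt).2.1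
  · intro t htt; exact (h.energy t htt).2.2
  · intro ε hε
    obtain ⟨C, hC⟩ := h.energy_bdd ε hε
    refine ⟨C, fun t htt => ?_⟩
    have := hC t htt
    unfold H1normSq at this
    have a1 : 0 ≤ ∫ r in Ioi (0:ℝ), (u r t ^ m) ^ 2 * Real.sinh r ^ (N - 1) :=
      setIntegral_nonneg measurableSet_Ioi (fun r hr => by
        have : 0 < Real.sinh r := Real.sinh_pos_iff.2 hr
        positivity)
    have a2 : 0 ≤ ∫ r in Ioi (0:ℝ), (deriv (fun ρ => u ρ t ^ m) r) ^ 2 * Real.sinh r ^ (N - 1) :=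
      setIntegral_nonneg measurableSet_Ioi (fun r hr => by
        have : 0 < Real.sinh r := Real.sinh_pos_iff.2 hr
        positivity)
    exact ⟨by linarith, by linarith⟩
  · obtain ⟨M, hM⟩ := h.init_bdd
    have hcu : ContinuousOn (fun r => u r 0) (Ici 0) :=
      h.continuousOn.comp (f := fun r : ℝ => (r, (0:ℝ))) (by fun_prop)
        (fun r hr => ⟨hr, le_rfl, hT.le⟩)
    have hi := h.init_energy.2.1.const_mul (max M 0 ^ (1 - m))
    refine hi.mono' ?_ ?_
    · refine ContinuousOn.aestronglyMeasurable ?_ measurableSet_Ioi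
      exact ((hcu.mono Ioi_subset_Ici_self).rpow_const (fun _ _ => Or.inr (by linarith))).mul
        (by fun_prop)
    · refine (ae_restrict_iff' measurableSet_Ioi).2 (Eventually.of_forall fun r hr => ?_)
      have hs : 0 < Real.sinh r := Real.sinh_pos_iff.2 hr
      have hu0 : 0 ≤ u r 0 := h.nonneg r (Ioi_subset_Ici_self hr) 0 ⟨le_rfl, hT.le⟩
      rw [Real.norm_of_nonneg (by positivity), ← mul_assoc]
      refine mul_le_mul_of_nonneg_right ?_ (by positivity)
      have e : u r 0 ^ (m + 1) = u r 0 ^ (1 - m) * (u r 0 ^ m) ^ 2 := by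
        rw [← Real.rpow_natCast, ← Real.rpow_mul hu0, ← Real.rpow_add_of_nonneg hu0 (by linarith) (by positivity)]
        congr 1; push_cast; ring
      rw [e]
      refine mul_le_mul_of_nonneg_right ?_ (by positivity)
      exact Real.rpow_le_rpow hu0 ((hM r (Ioi_subset_Ici_self hr)).trans (le_max_left _ _)) (by linarith)

section sob
variable {N : ℕ} {v v' : ℝ → ℝ}

lemma sinh_pos' {r : ℝ} (hr : 0 < r) : 0 < Real.sinh r := Real.sinh_pos_iff.2 hr

lemma w_mono (N : ℕ) {r s : ℝ} (hr : 0 < r) (hrs : r ≤ s) :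
    Real.sinh r ^ (N - 1) ≤ Real.sinh s ^ (N - 1) :=
  pow_le_pow_left₀ (sinh_pos' hr).le (Real.sinh_le_sinh.2 hrs) _

lemma prod_int (hv : ContinuousOn v (Ioi 0)) (hv' : ContinuousOn v' (Ioi 0))
    (h1 : IntegrableOn (fun r => v r ^ 2 * Real.sinh r ^ (N - 1)) (Ioi 0))
    (h2 : IntegrableOn (fun r => v' r ^ 2 * Real.sinh r ^ (N - 1)) (Ioi 0)) :
    IntegrableOn (fun r => v r * v' r * Real.sinh r ^ (N - 1)) (Ioi 0) := by
  refine (h1.add h2).mono' ?_ ?_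
  · exact ((hv.mul hv').mul (by fun_prop)).aestronglyMeasurable measurableSet_Ioi
  · refine (ae_restrict_iff' measurableSet_Ioi).2 (Eventually.of_forall fun r hr => ?_)
    have hs : 0 < Real.sinh r ^ (N - 1) := pow_pos (sinh_pos' hr) _
    simp only [Pi.add_apply]
    rw [norm_mul, norm_mul, Real.norm_of_nonneg hs.le, ← add_mul]
    refine mul_le_mul_of_nonneg_right ?_ hs.le
    rw [Real.norm_eq_abs, Real.norm_eq_abs, ← sq_abs (v r), ← sq_abs (v' r)]
    nlinarith [sq_nonneg (|v r| - |v' r|), sq_nonneg (|v r|), sq_nonneg (|v' r|)]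

lemma sob_decay (hN : 2 ≤ N) (hd : ∀ r > 0, HasDerivAt v (v' r) r) (hv' : ContinuousOn v' (Ioi 0))
    (h1 : IntegrableOn (fun r => v r ^ 2 * Real.sinh r ^ (N - 1)) (Ioi 0))
    (h2 : IntegrableOn (fun r => v' r ^ 2 * Real.sinh r ^ (N - 1)) (Ioi 0)) :
    Tendsto (fun r => v r ^ 2 * Real.sinh r ^ (N - 1)) atTop (𝓝 0) := by
  have hv : ContinuousOn v (Ioi 0) := fun r hr => (hd r hr).continuousAt.continuousWithinAt
  have hp := prod_int hv hv' h1 h2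
  have sub : Ioi (1:ℝ) ⊆ Ioi 0 := Ioi_subset_Ioi (by norm_num)
  refine tendsto_zero_of_hasDerivAt_of_integrableOn_Ioi (a := 1)
    (f' := fun r => 2 * (v r * v' r * Real.sinh r ^ (N - 1)) +
      v r ^ 2 * (((N - 1 : ℕ) : ℝ) * Real.sinh r ^ (N - 1 - 1) * Real.cosh r)) ?_ ?_ (h1.mono_set sub)
  · intro r hr
    have hr0 : (0:ℝ) < r := sub hr
    refine (((hd r hr0).pow 2).mul ((Real.hasDerivAt_sinh r).pow (N - 1))).congr_deriv ?_
    simp only [Pi.pow_apply]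
    push_cast
    ring
  · refine ((hp.mono_set sub).const_mul 2).add ?_
    refine ((h1.mono_set sub).const_mul (2 * ((N - 1 : ℕ) : ℝ))).mono' ?_ ?_
    · exact ((hv.mono sub).pow 2).mul (by fun_prop) |>.aestronglyMeasurable measurableSet_Ioi
    · refine (ae_restrict_iff' measurableSet_Ioi).2 (Eventually.of_forall fun r hr => ?_)
      have hr0 : (0:ℝ) < r := sub hr
      have hs := sinh_pos' hr0
      have hc := Real.cosh_pos r
      rw [Real.norm_of_nonneg (by positivity)]
      have hs1 : 1 ≤ Real.sinh r := by
        have : r ≤ Real.sinh r := Real.self_le_sinh_iff.2 hr0.le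
        have : (1:ℝ) < r := hr
        linarith
      have hcs : Real.cosh r ≤ 2 * Real.sinh r := by
        have := Real.cosh_sq r
        nlinarith
      have e : Real.sinh r ^ (N - 1) = Real.sinh r ^ (N - 1 - 1) * Real.sinh r := by
        rw [← pow_succ]; congr 1; omega
      rw [e]
      have : v r ^ 2 * (((N - 1 : ℕ) : ℝ) * Real.sinh r ^ (N - 1 - 1) * Real.cosh r) ≤
        v r ^ 2 * (((N - 1 : ℕ) : ℝ) * Real.sinh r ^ (N - 1 - 1) * (2 * Real.sinh r)) := by gcongr
      linarith

lemma sob_far (hN : 2 ≤ N) (hd : ∀ r > 0, HasDerivAt v (v' r) r) (hv' : ContinuousOn v' (Ioi 0))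
    (h1 : IntegrableOn (fun r => v r ^ 2 * Real.sinh r ^ (N - 1)) (Ioi 0))
    (h2 : IntegrableOn (fun r => v' r ^ 2 * Real.sinh r ^ (N - 1)) (Ioi 0)) {r : ℝ} (hr : 0 < r) :
    v r ^ 2 * Real.sinh r ^ (N - 1) ≤ 4 * ∫ r in Ioi (0:ℝ), v' r ^ 2 * Real.sinh r ^ (N - 1) := by
  have hv : ContinuousOn v (Ioi 0) := fun r hr => (hd r hr).continuousAt.continuousWithinAt
  have hdec := sob_decay hN hd hv' h1 h2
  have hp := (prod_int hv hv' h1 h2).norm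
  set E := ∫ r in Ioi (0:ℝ), v' r ^ 2 * Real.sinh r ^ (N - 1)
  set B := ∫ r in Ioi (0:ℝ), v r ^ 2 * Real.sinh r ^ (N - 1) with hB
  set D := ∫ r in Ioi (0:ℝ), ‖v r * v' r * Real.sinh r ^ (N - 1)‖ with hD
  have hwp : ∀ r > (0:ℝ), 0 < Real.sinh r ^ (N - 1) := fun r hr => pow_pos (sinh_pos' hr) _
  have hE0 : 0 ≤ E := setIntegral_nonneg measurableSet_Ioi (fun r hr => by have := hwp r hr; positivity)
  have hB0 : 0 ≤ B := setIntegral_nonneg measurableSet_Ioi (fun r hr => by have := hwp r hr; positivity)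
  have hDle : D ≤ Real.sqrt B * Real.sqrt E := by
    have e : D = ∫ r in Ioi (0:ℝ), |v r| * |v' r| * Real.sinh r ^ (N - 1) := by
      refine setIntegral_congr_fun measurableSet_Ioi fun r hr => ?_
      simp only [norm_mul, Real.norm_eq_abs]
      rw [abs_of_pos (hwp r hr)]
    have := cs_lemma (μ := volume.restrict (Ioi 0)) (a := fun r => |v r|) (b := fun r => |v' r|)
      (w := fun r => Real.sinh r ^ (N - 1))
      ((ae_restrict_iff' measurableSet_Ioi).2 (Eventually.of_forall fun r hr => (hwp r hr).le))
      (by simp only [sq_abs]; exact h1) (by simp only [sq_abs]; exact h2) (by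
        refine IntegrableOn.congr_fun hp (fun r hr => ?_) measurableSet_Ioi
        simp only [norm_mul, Real.norm_eq_abs]
        rw [abs_of_pos (hwp r hr)])
    simp only [sq_abs] at this
    rw [e]; exact this
  -- interval pieces of D
  have hpiece : ∀ a > 0, ∀ b, a ≤ b → ∫ s in a..b, ‖v s * v' s * Real.sinh s ^ (N - 1)‖ ≤ D := by
    intro a ha b hab
    rw [intervalIntegral.integral_of_le hab]
    exact setIntegral_mono_set hp (Eventually.of_forall fun _ => norm_nonneg _)
      (Eventually.of_forall fun s hs => ha.trans hs.1)
  have hsubI : ∀ a > (0:ℝ), ∀ b : ℝ, a ≤ b → uIcc a b ⊆ Ioi (0:ℝ) := by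
    intro a ha b hab s hs
    rw [uIcc_of_le hab] at hs
    exact ha.trans_le hs.1
  have hJ : ∀ r > 0, v r ^ 2 * Real.sinh r ^ (N - 1) ≤ 2 * D := by
    intro r hr
    have key : ∀ b ≥ r, v r ^ 2 * Real.sinh r ^ (N - 1) ≤ v b ^ 2 * Real.sinh b ^ (N - 1) + 2 * D := by
      intro b hb
      have hsub := hsubI r hr b hb
      have ftc : ∫ s in r..b, 2 * (v s * v' s) = v b ^ 2 - v r ^ 2 := by
        refine intervalIntegral.integral_eq_sub_of_hasDerivAt (f := fun s => v s ^ 2) ?_ ?_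
        · intro s hs
          refine ((hd s (hsub hs)).pow 2).congr_deriv ?_
          push_cast; ring
        · exact (((hv.mul hv').const_smul (2:ℝ)).mono hsub).intervalIntegrable
      have le1 : ∫ s in r..b, -(2 * (v s * v' s)) * Real.sinh r ^ (N - 1) ≤
          ∫ s in r..b, 2 * ‖v s * v' s * Real.sinh s ^ (N - 1)‖ := by
        refine intervalIntegral.integral_mono_on hb ?_ ?_ ?_
        · refine ContinuousOn.intervalIntegrable (ContinuousOn.mono ?_ hsub)
          exact ((continuousOn_const.mul (hv.mul hv')).neg).mul continuousOn_const
        · refine ContinuousOn.intervalIntegrable (ContinuousOn.mono ?_ hsub)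
          exact continuousOn_const.mul (((hv.mul hv').mul (by fun_prop)).norm)
        · intro s hs
          have hs0 : 0 < s := hr.trans_le hs.1
          rw [norm_mul, Real.norm_of_nonneg (hwp s hs0).le]
          have a1 : -(v s * v' s) ≤ ‖v s * v' s‖ := by rw [Real.norm_eq_abs]; exact neg_le_abs _
          have a2 := w_mono N hr hs.1
          have := hwp r hr
          have := norm_nonneg (v s * v' s)
          have a3 : -(v s * v' s) * Real.sinh r ^ (N - 1) ≤ ‖v s * v' s‖ * Real.sinh r ^ (N - 1) := by gcongr
          have a4 : ‖v s * v' s‖ * Real.sinh r ^ (N - 1) ≤ ‖v s * v' s‖ * Real.sinh s ^ (N - 1) := by gcongr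
          linarith
      rw [intervalIntegral.integral_mul_const, intervalIntegral.integral_neg, ftc,
        intervalIntegral.integral_const_mul] at le1
      have := hpiece r hr b hb
      have a2 := w_mono N hr hb
      have : v b ^ 2 * Real.sinh r ^ (N - 1) ≤ v b ^ 2 * Real.sinh b ^ (N - 1) := by gcongr
      linarith
    have := ge_of_tendsto (hdec.add_const (2 * D)) (eventually_atTop.2 ⟨r, key⟩)
    linarith
  have hBD : B ≤ 2 * D := by
    have key : ∀ a > 0, ∀ b, a ≤ b →
        ∫ s in a..b, v s ^ 2 * Real.sinh s ^ (N - 1) ≤ v b ^ 2 * Real.sinh b ^ (N - 1) + 2 * D := by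
      intro a ha b hab
      have hsub := hsubI a ha b hab
      have c1 : ContinuousOn (fun s => 2 * (v s * v' s * Real.sinh s ^ (N - 1))) (Ioi 0) :=
        continuousOn_const.mul ((hv.mul hv').mul (by fun_prop))
      have c2 : ContinuousOn (fun s => v s ^ 2 * (((N - 1 : ℕ) : ℝ) * Real.sinh s ^ (N - 1 - 1) * Real.cosh s)) (Ioi 0) :=
        (hv.pow 2).mul (by fun_prop)
      have ftc : ∫ s in a..b, (2 * (v s * v' s * Real.sinh s ^ (N - 1)) +
            v s ^ 2 * (((N - 1 : ℕ) : ℝ) * Real.sinh s ^ (N - 1 - 1) * Real.cosh s))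
          = v b ^ 2 * Real.sinh b ^ (N - 1) - v a ^ 2 * Real.sinh a ^ (N - 1) := by
        refine intervalIntegral.integral_eq_sub_of_hasDerivAt
          (f := fun s => v s ^ 2 * Real.sinh s ^ (N - 1)) ?_ ?_
        · intro s hs
          refine (((hd s (hsub hs)).pow 2).mul ((Real.hasDerivAt_sinh s).pow (N - 1))).congr_deriv ?_
          simp only [Pi.pow_apply]
          push_cast
          ring
        · exact ((c1.add c2).mono hsub).intervalIntegrable
      rw [intervalIntegral.integral_add (c1.mono hsub).intervalIntegrable (c2.mono hsub).intervalIntegrable] at ftc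
      have l1 : -(2 * D) ≤ ∫ s in a..b, 2 * (v s * v' s * Real.sinh s ^ (N - 1)) := by
        rw [intervalIntegral.integral_const_mul]
        have := intervalIntegral.norm_integral_le_integral_norm (f := fun s => v s * v' s * Real.sinh s ^ (N - 1)) (μ := volume) hab
        have h3 := hpiece a ha b hab
        have := neg_le_of_abs_le (this.trans h3)
        linarith
      have l2 : ∫ s in a..b, v s ^ 2 * Real.sinh s ^ (N - 1) ≤
          ∫ s in a..b, v s ^ 2 * (((N - 1 : ℕ) : ℝ) * Real.sinh s ^ (N - 1 - 1) * Real.cosh s) := by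
        refine intervalIntegral.integral_mono_on hab ?_ (c2.mono hsub).intervalIntegrable ?_
        · refine ContinuousOn.intervalIntegrable (ContinuousOn.mono ?_ hsub)
          exact (hv.pow 2).mul (by fun_prop)
        · intro s hs
          have hs0 := sinh_pos' (ha.trans_le hs.1)
          refine mul_le_mul_of_nonneg_left ?_ (by positivity)
          have e : Real.sinh s ^ (N - 1) = 1 * Real.sinh s ^ (N - 1 - 1) * Real.sinh s := by
            rw [one_mul, ← pow_succ]; congr 1; omega
          rw [e]
          have : (1:ℝ) ≤ ((N - 1 : ℕ) : ℝ) := by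
            exact_mod_cast (by omega : 1 ≤ N - 1)
          have := (Real.sinh_lt_cosh s).le
          gcongr
      have := mul_nonneg (sq_nonneg (v a)) (hwp a ha).le
      linarith
    have k2 : ∀ a > 0, ∫ s in Ioi a, v s ^ 2 * Real.sinh s ^ (N - 1) ≤ 2 * D := by
      intro a ha
      have t1 := intervalIntegral_tendsto_integral_Ioi a (h1.mono_set (Ioi_subset_Ioi ha.le)) tendsto_id
      have t2 := hdec.add_const (2 * D)
      rw [zero_add] at t2
      exact le_of_tendsto_of_tendsto t1 t2 (eventually_atTop.2 ⟨a, fun b hb => key a ha b hb⟩)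
    have cov : AECover (volume.restrict (Ioi (0:ℝ))) (𝓝[>] (0:ℝ)) (fun a => Ioi a) :=
      aecover_Ioi_of_Ioi (tendsto_id.mono_left nhdsWithin_le_nhds)
    have t3 := cov.integral_tendsto_of_countably_generated h1
    refine le_of_tendsto t3 ?_
    filter_upwards [self_mem_nhdsWithin] with a ha
    rw [Measure.restrict_restrict measurableSet_Ioi, inter_eq_left.2 (Ioi_subset_Ioi (le_of_lt ha))]
    exact k2 a ha
  have hsB : Real.sqrt B ≤ 2 * Real.sqrt E := by
    have := Real.sq_sqrt hB0
    by_contra hcon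
    push Not at hcon
    have h0 : 0 < Real.sqrt B := lt_of_le_of_lt (by positivity) hcon
    nlinarith
  have := hJ r hr
  have := Real.sq_sqrt hE0
  nlinarith [Real.sqrt_nonneg E]

end sob

lemma sob_near {N : ℕ} {v v' : ℝ → ℝ} (hN : 2 ≤ N) (hd : ∀ r > 0, HasDerivAt v (v' r) r)
    (hv' : ContinuousOn v' (Ioi 0)) (hv0 : ∀ r > 0, 0 ≤ v r)
    (h1 : IntegrableOn (fun r => v r ^ 2 * Real.sinh r ^ (N - 1)) (Ioi 0))
    (h2 : IntegrableOn (fun r => v' r ^ 2 * Real.sinh r ^ (N - 1)) (Ioi 0)) {β : ℝ} (hβ : 0 < β)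
    (hβN : (N : ℝ) - 2 ≤ β) {r : ℝ} (hr : 0 < r) (hr1 : r ≤ 1) :
    v r ≤ Real.sqrt (∫ r in Ioi (0:ℝ), v' r ^ 2 * Real.sinh r ^ (N - 1)) *
      ((2 + Real.sqrt (1 / β)) * r ^ (-(β / 2))) := by
  have hfar := sob_far hN hd hv' h1 h2 one_pos
  set E := ∫ r in Ioi (0:ℝ), v' r ^ 2 * Real.sinh r ^ (N - 1)
  have hwp : ∀ r > (0:ℝ), 0 < Real.sinh r ^ (N - 1) := fun r hr => pow_pos (sinh_pos' hr) _
  have hE0 : 0 ≤ E := setIntegral_nonneg measurableSet_Ioi (fun r hr => by have := hwp r hr; positivity)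
  have hsub : uIcc r 1 ⊆ Ioi 0 := by
    intro s hs
    rw [uIcc_of_le hr1] at hs
    exact hr.trans_le hs.1
  have hsub' : Ioc r 1 ⊆ Ioi 0 := fun s hs => hr.trans hs.1
  have hv1 : v 1 ≤ 2 * Real.sqrt E := by
    have : (1:ℝ) ≤ Real.sinh 1 ^ (N - 1) := one_le_pow₀ (Real.self_le_sinh_iff.2 zero_le_one)
    have : v 1 ^ 2 ≤ 4 * E := by nlinarith [sq_nonneg (v 1)]
    have h4 := Real.abs_le_sqrt this
    rw [show (4:ℝ) * E = 2 ^ 2 * E by norm_num, Real.sqrt_mul (by norm_num), Real.sqrt_sq (by norm_num)] at h4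
    exact (le_abs_self _).trans h4
  have ftc : ∫ s in r..1, v' s = v 1 - v r :=
    intervalIntegral.integral_eq_sub_of_hasDerivAt (fun s hs => hd s (hsub hs)) (hv'.mono hsub).intervalIntegrable
  have cinv : ContinuousOn (fun s => (Real.sinh s ^ (N - 1))⁻¹) (Ioi 0) :=
    ContinuousOn.inv₀ (by fun_prop) (fun s hs => (hwp s hs).ne')
  have ii : ∀ {f : ℝ → ℝ}, ContinuousOn f (Ioi 0) → IntegrableOn f (Ioc r 1) := by
    intro f hf
    rw [← intervalIntegrable_iff_integrableOn_Ioc_of_le hr1]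
    exact (hf.mono hsub).intervalIntegrable
  have cs := cs_lemma (μ := volume.restrict (Ioc r 1)) (a := fun s => -v' s)
    (b := fun s => (Real.sinh s ^ (N - 1))⁻¹) (w := fun s => Real.sinh s ^ (N - 1))
    ((ae_restrict_iff' measurableSet_Ioc).2 (Eventually.of_forall fun s hs => (hwp s (hsub' hs)).le))
    (ii ((hv'.neg.pow 2).mul (by fun_prop))) (ii ((cinv.pow 2).mul (by fun_prop)))
    (ii ((hv'.neg.mul cinv).mul (by fun_prop)))
  have e1 : ∫ s in Ioc r 1, -v' s * (Real.sinh s ^ (N - 1))⁻¹ * Real.sinh s ^ (N - 1) = v r - v 1 := by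
    rw [← neg_sub (v 1), ← ftc, intervalIntegral.integral_of_le hr1, ← integral_neg]
    refine setIntegral_congr_fun measurableSet_Ioc fun s hs => ?_
    have := (hwp s (hsub' hs)).ne'
    field_simp
  have e2 : ∫ s in Ioc r 1, (-v' s) ^ 2 * Real.sinh s ^ (N - 1) ≤ E := by
    simp only [neg_sq]
    exact setIntegral_mono_set h2 ((ae_restrict_iff' measurableSet_Ioi).2
      (Eventually.of_forall fun s hs => by have := hwp s hs; simp only [Pi.zero_apply]; positivity))
      (Eventually.of_forall hsub')
  have e3 : ∫ s in Ioc r 1, ((Real.sinh s ^ (N - 1))⁻¹) ^ 2 * Real.sinh s ^ (N - 1) ≤ 1 / β * r ^ (-β) := by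
    have l : ∫ s in Ioc r 1, ((Real.sinh s ^ (N - 1))⁻¹) ^ 2 * Real.sinh s ^ (N - 1) ≤ ∫ s in Ioc r 1, s ^ (-β - 1) := by
      refine setIntegral_mono_on (ii ((cinv.pow 2).mul (by fun_prop))) (ii ?_) measurableSet_Ioc ?_
      · exact ContinuousOn.rpow_const (by fun_prop) (fun s hs => Or.inl (ne_of_gt hs))
      · intro s hs
        have hs0 : 0 < s := hsub' hs
        have hw := hwp s hs0
        have : ((Real.sinh s ^ (N - 1))⁻¹) ^ 2 * Real.sinh s ^ (N - 1) = (Real.sinh s ^ (N - 1))⁻¹ := by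
          field_simp
        rw [this]
        have l1 : s ^ (N - 1) ≤ Real.sinh s ^ (N - 1) :=
          pow_le_pow_left₀ hs0.le (Real.self_le_sinh_iff.2 hs0.le) _
        have l2 : s ^ (β + 1) ≤ s ^ (N - 1) := by
          rw [← Real.rpow_natCast]
          apply Real.rpow_le_rpow_of_exponent_ge hs0 hs.2
          rw [Nat.cast_sub (by omega)]; push_cast; linarith
        rw [show -β - 1 = -(β + 1) by ring, Real.rpow_neg hs0.le]
        exact inv_anti₀ (Real.rpow_pos_of_pos hs0 _) (l2.trans l1)
    refine l.trans ?_
    rw [← intervalIntegral.integral_of_le hr1, integral_rpow (Or.inr ⟨by linarith, fun h0 => lt_irrefl (0:ℝ) (hsub h0)⟩)]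
    simp only [sub_add_cancel, Real.one_rpow]
    rw [div_neg, ← neg_div, neg_sub, div_eq_inv_mul, one_div]
    refine mul_le_mul_of_nonneg_left ?_ (by positivity)
    linarith
  rw [e1] at cs
  have hrb : Real.sqrt (r ^ (-β)) = r ^ (-(β / 2)) := by
    rw [Real.sqrt_eq_rpow, ← Real.rpow_mul hr.le]; congr 1; ring
  have hr1' : 1 ≤ r ^ (-(β / 2)) := Real.one_le_rpow_of_pos_of_le_one_of_nonpos hr hr1 (by linarith)
  have cs2 : v r - v 1 ≤ Real.sqrt E * (Real.sqrt (1 / β) * r ^ (-(β / 2))) := by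
    refine cs.trans ?_
    rw [← hrb, ← Real.sqrt_mul (by positivity : (0:ℝ) ≤ 1 / β)]
    gcongr
  have : 2 * Real.sqrt E ≤ Real.sqrt E * (2 * r ^ (-(β / 2))) := by
    nlinarith [Real.sqrt_nonneg E]
  nlinarith

lemma sobolev_pt {N : ℕ} (hN : 2 ≤ N) {m : ℝ} (hm : m ∈ Ioo (((N : ℝ) - 2) / ((N : ℝ) + 2)) 1) :
    ∃ H : ℝ → ℝ, (∀ r > 0, 0 ≤ H r) ∧ IntegrableOn H (Ioi 0) ∧ ∀ v v' : ℝ → ℝ,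
      (∀ r > 0, HasDerivAt v (v' r) r) → ContinuousOn v' (Ioi 0) → (∀ r > 0, 0 ≤ v r) →
      IntegrableOn (fun r => v r ^ 2 * Real.sinh r ^ (N - 1)) (Ioi 0) →
      IntegrableOn (fun r => v' r ^ 2 * Real.sinh r ^ (N - 1)) (Ioi 0) →
      ∀ r > 0, v r ^ ((m + 1) / m) * Real.sinh r ^ (N - 1) ≤
        (∫ r in Ioi (0:ℝ), v' r ^ 2 * Real.sinh r ^ (N - 1)) ^ ((m + 1) / m / 2) * H r := by
  have hN2 : (2:ℝ) ≤ N := by exact_mod_cast hN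
  have hm0 : 0 < m := lt_of_le_of_lt (div_nonneg (by linarith) (by linarith)) hm.1
  have hm1 := hm.2
  have hms : (N:ℝ) - 2 < m * (N + 2) := by
    have := hm.1
    rwa [div_lt_iff₀ (by linarith)] at this
  set q := (m + 1) / m with hq
  have hq2 : 2 < q := by rw [hq, lt_div_iff₀ hm0]; linarith
  have hqN : (N:ℝ) - 2 < 2 * N / q := by
    rw [hq, lt_div_iff₀ (by positivity), mul_div_assoc', div_lt_iff₀ hm0]
    nlinarith
  set β := (((N:ℝ) - 2) + 2 * N / q) / 2 with hβd
  have hβ : 0 < β := by linarith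
  have hβN : (N:ℝ) - 2 ≤ β := by linarith
  have hβq : β * q < 2 * N := by
    have : β < 2 * N / q := by linarith
    rwa [lt_div_iff₀ (by linarith)] at this
  set K := 2 + Real.sqrt (1 / β) with hK
  have hK0 : 0 < K := by positivity
  have hwp : ∀ r > (0:ℝ), 0 < Real.sinh r ^ (N - 1) := fun r hr => pow_pos (sinh_pos' hr) _
  have cs : ContinuousOn (fun r : ℝ => (K * r ^ (-(β / 2))) ^ q * Real.sinh r ^ (N - 1)) (Ioi 0) := by
    refine ContinuousOn.mul ?_ (by fun_prop)
    refine ContinuousOn.rpow_const ?_ (fun r hr => Or.inr (by linarith))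
    exact continuousOn_const.mul (ContinuousOn.rpow_const (by fun_prop) (fun r hr => Or.inl (ne_of_gt hr)))
  have cl : ContinuousOn (fun r : ℝ => 4 ^ (q / 2) * (Real.sinh r ^ (N - 1)) ^ (1 - q / 2)) (Ioi 0) := by
    exact continuousOn_const.mul (ContinuousOn.rpow_const (by fun_prop) (fun r hr => Or.inl (hwp r hr).ne'))
  have s01 : Ioc (0:ℝ) 1 ⊆ Ioi 0 := fun s hs => hs.1
  have s1 : Ioi (1:ℝ) ⊆ Ioi 0 := Ioi_subset_Ioi zero_le_one
  refine ⟨fun r => if r ≤ 1 then (K * r ^ (-(β / 2))) ^ q * Real.sinh r ^ (N - 1) else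
    4 ^ (q / 2) * (Real.sinh r ^ (N - 1)) ^ (1 - q / 2), ?_, ?_, ?_⟩
  · intro r hr
    have := hwp r hr
    dsimp only
    split_ifs <;> positivity
  · rw [← Ioc_union_Ioi_eq_Ioi (zero_le_one' ℝ)]
    refine IntegrableOn.union ?_ ?_
    · have : IntegrableOn (fun r : ℝ => (K * r ^ (-(β / 2))) ^ q * Real.sinh r ^ (N - 1)) (Ioc 0 1) := by
        have hi : IntegrableOn (fun r : ℝ => K ^ q * 2 ^ (N - 1) * r ^ (-(β / 2) * q + (N - 1 : ℕ))) (Ioc 0 1) := by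
          rw [← intervalIntegrable_iff_integrableOn_Ioc_of_le zero_le_one]
          refine (intervalIntegral.intervalIntegrable_rpow' ?_).const_mul _
          rw [Nat.cast_sub (by omega)]; push_cast; linarith
        refine hi.mono' ((cs.mono s01).aestronglyMeasurable measurableSet_Ioc) ?_
        refine (ae_restrict_iff' measurableSet_Ioc).2 (Eventually.of_forall fun r hr => ?_)
        have hr0 : 0 < r := hr.1
        have := hwp r hr0
        rw [Real.norm_of_nonneg (by positivity), Real.mul_rpow hK0.le (by positivity), ← Real.rpow_mul hr0.le,
          Real.rpow_add hr0, Real.rpow_natCast]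
        have hsr : Real.sinh r ≤ 2 * r := by
          rw [Real.sinh_eq]
          have a1 := Real.abs_exp_sub_one_le (x := r) (by rw [abs_of_pos hr0]; exact hr.2)
          have a2 := Real.abs_exp_sub_one_le (x := -r) (by rw [abs_neg, abs_of_pos hr0]; exact hr.2)
          rw [abs_neg] at a2
          rw [abs_of_pos hr0] at a1 a2
          have := le_of_abs_le a1
          have := neg_le_of_abs_le a2
          linarith
        have : Real.sinh r ^ (N - 1) ≤ 2 ^ (N - 1) * r ^ (N - 1) := by
          rw [← mul_pow]; exact pow_le_pow_left₀ (sinh_pos' hr0).le hsr _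
        calc _ ≤ K ^ q * r ^ (-(β / 2) * q) * (2 ^ (N - 1) * r ^ (N - 1)) := by gcongr
          _ = _ := by ring
      refine this.congr_fun (fun r hr => ?_) measurableSet_Ioc
      simp only [if_pos hr.2]
    · have : IntegrableOn (fun r : ℝ => 4 ^ (q / 2) * (Real.sinh r ^ (N - 1)) ^ (1 - q / 2)) (Ioi 1) := by
        have hi := (exp_neg_integrableOn_Ioi 1 (b := q / 2 - 1) (by linarith)).const_mul
          ((4:ℝ) ^ (q / 2) * (4:ℝ) ^ (q / 2 - 1))
        refine hi.mono' ((cl.mono s1).aestronglyMeasurable measurableSet_Ioi) ?_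
        refine (ae_restrict_iff' measurableSet_Ioi).2 (Eventually.of_forall fun r hr => ?_)
        have hr1 : 1 < r := hr
        have hr0 : 0 < r := s1 hr
        have hw := hwp r hr0
        rw [Real.norm_of_nonneg (by positivity), mul_assoc]
        refine mul_le_mul_of_nonneg_left ?_ (by positivity)
        have l1 : Real.exp r / 4 ≤ Real.sinh r ^ (N - 1) := by
          have hs1 : 1 ≤ Real.sinh r := by
            have : r ≤ Real.sinh r := Real.self_le_sinh_iff.2 hr0.le
            linarith
          have : Real.sinh r ≤ Real.sinh r ^ (N - 1) := le_self_pow₀ hs1 (by omega)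
          refine le_trans ?_ this
          rw [Real.sinh_eq]
          have b1 : Real.exp (-r) ≤ 1 := Real.exp_le_one_iff.2 (by linarith)
          have b2 : 2 ≤ Real.exp r := by linarith [Real.add_one_le_exp r]
          linarith
        calc (Real.sinh r ^ (N - 1)) ^ (1 - q / 2) ≤ (Real.exp r / 4) ^ (1 - q / 2) :=
              Real.rpow_le_rpow_of_nonpos (by positivity) l1 (by linarith)
          _ = 4 ^ (q / 2 - 1) * Real.exp (-(q / 2 - 1) * r) := by
              rw [Real.div_rpow (by positivity) (by norm_num), ← Real.exp_mul,
                show (1 - q / 2) = -(q / 2 - 1) by ring, Real.rpow_neg (by norm_num : (0:ℝ) ≤ 4), div_inv_eq_mul, mul_comm]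
              congr 2; ring
      refine this.congr_fun (fun r hr => ?_) measurableSet_Ioi
      simp only [if_neg (not_le.2 (show (1:ℝ) < r from hr))]
  · intro v v' hd hv' hv0 h1 h2 r hr
    set E := ∫ r in Ioi (0:ℝ), v' r ^ 2 * Real.sinh r ^ (N - 1) with hE
    have hE0 : 0 ≤ E := setIntegral_nonneg measurableSet_Ioi (fun r hr => by have := hwp r hr; positivity)
    have hw := hwp r hr
    dsimp only
    have hEs : E ^ (q / 2) = (Real.sqrt E) ^ q := by
      rw [Real.sqrt_eq_rpow, ← Real.rpow_mul hE0]; congr 1; ring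
    split_ifs with hr1
    · have := sob_near hN hd hv' hv0 h1 h2 hβ hβN hr hr1
      rw [hEs, ← mul_assoc, ← Real.mul_rpow (by positivity) (by positivity)]
      refine mul_le_mul_of_nonneg_right ?_ hw.le
      exact Real.rpow_le_rpow (hv0 r hr) this (by linarith)
    · have := sob_far hN hd hv' h1 h2 hr
      rw [← mul_assoc, ← Real.mul_rpow hE0 (by norm_num), mul_comm E 4]
      have e : v r ^ q * Real.sinh r ^ (N - 1) =
          (v r ^ 2 * Real.sinh r ^ (N - 1)) ^ (q / 2) * (Real.sinh r ^ (N - 1)) ^ (1 - q / 2) := by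
        rw [Real.mul_rpow (by positivity) hw.le, mul_assoc, ← Real.rpow_add hw, ← Real.rpow_natCast (v r) 2,
          ← Real.rpow_mul (hv0 r hr)]
        rw [show q / 2 + (1 - q / 2) = 1 by ring, Real.rpow_one]
        congr 2; push_cast; ring
      rw [e]
      refine mul_le_mul_of_nonneg_right ?_ (by positivity)
      exact Real.rpow_le_rpow (mul_nonneg (sq_nonneg _) hw.le) this (by linarith)

lemma prodint {N : ℕ} {f g : ℝ → ℝ → ℝ} {a b C : ℝ}
    (hf : ContinuousOn (fun p : ℝ × ℝ => f p.1 p.2) (Ioi 0 ×ˢ Icc a b))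
    (hg : ContinuousOn (fun p : ℝ × ℝ => g p.1 p.2) (Ioi 0 ×ˢ Icc a b))
    (fi : ∀ τ ∈ Icc a b, IntegrableOn (fun r => f r τ ^ 2 * Real.sinh r ^ (N - 1)) (Ioi 0))
    (gi : ∀ τ ∈ Icc a b, IntegrableOn (fun r => g r τ ^ 2 * Real.sinh r ^ (N - 1)) (Ioi 0))
    (fC : ∀ τ ∈ Icc a b, ∫ r in Ioi (0:ℝ), f r τ ^ 2 * Real.sinh r ^ (N - 1) ≤ C)
    (gC : ∀ τ ∈ Icc a b, ∫ r in Ioi (0:ℝ), g r τ ^ 2 * Real.sinh r ^ (N - 1) ≤ C) :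
    Integrable (fun p : ℝ × ℝ => f p.1 p.2 * g p.1 p.2 * Real.sinh p.1 ^ (N - 1))
      ((volume.restrict (Ioi 0)).prod (volume.restrict (Ioc a b))) := by
  have hsub : Ioi (0:ℝ) ×ˢ Ioc a b ⊆ Ioi (0:ℝ) ×ˢ Icc a b := prod_mono le_rfl Ioc_subset_Icc_self
  have hc : ContinuousOn (fun p : ℝ × ℝ => f p.1 p.2 * g p.1 p.2 * Real.sinh p.1 ^ (N - 1))
      (Ioi 0 ×ˢ Icc a b) := (hf.mul hg).mul (by fun_prop)
  have hm : AEStronglyMeasurable (fun p : ℝ × ℝ => f p.1 p.2 * g p.1 p.2 * Real.sinh p.1 ^ (N - 1))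
      ((volume.restrict (Ioi 0)).prod (volume.restrict (Ioc a b))) := by
    rw [Measure.prod_restrict]
    exact (hc.mono hsub).aestronglyMeasurable (measurableSet_Ioi.prod measurableSet_Ioc)
  have sec : ∀ {k : ℝ → ℝ → ℝ}, ContinuousOn (fun p : ℝ × ℝ => k p.1 p.2) (Ioi 0 ×ˢ Icc a b) →
      ∀ τ ∈ Icc a b, ContinuousOn (fun r => k r τ) (Ioi 0) := by
    intro k hk τ hτ
    exact hk.comp (f := fun r : ℝ => (r, τ)) (by fun_prop) (fun r hr => ⟨hr, hτ⟩)
  have hi : ∀ τ ∈ Icc a b, IntegrableOn (fun r => f r τ * g r τ * Real.sinh r ^ (N - 1)) (Ioi 0) :=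
    fun τ hτ => prod_int (sec hf τ hτ) (sec hg τ hτ) (fi τ hτ) (gi τ hτ)
  rw [integrable_prod_iff' hm]
  refine ⟨(ae_restrict_iff' measurableSet_Ioc).2 (Eventually.of_forall fun τ hτ =>
    hi τ (Ioc_subset_Icc_self hτ)), ?_⟩
  refine (integrable_const (2 * C)).mono' ?_ ?_
  · exact (hm.norm.prod_swap).integral_prod_right'
  · refine (ae_restrict_iff' measurableSet_Ioc).2 (Eventually.of_forall fun τ hτ' => ?_)
    have hτ := Ioc_subset_Icc_self hτ'
    rw [Real.norm_of_nonneg (integral_nonneg fun _ => norm_nonneg _)]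
    have := integral_mono_ae (hi τ hτ).norm ((fi τ hτ).add (gi τ hτ)) (by
      refine (ae_restrict_iff' measurableSet_Ioi).2 (Eventually.of_forall fun r hr => ?_)
      have hs : 0 < Real.sinh r ^ (N - 1) := pow_pos (sinh_pos' hr) _
      simp only [Pi.add_apply]
      rw [norm_mul, norm_mul, Real.norm_of_nonneg hs.le, ← add_mul]
      refine mul_le_mul_of_nonneg_right ?_ hs.le
      rw [Real.norm_eq_abs, Real.norm_eq_abs, ← sq_abs (f r τ), ← sq_abs (g r τ)]
      nlinarith [sq_nonneg (|f r τ| - |g r τ|), sq_nonneg (|f r τ|), sq_nonneg (|g r τ|)])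
    refine this.trans ?_
    simp only [Pi.add_apply]
    rw [integral_add (fi τ hτ) (gi τ hτ)]
    linarith [fC τ hτ, gC τ hτ]

lemma flux_identity {N : ℕ} (hN : 2 ≤ N) {m T : ℝ} {u vr ut : ℝ → ℝ → ℝ} (h : CoreSol N m T u vr ut)
    {g gr : ℝ → ℝ → ℝ} {a b : ℝ} (ha : 0 < a) (hab : a ≤ b) (hbT : b < T)
    (hg : ∀ r > 0, ∀ τ ∈ Icc a b, HasDerivAt (fun ρ => g ρ τ) (gr r τ) r)
    (cg : ContinuousOn (fun p : ℝ × ℝ => g p.1 p.2) (Ioi 0 ×ˢ Icc a b))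
    (cgr : ContinuousOn (fun p : ℝ × ℝ => gr p.1 p.2) (Ioi 0 ×ˢ Icc a b))
    (bg : ∃ M, ∀ r ∈ Ioc (0:ℝ) 1, ∀ τ ∈ Icc a b, |g r τ| ≤ M)
    (ig : ∀ τ ∈ Icc a b, IntegrableOn (fun r => g r τ ^ 2 * Real.sinh r ^ (N - 1)) (Ioi 0))
    (igr : ∀ τ ∈ Icc a b, IntegrableOn (fun r => gr r τ ^ 2 * Real.sinh r ^ (N - 1)) (Ioi 0))
    (Cg : ∃ C, ∀ τ ∈ Icc a b, ∫ r in Ioi (0:ℝ), g r τ ^ 2 * Real.sinh r ^ (N - 1) ≤ C)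
    (Cgr : ∃ C, ∀ τ ∈ Icc a b, ∫ r in Ioi (0:ℝ), gr r τ ^ 2 * Real.sinh r ^ (N - 1) ≤ C)
    (hi : IntegrableOn (fun r => Real.sinh r ^ (N - 1) * ∫ τ in a..b, ut r τ * g r τ) (Ioi 0)) :
    IntervalIntegrable (fun τ => ∫ r in Ioi (0:ℝ), vr r τ * gr r τ * Real.sinh r ^ (N - 1)) volume a b
    ∧ ∫ r in Ioi (0:ℝ), Real.sinh r ^ (N - 1) * ∫ τ in a..b, ut r τ * g r τ
      = - ∫ τ in a..b, ∫ r in Ioi (0:ℝ), vr r τ * gr r τ * Real.sinh r ^ (N - 1) := by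
  have hI : Icc a b ⊆ Ioo 0 T := fun x hx => ⟨ha.trans_le hx.1, hx.2.trans_lt hbT⟩
  have hP : Ioi (0:ℝ) ×ˢ Icc a b ⊆ Ioi (0:ℝ) ×ˢ Ioo 0 T := prod_mono le_rfl hI
  have cvr := h.c_vr.mono hP
  have cut := h.c_ut.mono hP
  obtain ⟨C1, hC1⟩ := Cg
  obtain ⟨C2, hC2⟩ := Cgr
  obtain ⟨C3, hC3⟩ := h.bdd a (hI ⟨le_rfl, hab⟩)
  have hC3' : ∀ τ ∈ Icc a b, ∫ r in Ioi (0:ℝ), (vr r τ) ^ 2 * Real.sinh r ^ (N - 1) ≤ C3 :=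
    fun τ hτ => (hC3 τ ⟨hτ.1, hτ.2.trans_lt hbT⟩).2
  have P1 := prodint (N := N) (C := max C1 C3) cvr cg (fun τ hτ => h.int_vr τ (hI hτ)) ig
    (fun τ hτ => (hC3' τ hτ).trans (le_max_right _ _)) (fun τ hτ => (hC1 τ hτ).trans (le_max_left _ _))
  have P2 := prodint (N := N) (C := max C2 C3) cvr cgr (fun τ hτ => h.int_vr τ (hI hτ)) igr
    (fun τ hτ => (hC3' τ hτ).trans (le_max_right _ _)) (fun τ hτ => (hC2 τ hτ).trans (le_max_left _ _))
  have sec : ∀ {k : ℝ → ℝ → ℝ}, ContinuousOn (fun p : ℝ × ℝ => k p.1 p.2) (Ioi 0 ×ˢ Icc a b) →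
      ∀ r > 0, ContinuousOn (fun τ => k r τ) (Icc a b) := by
    intro k hk r hr
    exact hk.comp (f := fun τ : ℝ => (r, τ)) (by fun_prop) (fun τ hτ => ⟨hr, hτ⟩)
  have hsplit : ∀ r > 0, ∫ τ in a..b, (Real.sinh r ^ (N - 1) * (ut r τ * g r τ)
      + vr r τ * gr r τ * Real.sinh r ^ (N - 1)) = Real.sinh r ^ (N - 1) * (∫ τ in a..b, ut r τ * g r τ)
      + ∫ τ in a..b, vr r τ * gr r τ * Real.sinh r ^ (N - 1) := by
    intro r hr
    rw [intervalIntegral.integral_add, intervalIntegral.integral_const_mul]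
    · apply ContinuousOn.intervalIntegrable
      rw [uIcc_of_le hab]
      exact continuousOn_const.mul ((sec cut r hr).mul (sec cg r hr))
    · apply ContinuousOn.intervalIntegrable
      rw [uIcc_of_le hab]
      exact ((sec cvr r hr).mul (sec cgr r hr)).mul continuousOn_const
  have hi2 : IntegrableOn (fun r => ∫ τ in a..b, vr r τ * gr r τ * Real.sinh r ^ (N - 1)) (Ioi 0) := by
    have := P2.integral_prod_left
    simp_rw [intervalIntegral.integral_of_le hab]
    exact this
  have key := div_lemma (F := fun r τ => Real.sinh r ^ (N - 1) * vr r τ * g r τ)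
    (F' := fun r τ => Real.sinh r ^ (N - 1) * (ut r τ * g r τ)
      + vr r τ * gr r τ * Real.sinh r ^ (N - 1)) hab ?_ ?_ ?_ ?_ ?_ ?_
  · rw [setIntegral_congr_fun measurableSet_Ioi (fun r hr => hsplit r hr), integral_add hi hi2] at key
    have sw : ∫ r in Ioi (0:ℝ), ∫ τ in a..b, vr r τ * gr r τ * Real.sinh r ^ (N - 1)
        = ∫ τ in a..b, ∫ r in Ioi (0:ℝ), vr r τ * gr r τ * Real.sinh r ^ (N - 1) := by
      simp_rw [intervalIntegral.integral_of_le hab]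
      exact integral_integral_swap P2
    rw [sw] at key
    refine ⟨?_, by linarith⟩
    rw [intervalIntegrable_iff_integrableOn_Ioc_of_le hab]
    exact P2.integral_prod_right
  · intro r hr τ hτ
    refine ((h.hd_flux r hr τ (hI hτ)).mul (hg r hr τ hτ)).congr_deriv ?_
    ring
  · exact ((ContinuousOn.mul (by fun_prop) cvr).mul cg)
  · exact (ContinuousOn.mul (by fun_prop) (cut.mul cg)).add ((cvr.mul cgr).mul (by fun_prop))
  · obtain ⟨M, hM⟩ := h.bd0 a b ha hbT
    obtain ⟨G, hG⟩ := bg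
    refine ⟨Real.sinh 1 ^ (N - 2) * |M| * |G|, fun r hr τ hτ => ?_⟩
    have e : Real.sinh r ^ (N - 1) = Real.sinh r ^ (N - 2) * Real.sinh r := by
      rw [← pow_succ]; congr 1; omega
    rcases hr.1.eq_or_lt with h0 | h0
    · subst h0
      rw [e]; simp
    · have hs := sinh_pos' h0
      have h1 := (hM r ⟨h0, hr.2⟩ τ hτ).trans (le_abs_self M)
      have h2 := (hG r ⟨h0, hr.2⟩ τ hτ).trans (le_abs_self G)
      rw [abs_mul, abs_mul, abs_of_pos (pow_pos hs _), e]
      have h3 : Real.sinh r ^ (N - 2) ≤ Real.sinh 1 ^ (N - 2) :=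
        pow_le_pow_left₀ hs.le (Real.sinh_le_sinh.2 hr.2) _
      calc Real.sinh r ^ (N - 2) * Real.sinh r * |vr r τ| * |g r τ|
          ≤ Real.sinh 1 ^ (N - 2) * Real.sinh r * |M| * |G| := by gcongr
        _ = _ := by ring
  · refine P1.congr (Eventually.of_forall fun p => ?_)
    simp only; ring
  · refine (hi.add hi2).congr ?_
    refine (ae_restrict_iff' measurableSet_Ioi).2 (Eventually.of_forall fun r hr => ?_)
    simp only [Pi.add_apply]
    rw [hsplit r hr]

noncomputable def EE (N : ℕ) (vr : ℝ → ℝ → ℝ) (t : ℝ) : ℝ :=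
  ∫ r in Ioi (0:ℝ), vr r t ^ 2 * Real.sinh r ^ (N - 1)

noncomputable def II (N : ℕ) (m : ℝ) (u : ℝ → ℝ → ℝ) (t : ℝ) : ℝ :=
  ∫ r in Ioi (0:ℝ), u r t ^ (m + 1) * Real.sinh r ^ (N - 1)

def SobH (N : ℕ) (m : ℝ) (H : ℝ → ℝ) : Prop :=
  (∀ r > 0, 0 ≤ H r) ∧ IntegrableOn H (Ioi 0) ∧ ∀ v v' : ℝ → ℝ,
      (∀ r > 0, HasDerivAt v (v' r) r) → ContinuousOn v' (Ioi 0) → (∀ r > 0, 0 ≤ v r) →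
      IntegrableOn (fun r => v r ^ 2 * Real.sinh r ^ (N - 1)) (Ioi 0) →
      IntegrableOn (fun r => v' r ^ 2 * Real.sinh r ^ (N - 1)) (Ioi 0) →
      ∀ r > 0, v r ^ ((m + 1) / m) * Real.sinh r ^ (N - 1) ≤
        (∫ r in Ioi (0:ℝ), v' r ^ 2 * Real.sinh r ^ (N - 1)) ^ ((m + 1) / m / 2) * H r

section core
variable {N : ℕ} {m T : ℝ} {u vr ut : ℝ → ℝ → ℝ} {H : ℝ → ℝ}

lemma EE_nonneg (t : ℝ) : 0 ≤ EE N vr t :=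
  setIntegral_nonneg measurableSet_Ioi fun _ hr => mul_nonneg (sq_nonneg _)
    (pow_pos (sinh_pos' hr) _).le

lemma ae_Ioi {p : ℝ → Prop} (h : ∀ r > 0, p r) : ∀ᵐ r ∂(volume.restrict (Ioi (0:ℝ))), p r :=
  (ae_restrict_iff' measurableSet_Ioi).2 (Eventually.of_forall fun r hr => h r hr)

lemma u_sec (h : CoreSol N m T u vr ut) {t : ℝ} (ht : t ∈ Icc 0 T) :
    ContinuousOn (fun r => u r t) (Ici 0) :=
  h.c_u.comp (f := fun r : ℝ => (r, t)) (by fun_prop) (fun _ hr => ⟨hr, ht⟩)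

lemma vr_sec (h : CoreSol N m T u vr ut) {t : ℝ} (ht : t ∈ Ioo 0 T) :
    ContinuousOn (fun r => vr r t) (Ioi 0) :=
  h.c_vr.comp (f := fun r : ℝ => (r, t)) (by fun_prop) (fun _ hr => ⟨hr, ht⟩)

lemma u_pt (hm0 : 0 < m) (h : CoreSol N m T u vr ut) (hH : SobH N m H) {t : ℝ} (ht : t ∈ Ioo 0 T) {r : ℝ}
    (hr : 0 < r) :
    u r t ^ (m + 1) * Real.sinh r ^ (N - 1) ≤ EE N vr t ^ ((m + 1) / m / 2) * H r := by
  have := hH.2.2 (fun r => u r t ^ m) (fun r => vr r t) (fun r hr => h.hd_v r hr t ht)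
    (vr_sec h ht) (fun r hr => Real.rpow_nonneg (h.pos r (le_of_lt hr) t ht).le _)
    (h.int_v t ht) (h.int_vr t ht) r hr
  rw [← Real.rpow_mul (h.pos r (le_of_lt hr) t ht).le, mul_div_cancel₀ _ hm0.ne'] at this
  exact this

lemma um_meas (hm0 : 0 < m) (h : CoreSol N m T u vr ut) {t : ℝ} (ht : t ∈ Icc 0 T) :
    AEStronglyMeasurable (fun r => u r t ^ (m + 1) * Real.sinh r ^ (N - 1)) (volume.restrict (Ioi 0)) := by
  refine ContinuousOn.aestronglyMeasurable ?_ measurableSet_Ioi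
  refine (((u_sec h ht).mono Ioi_subset_Ici_self).rpow_const (fun r hr => Or.inr (by linarith))).mul ?_
  fun_prop

lemma I_int (hm0 : 0 < m) (h : CoreSol N m T u vr ut) (hH : SobH N m H) {t : ℝ} (ht : t ∈ Ioo 0 T) :
    IntegrableOn (fun r => u r t ^ (m + 1) * Real.sinh r ^ (N - 1)) (Ioi 0) := by
  refine (hH.2.1.const_mul (EE N vr t ^ ((m + 1) / m / 2))).mono' (um_meas hm0 h ⟨ht.1.le, ht.2.le⟩)
    (ae_Ioi fun r hr => ?_)
  rw [Real.norm_of_nonneg (mul_nonneg (Real.rpow_nonneg (h.pos r (le_of_lt hr) t ht).le _)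
    (pow_pos (sinh_pos' hr) _).le)]
  exact u_pt hm0 h hH ht hr

lemma I_le (hm0 : 0 < m) (h : CoreSol N m T u vr ut) (hH : SobH N m H) {t : ℝ} (ht : t ∈ Ioo 0 T) :
    II N m u t ≤ EE N vr t ^ ((m + 1) / m / 2) * ∫ r in Ioi (0:ℝ), H r := by
  rw [← integral_const_mul]
  exact integral_mono_ae (I_int hm0 h hH ht) (hH.2.1.const_mul _)
    (ae_Ioi fun r hr => u_pt hm0 h hH ht hr)

lemma I_pos (hm0 : 0 < m) (h : CoreSol N m T u vr ut) (hH : SobH N m H) {t : ℝ} (ht : t ∈ Ioo 0 T) :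
    0 < II N m u t := by
  have hp : ∀ r > 0, 0 < u r t ^ (m + 1) * Real.sinh r ^ (N - 1) := fun r hr =>
    mul_pos (Real.rpow_pos_of_pos (h.pos r (le_of_lt hr) t ht) _) (pow_pos (sinh_pos' hr) _)
  unfold II
  rw [setIntegral_pos_iff_support_of_nonneg_ae (ae_Ioi fun r hr => (hp r hr).le) (I_int hm0 h hH ht)]
  have : Ioi (0:ℝ) ⊆ Function.support (fun r => u r t ^ (m + 1) * Real.sinh r ^ (N - 1)) ∩ Ioi 0 :=
    fun r hr => ⟨(hp r hr).ne', hr⟩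
  exact lt_of_lt_of_le (by simp) (measure_mono this)

lemma E_lower (hm0 : 0 < m) (hH : SobH N m H) : ∃ c > 0, ∀ {T : ℝ} {u vr ut : ℝ → ℝ → ℝ},
    CoreSol N m T u vr ut → ∀ t ∈ Ioo 0 T, c * II N m u t ^ (2 * m / (m + 1)) ≤ EE N vr t := by
  set K := (∫ r in Ioi (0:ℝ), H r) + 1 with hK
  have hK1 : 0 < K := by
    have : 0 ≤ ∫ r in Ioi (0:ℝ), H r := setIntegral_nonneg measurableSet_Ioi fun r hr => hH.1 r hr
    linarith
  refine ⟨(K ^ (2 * m / (m + 1)))⁻¹, inv_pos.2 (Real.rpow_pos_of_pos hK1 _), ?_⟩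
  intro T u vr ut h t ht
  have hE := EE_nonneg (N := N) (vr := vr) t
  have h1 : II N m u t ≤ K * EE N vr t ^ ((m + 1) / m / 2) := by
    refine (I_le hm0 h hH ht).trans ?_
    rw [mul_comm]
    exact mul_le_mul_of_nonneg_right (by linarith) (Real.rpow_nonneg hE _)
  have h2 := Real.rpow_le_rpow (I_pos hm0 h hH ht).le h1 (z := 2 * m / (m + 1)) (by positivity)
  rw [Real.mul_rpow hK1.le (Real.rpow_nonneg hE _), ← Real.rpow_mul hE] at h2
  have e : (m + 1) / m / 2 * (2 * m / (m + 1)) = 1 := by field_simp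
  rw [e, Real.rpow_one] at h2
  rw [inv_mul_le_iff₀ (Real.rpow_pos_of_pos hK1 _)]
  exact h2

lemma E_pos (hm0 : 0 < m) (h : CoreSol N m T u vr ut) (hH : SobH N m H) {t : ℝ} (ht : t ∈ Ioo 0 T) :
    0 < EE N vr t := by
  obtain ⟨c, hc, hl⟩ := E_lower hm0 hH
  exact lt_of_lt_of_le (mul_pos hc (Real.rpow_pos_of_pos (I_pos hm0 h hH ht) _)) (hl h t ht)

lemma v_bd (h : CoreSol N m T u vr ut) : ∃ M, ∀ r ∈ Ioc (0:ℝ) 1, ∀ τ ∈ Icc 0 T, |u r τ ^ m| ≤ M := by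
  obtain ⟨M, hM⟩ := (isCompact_Icc.prod isCompact_Icc : IsCompact (Icc (0:ℝ) 1 ×ˢ Icc 0 T)).exists_bound_of_continuousOn
    (h.c_v.mono (prod_mono (fun x hx => hx.1) le_rfl))
  exact ⟨M, fun r hr τ hτ => hM (r, τ) ⟨⟨hr.1.le, hr.2⟩, hτ⟩⟩

lemma I_identity (hN : 2 ≤ N) (hm0 : 0 < m) (h : CoreSol N m T u vr ut) (hH : SobH N m H) {a b : ℝ}
    (ha : 0 < a) (hab : a ≤ b) (hb : b < T) :
    IntervalIntegrable (EE N vr) volume a b ∧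
    II N m u b - II N m u a = - ((m + 1) * ∫ τ in a..b, EE N vr τ) := by
  have hI : Icc a b ⊆ Ioo 0 T := fun x hx => ⟨ha.trans_le hx.1, hx.2.trans_lt hb⟩
  have hIc : Icc a b ⊆ Icc 0 T := hI.trans Ioo_subset_Icc_self
  have hP : Ioi (0:ℝ) ×ˢ Icc a b ⊆ Ioi (0:ℝ) ×ˢ Ioo 0 T := prod_mono le_rfl hI
  have hP' : Ioi (0:ℝ) ×ˢ Icc a b ⊆ Ici (0:ℝ) ×ˢ Icc 0 T := prod_mono Ioi_subset_Ici_self hIc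
  obtain ⟨C, hC⟩ := h.bdd a (hI ⟨le_rfl, hab⟩)
  have hC' : ∀ τ ∈ Icc a b, τ ∈ Ico a T := fun τ hτ => ⟨hτ.1, hτ.2.trans_lt hb⟩
  have hti : ∀ r > 0, ∫ τ in a..b, ut r τ * u r τ ^ m = (u r b ^ (m + 1) - u r a ^ (m + 1)) / (m + 1) := by
    intro r hr
    have hd : ∀ τ ∈ uIcc a b, HasDerivAt (fun τ => u r τ ^ (m + 1) / (m + 1)) (ut r τ * u r τ ^ m) τ := by
      intro τ hτ
      rw [uIcc_of_le hab] at hτ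
      have := ((h.hd_t r hr τ (hI hτ)).rpow_const (p := m + 1)
        (Or.inl (h.pos r (le_of_lt hr) τ (hI hτ)).ne')).div_const (m + 1)
      refine this.congr_deriv ?_
      rw [add_sub_cancel_right]; field_simp
    rw [intervalIntegral.integral_eq_sub_of_hasDerivAt hd]
    · ring
    · apply ContinuousOn.intervalIntegrable
      rw [uIcc_of_le hab]
      exact ((h.c_ut.mono hP).mul (h.c_v.mono hP')).comp (f := fun τ : ℝ => (r, τ)) (by fun_prop)
        (fun τ hτ => ⟨hr, hτ⟩)
  have hbI := I_int hm0 h hH (hI ⟨hab, le_rfl⟩)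
  have haI := I_int hm0 h hH (hI ⟨le_rfl, hab⟩)
  have hfun : ∀ r ∈ Ioi (0:ℝ), Real.sinh r ^ (N - 1) * ∫ τ in a..b, ut r τ * u r τ ^ m =
      (m + 1)⁻¹ * (u r b ^ (m + 1) * Real.sinh r ^ (N - 1) - u r a ^ (m + 1) * Real.sinh r ^ (N - 1)) := by
    intro r hr
    rw [hti r hr]; ring
  have key := flux_identity hN h (g := fun r τ => u r τ ^ m) (gr := vr) ha hab hb
    (fun r hr τ hτ => h.hd_v r hr τ (hI hτ)) (h.c_v.mono hP') (h.c_vr.mono hP)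
    (by obtain ⟨M, hM⟩ := v_bd h
        exact ⟨M, fun r hr τ hτ => hM r hr τ (hIc hτ)⟩)
    (fun τ hτ => h.int_v τ (hI hτ)) (fun τ hτ => h.int_vr τ (hI hτ))
    ⟨C, fun τ hτ => (hC τ (hC' τ hτ)).1⟩ ⟨C, fun τ hτ => (hC τ (hC' τ hτ)).2⟩
    (((hbI.sub haI).const_mul (m + 1)⁻¹).congr (ae_Ioi fun r hr => (hfun r hr).symm))
  rw [setIntegral_congr_fun measurableSet_Ioi hfun, integral_const_mul, integral_sub hbI haI] at key
  have e : (fun τ => ∫ r in Ioi (0:ℝ), vr r τ * vr r τ * Real.sinh r ^ (N - 1)) = EE N vr := by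
    funext τ; simp only [EE, sq]
  rw [e] at key
  refine ⟨key.1, ?_⟩
  have k2 := key.2
  change (m + 1)⁻¹ * (II N m u b - II N m u a) = _ at k2
  field_simp at k2
  linarith

lemma hoelder_cross (hm0 : 0 < m) (h : CoreSol N m T u vr ut) (hH : SobH N m H) {a b : ℝ}
    (ha : a ∈ Ioo 0 T) (hb : b ∈ Ioo 0 T) :
    IntegrableOn (fun r => u r b * u r a ^ m * Real.sinh r ^ (N - 1)) (Ioi 0) ∧
    ∫ r in Ioi (0:ℝ), u r b * u r a ^ m * Real.sinh r ^ (N - 1) ≤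
      II N m u b ^ (1 / (m + 1)) * (II N m u a ^ (1 / (m + 1))) ^ m := by
  have hA := I_pos hm0 h hH ha
  have hB := I_pos hm0 h hH hb
  set A := II N m u a ^ (1 / (m + 1)) with hAd
  set B := II N m u b ^ (1 / (m + 1)) with hBd
  have hA0 : 0 < A := Real.rpow_pos_of_pos hA _
  have hB0 : 0 < B := Real.rpow_pos_of_pos hB _
  have hA1 : A ^ (m + 1) = II N m u a := by
    rw [hAd, ← Real.rpow_mul hA.le]; field_simp; simp
  have hB1 : B ^ (m + 1) = II N m u b := by
    rw [hBd, ← Real.rpow_mul hB.le]; field_simp; simp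
  have hbI := I_int hm0 h hH hb
  have haI := I_int hm0 h hH ha
  have hG : IntegrableOn (fun r => B * A ^ m * ((1 / (m + 1)) * ((II N m u b)⁻¹ * (u r b ^ (m + 1) * Real.sinh r ^ (N - 1))) +
      (m / (m + 1)) * ((II N m u a)⁻¹ * (u r a ^ (m + 1) * Real.sinh r ^ (N - 1))))) (Ioi 0) :=
    (((hbI.const_mul _).const_mul _).add ((haI.const_mul _).const_mul _)).const_mul _
  have hpt : ∀ r > 0, u r b * u r a ^ m * Real.sinh r ^ (N - 1) ≤
      B * A ^ m * ((1 / (m + 1)) * ((II N m u b)⁻¹ * (u r b ^ (m + 1) * Real.sinh r ^ (N - 1))) +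
      (m / (m + 1)) * ((II N m u a)⁻¹ * (u r a ^ (m + 1) * Real.sinh r ^ (N - 1)))) := by
    intro r hr
    have hub := h.pos r (le_of_lt hr) b hb
    have hua := h.pos r (le_of_lt hr) a ha
    have hw := pow_pos (sinh_pos' hr) (N - 1)
    have yg := Real.geom_mean_le_arith_mean2_weighted (w₁ := 1 / (m + 1)) (w₂ := m / (m + 1))
      (p₁ := (u r b / B) ^ (m + 1)) (p₂ := (u r a / A) ^ (m + 1)) (by positivity) (by positivity)
      (by positivity) (by positivity) (by field_simp; ring)
    rw [← Real.rpow_mul (by positivity), ← Real.rpow_mul (by positivity)] at yg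
    have e1 : (m + 1) * (1 / (m + 1)) = 1 := by field_simp
    have e2 : (m + 1) * (m / (m + 1)) = m := by field_simp
    rw [e1, e2, Real.rpow_one, Real.div_rpow hua.le hA0.le, Real.div_rpow hub.le hB0.le,
      Real.div_rpow hua.le hA0.le, hA1, hB1] at yg
    have hAm : 0 < A ^ m := Real.rpow_pos_of_pos hA0 _
    calc u r b * u r a ^ m * Real.sinh r ^ (N - 1)
        = B * A ^ m * Real.sinh r ^ (N - 1) * (u r b / B * (u r a ^ m / A ^ m)) := by field_simp
      _ ≤ B * A ^ m * Real.sinh r ^ (N - 1) * (1 / (m + 1) * (u r b ^ (m + 1) / II N m u b) + m / (m + 1) * (u r a ^ (m + 1) / II N m u a)) := by gcongr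
      _ = _ := by ring
  have hI : IntegrableOn (fun r => u r b * u r a ^ m * Real.sinh r ^ (N - 1)) (Ioi 0) := by
    refine hG.mono' ?_ (ae_Ioi fun r hr => ?_)
    · refine ContinuousOn.aestronglyMeasurable ?_ measurableSet_Ioi
      refine (((u_sec h ⟨hb.1.le, hb.2.le⟩).mono Ioi_subset_Ici_self).mul
        (((u_sec h ⟨ha.1.le, ha.2.le⟩).mono Ioi_subset_Ici_self).rpow_const (fun r hr => Or.inr hm0.le))).mul ?_
      fun_prop
    · have hub := h.pos r (le_of_lt hr) b hb
      have hua := h.pos r (le_of_lt hr) a ha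
      have hw := pow_pos (sinh_pos' hr) (N - 1)
      rw [Real.norm_of_nonneg (by positivity)]
      exact hpt r hr
  refine ⟨hI, ?_⟩
  refine (integral_mono_ae hI hG (ae_Ioi hpt)).trans (le_of_eq ?_)
  rw [integral_const_mul, integral_add ((hbI.const_mul _).const_mul _) ((haI.const_mul _).const_mul _),
    integral_const_mul, integral_const_mul, integral_const_mul, integral_const_mul]
  change B * A ^ m * (1 / (m + 1) * ((II N m u b)⁻¹ * II N m u b) + m / (m + 1) * ((II N m u a)⁻¹ * II N m u a)) = _
  rw [inv_mul_cancel₀ hA.ne', inv_mul_cancel₀ hB.ne']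
  field_simp
  ring

lemma cross_ineq (hN : 2 ≤ N) (hm0 : 0 < m) (h : CoreSol N m T u vr ut) (hH : SobH N m H) {a b : ℝ}
    (ha : 0 < a) (hab : a ≤ b) (hb : b < T) :
    IntervalIntegrable (fun τ => √(EE N vr τ)) volume a b ∧
    (II N m u a ^ (1 / (m + 1))) ^ m * (II N m u a ^ (1 / (m + 1)) - II N m u b ^ (1 / (m + 1))) ≤
      √(EE N vr a) * ∫ τ in a..b, √(EE N vr τ) := by
  have hI : Icc a b ⊆ Ioo 0 T := fun x hx => ⟨ha.trans_le hx.1, hx.2.trans_lt hb⟩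
  have hIc : Icc a b ⊆ Icc 0 T := hI.trans Ioo_subset_Icc_self
  have hP : Ioi (0:ℝ) ×ˢ Icc a b ⊆ Ioi (0:ℝ) ×ˢ Ioo 0 T := prod_mono le_rfl hI
  have haT := hI ⟨le_rfl, hab⟩
  have hbT := hI ⟨hab, le_rfl⟩
  have hEi := (I_identity hN hm0 h hH ha hab hb).1
  have hsE : IntervalIntegrable (fun τ => √(EE N vr τ)) volume a b := by
    rw [intervalIntegrable_iff_integrableOn_Ioc_of_le hab] at hEi ⊢
    refine (hEi.add (integrable_const (1:ℝ) (μ := volume.restrict (Ioc a b)))).mono' ?_ ?_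
    · exact Real.continuous_sqrt.comp_aestronglyMeasurable hEi.aestronglyMeasurable
    · refine Eventually.of_forall fun τ => ?_
      have hE := EE_nonneg (N := N) (vr := vr) τ
      simp only [Pi.add_apply]
      rw [Real.norm_of_nonneg (Real.sqrt_nonneg _)]
      nlinarith [Real.sq_sqrt hE, sq_nonneg (√(EE N vr τ) - 1), Real.sqrt_nonneg (EE N vr τ)]
  refine ⟨hsE, ?_⟩
  have hti : ∀ r > 0, ∫ τ in a..b, ut r τ * u r a ^ m = (u r b - u r a) * u r a ^ m := by
    intro r hr
    rw [intervalIntegral.integral_mul_const, intervalIntegral.integral_eq_sub_of_hasDerivAt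
      (f := fun τ => u r τ)]
    · intro τ hτ
      rw [uIcc_of_le hab] at hτ
      exact h.hd_t r hr τ (hI hτ)
    · apply ContinuousOn.intervalIntegrable
      rw [uIcc_of_le hab]
      exact (h.c_ut.mono hP).comp (f := fun τ : ℝ => (r, τ)) (by fun_prop)
        (fun τ hτ => ⟨hr, hτ⟩)
  obtain ⟨hc1, hc2⟩ := hoelder_cross hm0 h hH haT hbT
  have haI := I_int hm0 h hH haT
  have hfun : ∀ r ∈ Ioi (0:ℝ), Real.sinh r ^ (N - 1) * ∫ τ in a..b, ut r τ * u r a ^ m =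
      u r b * u r a ^ m * Real.sinh r ^ (N - 1) - u r a ^ (m + 1) * Real.sinh r ^ (N - 1) := by
    intro r hr
    rw [hti r hr, Real.rpow_add (h.pos r (Ioi_subset_Ici_self hr) a haT), Real.rpow_one]; ring
  have pr : MapsTo (fun p : ℝ × ℝ => (p.1, a)) (Ioi (0:ℝ) ×ˢ Icc a b) (Ioi (0:ℝ) ×ˢ Ioo 0 T) :=
    fun p hp => ⟨hp.1, haT⟩
  have pr' : MapsTo (fun p : ℝ × ℝ => (p.1, a)) (Ioi (0:ℝ) ×ˢ Icc a b) (Ici (0:ℝ) ×ˢ Icc 0 T) :=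
    fun p hp => ⟨Ioi_subset_Ici_self hp.1, Ioo_subset_Icc_self haT⟩
  have key := flux_identity hN h (g := fun r τ => u r a ^ m) (gr := fun r τ => vr r a) ha hab hb
    (fun r hr τ hτ => h.hd_v r hr a haT)
    (h.c_v.comp (f := fun p : ℝ × ℝ => (p.1, a)) (by fun_prop) pr')
    (h.c_vr.comp (f := fun p : ℝ × ℝ => (p.1, a)) (by fun_prop) pr)
    (by obtain ⟨M, hM⟩ := v_bd h
        exact ⟨M, fun r hr τ hτ => hM r hr a (Ioo_subset_Icc_self haT)⟩)
    (fun τ hτ => h.int_v a haT) (fun τ hτ => h.int_vr a haT)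
    ⟨_, fun τ hτ => le_rfl⟩ ⟨_, fun τ hτ => le_rfl⟩
    ((hc1.sub haI).congr (ae_Ioi fun r hr => (hfun r hr).symm))
  rw [setIntegral_congr_fun measurableSet_Ioi hfun, integral_sub hc1 haI] at key
  obtain ⟨k1, k2⟩ := key
  have hcs : ∫ τ in a..b, ∫ r in Ioi (0:ℝ), vr r τ * vr r a * Real.sinh r ^ (N - 1) ≤
      ∫ τ in a..b, √(EE N vr a) * √(EE N vr τ) := by
    refine intervalIntegral.integral_mono_on hab k1 (hsE.const_mul _) fun τ hτ => ?_
    rw [mul_comm]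
    exact cs_lemma (ae_Ioi fun r hr => (pow_pos (sinh_pos' hr) _).le) (h.int_vr τ (hI hτ))
      (h.int_vr a haT) (prod_int (vr_sec h (hI hτ)) (vr_sec h haT) (h.int_vr τ (hI hτ))
      (h.int_vr a haT))
  rw [intervalIntegral.integral_const_mul] at hcs
  refine le_trans ?_ hcs
  have hA := I_pos hm0 h hH haT
  have hA1 : (II N m u a ^ (1 / (m + 1))) ^ m * II N m u a ^ (1 / (m + 1)) = II N m u a := by
    rw [← Real.rpow_mul hA.le, ← Real.rpow_add hA]
    have : 1 / (m + 1) * m + 1 / (m + 1) = 1 := by field_simp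
    rw [this, Real.rpow_one]
  have : II N m u a = ∫ r in Ioi (0:ℝ), u r a ^ (m + 1) * Real.sinh r ^ (N - 1) := rfl
  rw [mul_sub, hA1]
  linarith

end core

section core2
variable {N : ℕ} {m T : ℝ} {u vr ut : ℝ → ℝ → ℝ} {H : ℝ → ℝ}

lemma E_lsc (h : CoreSol N m T u vr ut) {a b : ℝ} (ha : 0 < a) (hb : b < T) {c : ℝ → ℝ}
    (hc : ContinuousOn c (Icc a b)) (hc0 : ∀ t ∈ Icc a b, 0 < c t) :
    LowerSemicontinuousOn (fun t => c t * √(EE N vr t)) (Icc a b) := by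
  have hI : Icc a b ⊆ Ioo 0 T := fun x hx => ⟨ha.trans_le hx.1, hx.2.trans_lt hb⟩
  set lo : ℕ → ℝ := fun k => 1 / ((k:ℝ) + 1) with hlo
  set hi : ℕ → ℝ := fun k => (k:ℝ) + 1 with hhi
  have hlo0 : ∀ k, 0 < lo k := fun k => by simp only [hlo]; positivity
  have hlh : ∀ k, lo k ≤ hi k := fun k => by
    simp only [hlo, hhi]
    have : (0:ℝ) ≤ k := Nat.cast_nonneg k
    rw [div_le_iff₀ (by positivity)]; nlinarith
  set Ek : ℕ → ℝ → ℝ := fun k t => ∫ r in lo k..hi k, vr r t ^ 2 * Real.sinh r ^ (N - 1) with hEk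
  have hEk_le : ∀ k, ∀ t ∈ Icc a b, Ek k t ≤ EE N vr t := by
    intro k t ht
    simp only [hEk, EE]
    rw [intervalIntegral.integral_of_le (hlh k)]
    refine setIntegral_mono_set (h.int_vr t (hI ht)) (ae_Ioi fun r hr => ?_) ?_
    · exact mul_nonneg (sq_nonneg _) (pow_pos (sinh_pos' hr) _).le
    · exact (Filter.Eventually.of_forall fun r hr => (hlo0 k).trans hr.1)
  have hEk_lim : ∀ t ∈ Icc a b, Tendsto (fun k => Ek k t) atTop (𝓝 (EE N vr t)) := by
    intro t ht
    have h1 : Tendsto lo atTop (𝓝 0) := tendsto_one_div_add_atTop_nhds_zero_nat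
    have h2 : Tendsto hi atTop atTop := tendsto_natCast_atTop_atTop.atTop_add tendsto_const_nhds
    have cov : AECover (volume.restrict (Ioi (0:ℝ))) atTop (fun k => Ioc (lo k) (hi k)) :=
      (aecover_Ioi_of_Ioi h1).inter (aecover_Iic h2)
    refine (cov.integral_tendsto_of_countably_generated (h.int_vr t (hI ht))).congr fun k => ?_
    simp only [hEk]
    rw [intervalIntegral.integral_of_le (hlh k), Measure.restrict_restrict measurableSet_Ioc]
    congr 2
    exact inter_eq_left.2 (fun r hr => (hlo0 k).trans hr.1)
  have hEk_c : ∀ k, ContinuousOn (Ek k) (Icc a b) := by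
    intro k x hx
    have hcc : ContinuousOn (fun p : ℝ × ℝ => vr p.1 p.2 ^ 2 * Real.sinh p.1 ^ (N - 1))
        (Icc (lo k) (hi k) ×ˢ Icc a b) := by
      refine ((h.c_vr.mono (prod_mono (fun r hr => (hlo0 k).trans_le hr.1) hI)).pow 2).mul (by fun_prop)
    obtain ⟨M, hM⟩ := (isCompact_Icc.prod isCompact_Icc).exists_bound_of_continuousOn hcc
    refine intervalIntegral.continuousWithinAt_of_dominated_interval (bound := fun _ => M) ?_ ?_
      intervalIntegrable_const ?_
    · refine eventually_mem_nhdsWithin.mono fun t ht => ?_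
      rw [uIoc_of_le (hlh k)]
      refine ContinuousOn.aestronglyMeasurable ?_ measurableSet_Ioc
      exact hcc.comp (f := fun r : ℝ => (r, t)) (by fun_prop)
        (fun r hr => ⟨Ioc_subset_Icc_self hr, ht⟩)
    · refine eventually_mem_nhdsWithin.mono fun t ht => Eventually.of_forall fun r hr => ?_
      rw [uIoc_of_le (hlh k)] at hr
      exact hM (r, t) ⟨Ioc_subset_Icc_self hr, ht⟩
    · refine Eventually.of_forall fun r hr => ?_
      rw [uIoc_of_le (hlh k)] at hr
      exact (hcc.comp (f := fun t : ℝ => (r, t)) (by fun_prop)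
        (fun t ht => ⟨Ioc_subset_Icc_self hr, ht⟩)) x hx
  intro x hx y hy
  have l1 : Tendsto (fun k => c x * √(Ek k x)) atTop (𝓝 (c x * √(EE N vr x))) :=
    ((Real.continuous_sqrt.tendsto _).comp (hEk_lim x hx)).const_mul _
  obtain ⟨k, hk⟩ := (l1.eventually (lt_mem_nhds hy)).exists
  have cc : ContinuousWithinAt (fun t => c t * √(Ek k t)) (Icc a b) x :=
    (hc x hx).mul ((hEk_c k x hx).sqrt)
  filter_upwards [cc.eventually (lt_mem_nhds hk), eventually_mem_nhdsWithin] with t ht ht'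
  refine lt_of_lt_of_le ht ?_
  exact mul_le_mul_of_nonneg_left (Real.sqrt_le_sqrt (hEk_le k t ht')) (hc0 t ht').le

lemma E_anti (hN : 2 ≤ N) (hm0 : 0 < m) (h : CoreSol N m T u vr ut) (hH : SobH N m H) {a b : ℝ}
    (ha : 0 < a) (hab : a ≤ b) (hb : b < T) : √(EE N vr b) ≤ √(EE N vr a) := by
  refine order_lemma (f := fun t => √(EE N vr t)) (ρ := fun _ => 1) hab ?_ ?_ ?_ ?_ ?_ ?_
  · simpa using E_lsc h ha hb (c := fun _ => 1) continuousOn_const (fun _ _ => one_pos)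
  · exact fun _ _ => Real.sqrt_nonneg _
  · exact fun _ _ => one_pos
  · simpa using (cross_ineq hN hm0 h hH ha hab hb).1
  · simpa [Real.sq_sqrt (EE_nonneg _)] using (I_identity hN hm0 h hH ha hab hb).1
  · intro t ht
    have ht0 : 0 < t := ha.trans_le ht.1
    have htT : t < T := ht.2.trans hb
    simp only [mul_one, Real.sq_sqrt (EE_nonneg _)]
    refine le_trans ?_ (cross_ineq hN hm0 h hH ht0 ht.2.le hb).2
    have hid := (I_identity hN hm0 h hH ht0 ht.2.le hb).2
    have hA := I_pos hm0 h hH (t := t) ⟨ht0, htT⟩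
    have hB := I_pos hm0 h hH (t := b) ⟨ht0.trans ht.2, hb⟩
    have yg := Real.geom_mean_le_arith_mean2_weighted (w₁ := 1 / (m + 1)) (w₂ := m / (m + 1))
      (p₁ := II N m u b) (p₂ := II N m u t) (by positivity) (by positivity)
      hB.le hA.le (by field_simp; ring)
    have hA1 : (II N m u t ^ (1 / (m + 1))) ^ m * II N m u t ^ (1 / (m + 1)) = II N m u t := by
      rw [← Real.rpow_mul hA.le, ← Real.rpow_add hA]
      have : 1 / (m + 1) * m + 1 / (m + 1) = 1 := by field_simp
      rw [this, Real.rpow_one]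
    have hA2 : (II N m u t ^ (1 / (m + 1))) ^ m = II N m u t ^ (m / (m + 1)) := by
      rw [← Real.rpow_mul hA.le]; congr 1; ring
    rw [mul_sub, hA1, hA2]
    have e : m / (m + 1) = 1 - 1 / (m + 1) := by field_simp; ring
    have e2 : ∫ τ in t..b, EE N vr τ = 1 / (m + 1) * (II N m u t - II N m u b) := by
      have : m + 1 ≠ 0 := by positivity
      field_simp; linarith
    rw [e2]
    rw [e] at yg ⊢
    nlinarith

lemma E_rc (hN : 2 ≤ N) (hm0 : 0 < m) (h : CoreSol N m T u vr ut) (hH : SobH N m H) {x : ℝ}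
    (hx : x ∈ Ioo 0 T) : ContinuousWithinAt (EE N vr) (Ioi x) x := by
  obtain ⟨b, hb1, hb2⟩ := exists_between hx.2
  have hl := E_lsc h hx.1 hb2 (c := fun _ => 1) continuousOn_const (fun _ _ => one_pos)
  simp only [one_mul] at hl
  have hx1 := hl x ⟨le_rfl, hb1.le⟩
  have hnb : 𝓝[Icc x b] x = 𝓝[≥] x := nhdsWithin_Icc_eq_nhdsGE hb1
  have hs : ContinuousWithinAt (fun t => √(EE N vr t)) (Ioi x) x := by
    refine tendsto_order.2 ⟨fun y hy => ?_, fun y hy => ?_⟩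
    · have := hx1 y hy
      rw [hnb] at this
      exact this.filter_mono (nhdsWithin_mono _ Ioi_subset_Ici_self)
    · filter_upwards [Ioo_mem_nhdsGT hb1] with t ht
      exact lt_of_le_of_lt (E_anti hN hm0 h hH hx.1 ht.1.le (ht.2.trans hb2)) hy
  refine (hs.pow 2).congr (fun t _ => ?_) ?_ <;> simp [Real.sq_sqrt (EE_nonneg _)]

lemma I_cont (hN : 2 ≤ N) (hm0 : 0 < m) (h : CoreSol N m T u vr ut) (hH : SobH N m H) {a b : ℝ}
    (ha : 0 < a) (hab : a ≤ b) (hb : b < T) : ContinuousOn (II N m u) (Icc a b) := by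
  have h1 := (I_identity hN hm0 h hH ha hab hb).1
  have h2 : ContinuousOn (fun t => II N m u a - (m + 1) * ∫ τ in a..t, EE N vr τ) (Icc a b) := by
    have := intervalIntegral.continuousOn_primitive_interval' h1 left_mem_uIcc
    rw [uIcc_of_le hab] at this
    exact continuousOn_const.sub (continuousOn_const.mul this)
  refine h2.congr fun t ht => ?_
  have := (I_identity hN hm0 h hH ha ht.1 (ht.2.trans_lt hb)).2
  simp only; linarith

lemma I_rderiv (hN : 2 ≤ N) (hm0 : 0 < m) (h : CoreSol N m T u vr ut) (hH : SobH N m H) {x : ℝ}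
    (hx : x ∈ Ioo 0 T) : HasDerivWithinAt (II N m u) (-((m + 1) * EE N vr x)) (Ioi x) x := by
  obtain ⟨b, hb1, hb2⟩ := exists_between hx.2
  have hi := (I_identity hN hm0 h hH hx.1 hb1.le hb2).1
  have hd : HasDerivWithinAt (fun t => ∫ τ in x..t, EE N vr τ) (EE N vr x) (Ici x) x := by
    refine intervalIntegral.integral_hasDerivWithinAt_right (t := Ioi x) (by simp) ?_
      (E_rc hN hm0 h hH hx)
    refine ⟨Ioc x b, Ioc_mem_nhdsGT hb1, ?_⟩
    rw [intervalIntegrable_iff_integrableOn_Ioc_of_le hb1.le] at hi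
    exact hi.aestronglyMeasurable
  have hd2 := ((hd.mono Ioi_subset_Ici_self).const_mul (-(m + 1))).const_add (II N m u x)
  refine (hd2.congr_of_eventuallyEq ?_ (by simp)).congr_deriv (by ring)
  filter_upwards [Ioo_mem_nhdsGT hb1] with t ht
  have := (I_identity hN hm0 h hH hx.1 ht.1.le (ht.2.trans hb2)).2
  linarith

lemma I_rpow_identity (hN : 2 ≤ N) (hm0 : 0 < m) (h : CoreSol N m T u vr ut) (hH : SobH N m H) {a b : ℝ}
    (ha : 0 < a) (hab : a ≤ b) (hb : b < T) (α : ℝ) :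
    IntervalIntegrable (fun t => II N m u t ^ (α - 1) * EE N vr t) volume a b ∧
    II N m u a ^ α - II N m u b ^ α = (m + 1) * α * ∫ t in a..b, II N m u t ^ (α - 1) * EE N vr t := by
  have hI : Icc a b ⊆ Ioo 0 T := fun x hx => ⟨ha.trans_le hx.1, hx.2.trans_lt hb⟩
  have hc := I_cont hN hm0 h hH ha hab hb
  have hne : ∀ t ∈ Icc a b, II N m u t ≠ 0 := fun t ht => (I_pos hm0 h hH (hI ht)).ne'
  have hi : IntervalIntegrable (fun t => II N m u t ^ (α - 1) * EE N vr t) volume a b := by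
    refine (I_identity hN hm0 h hH ha hab hb).1.continuousOn_mul ?_
    rw [uIcc_of_le hab]
    exact hc.rpow_const fun t ht => Or.inl (hne t ht)
  refine ⟨hi, ?_⟩
  have := intervalIntegral.integral_eq_sub_of_hasDeriv_right_of_le (f := fun t => II N m u t ^ α)
    (f' := fun t => -((m + 1) * α) * (II N m u t ^ (α - 1) * EE N vr t)) hab
    (hc.rpow_const fun t ht => Or.inl (hne t ht)) (fun x hx => by
      refine ((I_rderiv hN hm0 h hH (hI (Ioo_subset_Icc_self hx))).rpow_const (p := α)
        (Or.inl (hne x (Ioo_subset_Icc_self hx)))).congr_deriv ?_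
      ring) (hi.const_mul _)
  rw [intervalIntegral.integral_const_mul] at this
  linarith

noncomputable def QQ (N : ℕ) (m : ℝ) (u vr : ℝ → ℝ → ℝ) (t : ℝ) : ℝ :=
  II N m u t ^ (-(m / (m + 1))) * √(EE N vr t)

lemma Q_nonneg (hm0 : 0 < m) (h : CoreSol N m T u vr ut) (hH : SobH N m H) {t : ℝ} (ht : t ∈ Ioo 0 T) :
    0 ≤ QQ N m u vr t :=
  mul_nonneg (Real.rpow_nonneg (I_pos hm0 h hH ht).le _) (Real.sqrt_nonneg _)

lemma Q_sq (hm0 : 0 < m) (h : CoreSol N m T u vr ut) (hH : SobH N m H) {t : ℝ} (ht : t ∈ Ioo 0 T) :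
    QQ N m u vr t ^ 2 = II N m u t ^ (-(2 * m / (m + 1))) * EE N vr t := by
  rw [QQ, mul_pow, Real.sq_sqrt (EE_nonneg _), ← Real.rpow_natCast, ← Real.rpow_mul (I_pos hm0 h hH ht).le]
  congr 2; push_cast; ring

lemma Q_anti (hN : 2 ≤ N) (hm0 : 0 < m) (h : CoreSol N m T u vr ut) (hH : SobH N m H) {a b : ℝ}
    (ha : 0 < a) (hab : a ≤ b) (hb : b < T) : QQ N m u vr b ≤ QQ N m u vr a := by
  have hI : Icc a b ⊆ Ioo 0 T := fun x hx => ⟨ha.trans_le hx.1, hx.2.trans_lt hb⟩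
  have hc := I_cont hN hm0 h hH ha hab hb
  have hp : ∀ t ∈ Icc a b, 0 < II N m u t := fun t ht => (I_pos hm0 h hH (hI ht))
  have f1 : ∀ t ∈ Icc a b, QQ N m u vr t * II N m u t ^ (m / (m + 1)) = √(EE N vr t) := by
    intro t ht
    rw [QQ, Real.rpow_neg (hp t ht).le]
    have := Real.rpow_pos_of_pos (hp t ht) (m / (m + 1))
    field_simp
  have e0 : 1 / (m + 1) - 1 = -(m / (m + 1)) := by field_simp; ring
  have f2 : ∀ t ∈ Icc a b, QQ N m u vr t ^ 2 * II N m u t ^ (m / (m + 1)) =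
      II N m u t ^ (1 / (m + 1) - 1) * EE N vr t := by
    intro t ht
    rw [sq, mul_assoc, f1 t ht, QQ, mul_assoc, Real.mul_self_sqrt (EE_nonneg _), e0]
  refine order_lemma (f := QQ N m u vr) (ρ := fun t => II N m u t ^ (m / (m + 1))) hab ?_ ?_ ?_ ?_ ?_ ?_
  · exact E_lsc h ha hb (hc.rpow_const fun t ht => Or.inl (hp t ht).ne')
      (fun t ht => Real.rpow_pos_of_pos (hp t ht) _)
  · exact fun t ht => Q_nonneg hm0 h hH (hI ht)
  · exact fun t ht => Real.rpow_pos_of_pos (hp t ht) _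
  · refine (cross_ineq hN hm0 h hH ha hab hb).1.congr fun t ht => ?_
    rw [uIoc_of_le hab] at ht
    exact (f1 t (Ioc_subset_Icc_self ht)).symm
  · refine (I_rpow_identity hN hm0 h hH ha hab hb (1 / (m + 1))).1.congr fun t ht => ?_
    rw [uIoc_of_le hab] at ht
    exact (f2 t (Ioc_subset_Icc_self ht)).symm
  · intro t ht
    have ht0 : 0 < t := ha.trans_le ht.1
    have hta : t ∈ Icc a b := ⟨ht.1, ht.2.le⟩
    have hsub : ∀ s ∈ uIcc t b, s ∈ Icc a b := fun s hs => by
      rw [uIcc_of_le ht.2.le] at hs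
      exact ⟨ht.1.trans hs.1, hs.2⟩
    rw [intervalIntegral.integral_congr fun s hs => f2 s (hsub s hs),
      intervalIntegral.integral_congr fun s hs => f1 s (hsub s hs)]
    have id := (I_rpow_identity hN hm0 h hH ht0 ht.2.le hb (1 / (m + 1))).2
    have e1 : (m + 1) * (1 / (m + 1)) = 1 := by field_simp
    rw [e1, one_mul] at id
    rw [← id, QQ]
    have cr := (cross_ineq hN hm0 h hH ht0 ht.2.le hb).2
    have hA2 : (II N m u t ^ (1 / (m + 1))) ^ m = II N m u t ^ (m / (m + 1)) := by
      rw [← Real.rpow_mul (hp t hta).le]; congr 1; ring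
    rw [hA2] at cr
    rw [Real.rpow_neg (hp t hta).le, mul_assoc, inv_mul_eq_div,
      le_div_iff₀ (Real.rpow_pos_of_pos (hp t hta) _)]
    linarith

end core2

section core3
variable {N : ℕ} {m T : ℝ} {u vr ut : ℝ → ℝ → ℝ} {H : ℝ → ℝ}

lemma I_tendsto (hm0 : 0 < m) (hT : 0 < T) (h : CoreSol N m T u vr ut) (hH : SobH N m H) :
    Tendsto (II N m u) (𝓝[<] T) (𝓝 0) := by
  obtain ⟨C, hC⟩ := h.bdd (T / 2) ⟨by linarith, by linarith⟩
  have hev : ∀ᶠ t in 𝓝[<] T, t ∈ Ico (T / 2) T := Ico_mem_nhdsLT (by linarith)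
  have hz : (0:ℝ) = ∫ r in Ioi (0:ℝ), (0:ℝ) := by simp
  rw [hz]
  refine tendsto_integral_filter_of_dominated_convergence (fun r => C ^ ((m + 1) / m / 2) * H r) ?_ ?_
    (hH.2.1.const_mul _) ?_
  · exact hev.mono fun t ht => um_meas hm0 h ⟨by linarith [ht.1], ht.2.le⟩
  · refine hev.mono fun t ht => ae_Ioi fun r hr => ?_
    have htT : t ∈ Ioo 0 T := ⟨by linarith [ht.1], ht.2⟩
    rw [Real.norm_of_nonneg (mul_nonneg (Real.rpow_nonneg (h.pos r (le_of_lt hr) t htT).le _)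
      (pow_pos (sinh_pos' hr) _).le)]
    refine (u_pt hm0 h hH htT hr).trans ?_
    exact mul_le_mul_of_nonneg_right (Real.rpow_le_rpow (EE_nonneg t) (hC t ht).2 (by positivity)) (hH.1 r hr)
  · refine ae_Ioi fun r hr => ?_
    have c1 : ContinuousOn (fun t => u r t) (Icc 0 T) :=
      h.c_u.comp (f := fun t : ℝ => (r, t)) (by fun_prop) (fun t ht => ⟨le_of_lt hr, ht⟩)
    have c2 : Tendsto (fun t => u r t) (𝓝[<] T) (𝓝 0) := by
      have := c1 T ⟨hT.le, le_rfl⟩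
      have h2 : Tendsto (fun t => u r t) (𝓝[Icc 0 T] T) (𝓝 (u r T)) := this
      rw [h.ext r (le_of_lt hr)] at h2
      refine h2.mono_left ?_
      rw [← nhdsWithin_Ico_eq_nhdsLT hT]
      exact nhdsWithin_mono _ Ico_subset_Icc_self
    have c3 := (c2.rpow_const (p := m + 1) (Or.inr (by linarith))).mul_const (Real.sinh r ^ (N - 1))
    rwa [Real.zero_rpow (by linarith), zero_mul] at c3

lemma g_identity (hN : 2 ≤ N) (hm0 : 0 < m) (h : CoreSol N m T u vr ut) (hH : SobH N m H) {a b : ℝ}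
    (ha : 0 < a) (hab : a ≤ b) (hb : b < T) :
    IntervalIntegrable (fun t => QQ N m u vr t ^ 2) volume a b ∧
    II N m u a ^ ((1 - m) / (m + 1)) - II N m u b ^ ((1 - m) / (m + 1)) =
      (1 - m) * ∫ t in a..b, QQ N m u vr t ^ 2 := by
  have hI : Icc a b ⊆ Ioo 0 T := fun x hx => ⟨ha.trans_le hx.1, hx.2.trans_lt hb⟩
  obtain ⟨i1, i2⟩ := I_rpow_identity hN hm0 h hH ha hab hb ((1 - m) / (m + 1))
  have e : (1 - m) / (m + 1) - 1 = -(2 * m / (m + 1)) := by field_simp; ring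
  have e1 : (m + 1) * ((1 - m) / (m + 1)) = 1 - m := by field_simp
  rw [e1] at i2
  rw [e] at i1 i2
  constructor
  · refine i1.congr fun t ht => ?_
    rw [uIoc_of_le hab] at ht
    exact (Q_sq hm0 h hH (hI (Ioc_subset_Icc_self ht))).symm
  · rw [i2]
    congr 1
    refine intervalIntegral.integral_congr fun t ht => ?_
    rw [uIcc_of_le hab] at ht
    exact (Q_sq hm0 h hH (hI ht)).symm

lemma g_lower (hN : 2 ≤ N) (hm0 : 0 < m) (hm1 : m < 1) (h : CoreSol N m T u vr ut) (hH : SobH N m H) {a b c : ℝ}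
    (ha : 0 < a) (hab : a ≤ b) (hb : b < T) (hc : ∀ t ∈ Icc a b, c ≤ QQ N m u vr t ^ 2) :
    (1 - m) * ((b - a) * c) ≤ II N m u a ^ ((1 - m) / (m + 1)) - II N m u b ^ ((1 - m) / (m + 1)) := by
  obtain ⟨i1, i2⟩ := g_identity hN hm0 h hH ha hab hb
  rw [i2]
  refine mul_le_mul_of_nonneg_left ?_ (by linarith)
  have := intervalIntegral.integral_mono_on hab (intervalIntegrable_const (c := c)) i1 hc
  rwa [intervalIntegral.integral_const, smul_eq_mul] at this

lemma g_upper (hN : 2 ≤ N) (hm0 : 0 < m) (hm1 : m < 1) (h : CoreSol N m T u vr ut) (hH : SobH N m H) {a b c : ℝ}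
    (ha : 0 < a) (hab : a ≤ b) (hb : b < T) (hc : ∀ t ∈ Icc a b, QQ N m u vr t ^ 2 ≤ c) :
    II N m u a ^ ((1 - m) / (m + 1)) - II N m u b ^ ((1 - m) / (m + 1)) ≤ (1 - m) * ((b - a) * c) := by
  obtain ⟨i1, i2⟩ := g_identity hN hm0 h hH ha hab hb
  rw [i2]
  refine mul_le_mul_of_nonneg_left ?_ (by linarith)
  have := intervalIntegral.integral_mono_on hab i1 (intervalIntegrable_const (c := c)) hc
  rwa [intervalIntegral.integral_const, smul_eq_mul] at this

lemma lower_bound (hN : 2 ≤ N) (hm0 : 0 < m) (hm1 : m < 1) (hH : SobH N m H) :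
    ∃ C > 0, ∀ {T : ℝ} {u vr ut : ℝ → ℝ → ℝ}, 
      CoreSol N m T u vr ut → ∀ t ∈ Ioo 0 T,
      C * (T - t) ^ (1 / (1 - m)) ≤ II N m u t ^ (1 / (m + 1)) := by
  obtain ⟨c, hc, hl⟩ := E_lower hm0 hH
  have hm1' : 0 < 1 - m := by linarith
  refine ⟨((1 - m) * c) ^ (1 / (1 - m)), Real.rpow_pos_of_pos (by positivity) _, ?_⟩
  intro T u vr ut h t ht
  have hIt := I_pos hm0 h hH ht
  have hQ : ∀ s ∈ Ioo 0 T, c ≤ QQ N m u vr s ^ 2 := by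
    intro s hs
    have hI := I_pos hm0 h hH hs
    rw [Q_sq hm0 h hH hs, Real.rpow_neg hI.le, inv_mul_eq_div, le_div_iff₀ (Real.rpow_pos_of_pos hI _)]
    exact hl h s hs
  have h1 : ∀ᶠ b in 𝓝[<] T, (1 - m) * ((b - t) * c) ≤ II N m u t ^ ((1 - m) / (m + 1)) := by
    filter_upwards [Ico_mem_nhdsLT ht.2] with b hb
    have := g_lower hN hm0 hm1 h hH ht.1 hb.1 hb.2 (c := c)
      (fun s hs => hQ s ⟨ht.1.trans_le hs.1, hs.2.trans_lt hb.2⟩)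
    have h2 := Real.rpow_nonneg (I_pos hm0 h hH ⟨ht.1.trans_le hb.1, hb.2⟩).le ((1 - m) / (m + 1))
    linarith
  have h2 : (1 - m) * ((T - t) * c) ≤ II N m u t ^ ((1 - m) / (m + 1)) := by
    refine le_of_tendsto (f := fun b => (1 - m) * ((b - t) * c)) (x := 𝓝[<] T) ?_ h1
    refine Tendsto.mono_left (Continuous.tendsto (by fun_prop) T) nhdsWithin_le_nhds
  have hTt : 0 < T - t := by linarith [ht.2]
  have h3 := Real.rpow_le_rpow (by positivity) h2 (z := 1 / (1 - m)) (by positivity)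
  rw [← Real.rpow_mul hIt.le] at h3
  have e : (1 - m) / (m + 1) * (1 / (1 - m)) = 1 / (m + 1) := by field_simp
  rw [e] at h3
  rw [← Real.mul_rpow (by positivity) hTt.le]
  convert h3 using 2; ring

lemma upper_bound (hN : 2 ≤ N) (hm0 : 0 < m) (hm1 : m < 1) (hT : 0 < T) (h : CoreSol N m T u vr ut) (hH : SobH N m H)
    (h0 : ∀ t ∈ Ioo 0 T, II N m u t ≤ II N m u 0) {t : ℝ} (ht : t ∈ Ioo 0 T) :
    II N m u t ^ (1 / (m + 1)) ≤ (1 - t / T) ^ (1 / (1 - m)) * II N m u 0 ^ (1 / (m + 1)) := by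
  have hm1' : 0 < 1 - m := by linarith
  have hIt := I_pos hm0 h hH ht
  have hI0 : 0 < II N m u 0 := hIt.trans_le (h0 t ht)
  have hα : 0 < (1 - m) / (m + 1) := by positivity
  set α := (1 - m) / (m + 1) with hαd
  set q := QQ N m u vr t ^ 2
  have hTt : 0 < T - t := by linarith [ht.2]
  have s1 : II N m u t ^ α ≤ (1 - m) * ((T - t) * q) := by
    have l1 : Tendsto (fun b => (1 - m) * ((b - t) * q) + II N m u b ^ α) (𝓝[<] T)
        (𝓝 ((1 - m) * ((T - t) * q) + 0)) := by
      refine Tendsto.add (Tendsto.mono_left (Continuous.tendsto (by fun_prop) T) nhdsWithin_le_nhds) ?_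
      have := (I_tendsto hm0 hT h hH).rpow_const (p := α) (Or.inr hα.le)
      rwa [Real.zero_rpow hα.ne'] at this
    rw [add_zero] at l1
    refine ge_of_tendsto l1 ?_
    filter_upwards [Ico_mem_nhdsLT ht.2] with b hb
    have := g_upper hN hm0 hm1 h hH ht.1 hb.1 hb.2 (c := q) (fun s hs =>
      pow_le_pow_left₀ (Q_nonneg hm0 h hH ⟨ht.1.trans_le hs.1, hs.2.trans_lt hb.2⟩)
        (Q_anti hN hm0 h hH ht.1 hs.1 (hs.2.trans_lt hb.2)) 2)
    linarith
  have s2 : (1 - m) * ((t - 0) * q) ≤ II N m u 0 ^ α - II N m u t ^ α := by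
    refine le_of_tendsto (f := fun a => (1 - m) * ((t - a) * q)) (x := 𝓝[>] 0)
      (Tendsto.mono_left (Continuous.tendsto (by fun_prop) 0) nhdsWithin_le_nhds) ?_
    filter_upwards [Ioc_mem_nhdsGT ht.1] with a ha
    have := g_lower hN hm0 hm1 h hH ha.1 ha.2 ht.2 (c := q) (fun s hs =>
      pow_le_pow_left₀ (Q_nonneg hm0 h hH ht)
        (Q_anti hN hm0 h hH (ha.1.trans_le hs.1) hs.2 ht.2) 2)
    have haT : a ∈ Ioo 0 T := ⟨ha.1, ha.2.trans_lt ht.2⟩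
    have := Real.rpow_le_rpow (I_pos hm0 h hH haT).le (h0 a haT) hα.le
    linarith
  have s3 : II N m u t ^ α ≤ (1 - t / T) * II N m u 0 ^ α := by
    have e : (1 - t / T) = (T - t) / T := by field_simp
    rw [e, div_mul_eq_mul_div, le_div_iff₀ hT]
    have p1 := mul_le_mul_of_nonneg_left s1 ht.1.le
    have p2 := mul_le_mul_of_nonneg_left s2 hTt.le
    linarith
  have h1t : 0 ≤ 1 - t / T := by
    rw [sub_nonneg, div_le_one hT]; exact ht.2.le
  have h3 := Real.rpow_le_rpow (Real.rpow_nonneg hIt.le _) s3 (z := 1 / (1 - m)) (by positivity)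
  rw [← Real.rpow_mul hIt.le, Real.mul_rpow h1t (Real.rpow_nonneg hI0.le _), ← Real.rpow_mul hI0.le] at h3
  have e : α * (1 / (1 - m)) = 1 / (m + 1) := by rw [hαd]; field_simp
  rwa [e] at h3

end core3

lemma bdd_prod_int {K : ℝ → ℝ → ℝ} {a b R M : ℝ}
    (hK : ContinuousOn (fun p : ℝ × ℝ => K p.1 p.2) (Ioi 0 ×ˢ Icc a b))
    (hM : ∀ r ∈ Ioc 0 R, ∀ τ ∈ Icc a b, |K r τ| ≤ M) :
    Integrable (fun p : ℝ × ℝ => K p.1 p.2)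
      ((volume.restrict (Ioc 0 R)).prod (volume.restrict (Ioc a b))) := by
  refine (integrable_const M).mono' ?_ ?_
  · rw [Measure.prod_restrict]
    exact (hK.mono (prod_mono (fun r hr => hr.1) Ioc_subset_Icc_self)).aestronglyMeasurable
      (measurableSet_Ioc.prod measurableSet_Ioc)
  · rw [Measure.prod_restrict]
    refine (ae_restrict_iff' (measurableSet_Ioc.prod measurableSet_Ioc)).2 (Eventually.of_forall ?_)
    rintro ⟨r, τ⟩ ⟨h1, h2⟩
    exact hM r h1 τ (Ioc_subset_Icc_self h2)

lemma bdd_int_left {K : ℝ → ℝ → ℝ} {a b R M : ℝ} (hab : a ≤ b) (hR : 0 ≤ R)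
    (hK : ContinuousOn (fun p : ℝ × ℝ => K p.1 p.2) (Ioi 0 ×ˢ Icc a b))
    (hM : ∀ r ∈ Ioc 0 R, ∀ τ ∈ Icc a b, |K r τ| ≤ M) :
    IntervalIntegrable (fun r => ∫ τ in a..b, K r τ) volume 0 R := by
  have := (bdd_prod_int hK hM).integral_prod_left
  rw [intervalIntegrable_iff_integrableOn_Ioc_of_le hR]
  simp_rw [intervalIntegral.integral_of_le hab]
  exact this

lemma abs_aux1 {X y v g Z M V g1 : ℝ} (hX : |X| ≤ Z) (hy : |y| ≤ M) (hv : |v| ≤ V) (hg : |g| ≤ g1) :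
    |X * y ^ 2 - v ^ 2 * g / 2| ≤ Z * M ^ 2 + V ^ 2 * g1 / 2 := by
  have hZ : 0 ≤ Z := (abs_nonneg _).trans hX
  have hM : 0 ≤ M := (abs_nonneg _).trans hy
  have hV : 0 ≤ V := (abs_nonneg _).trans hv
  refine (abs_sub _ _).trans ?_
  rw [abs_mul X, abs_pow, abs_div, abs_mul (v ^ 2), abs_pow, abs_of_pos (two_pos : (0:ℝ) < 2)]
  gcongr

lemma abs_aux2 {X y v g Z M V g1 : ℝ} (hX : |X| ≤ Z) (hy : |y| ≤ M) (hv : |v| ≤ V) (hg : |g| ≤ g1) :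
    |X * y * v - v ^ 2 * g / 2| ≤ Z * M * V + V ^ 2 * g1 / 2 := by
  have hZ : 0 ≤ Z := (abs_nonneg _).trans hX
  have hM : 0 ≤ M := (abs_nonneg _).trans hy
  have hV : 0 ≤ V := (abs_nonneg _).trans hv
  refine (abs_sub _ _).trans ?_
  rw [abs_mul (X * y), abs_mul X, abs_div, abs_mul (v ^ 2), abs_pow, abs_of_pos (two_pos : (0:ℝ) < 2)]
  gcongr

section core4
variable {N : ℕ} {m T : ℝ} {u vr ut : ℝ → ℝ → ℝ}

lemma um_time (hm0 : 0 < m) (h : CoreSol N m T u vr ut) {a b r : ℝ} (ha : 0 < a) (hab : a ≤ b)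
    (hb : b < T) (hr : 0 < r) :
    ∫ τ in a..b, ut r τ * u r τ ^ m = (u r b ^ (m + 1) - u r a ^ (m + 1)) / (m + 1) := by
  have hI : Icc a b ⊆ Ioo 0 T := fun x hx => ⟨ha.trans_le hx.1, hx.2.trans_lt hb⟩
  have hIc : Icc a b ⊆ Icc 0 T := hI.trans Ioo_subset_Icc_self
  have hP : Ioi (0:ℝ) ×ˢ Icc a b ⊆ Ioi (0:ℝ) ×ˢ Ioo 0 T := prod_mono le_rfl hI
  have hP' : Ioi (0:ℝ) ×ˢ Icc a b ⊆ Ici (0:ℝ) ×ˢ Icc 0 T := prod_mono Ioi_subset_Ici_self hIc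
  have hd : ∀ τ ∈ uIcc a b, HasDerivAt (fun τ => u r τ ^ (m + 1) / (m + 1)) (ut r τ * u r τ ^ m) τ := by
    intro τ hτ
    rw [uIcc_of_le hab] at hτ
    have := ((h.hd_t r hr τ (hI hτ)).rpow_const (p := m + 1)
      (Or.inl (h.pos r (le_of_lt hr) τ (hI hτ)).ne')).div_const (m + 1)
    refine this.congr_deriv ?_
    rw [add_sub_cancel_right]; field_simp
  rw [intervalIntegral.integral_eq_sub_of_hasDerivAt hd]
  · ring
  · apply ContinuousOn.intervalIntegrable
    rw [uIcc_of_le hab]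
    exact ((h.c_ut.mono hP).mul (h.c_v.mono hP')).comp (f := fun τ : ℝ => (r, τ)) (by fun_prop)
      (fun τ hτ => ⟨hr, hτ⟩)

lemma cutoff_ineq (hN : 2 ≤ N) (hm0 : 0 < m) (h : CoreSol N m T u vr ut) {ζ ζ' G G' B D : ℝ → ℝ}
    {R a b : ℝ} (hR : 1 ≤ R) (ha : 0 < a) (hab : a ≤ b) (hb : b < T)
    (hζ : ∀ r > 0, HasDerivAt ζ (ζ' r) r) (cζ : Continuous ζ)
    (hG : ∀ r > 0, HasDerivAt G (G' r) r) (cG : Continuous G) (cG' : Continuous G')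
    (cB : Continuous B) (cD : Continuous D)
    (hwz : ∀ r > 0, Real.sinh r ^ (N - 1) * ζ' r = G r) (hGB : ∀ r, G r = Real.sinh r * B r)
    (hζR : ζ R = 0) (hGR : G R = 0) (hζ0 : ∀ r ∈ Icc 0 R, 0 ≤ ζ r)
    (hD : ∀ r ∈ Ioc 0 R, G' r ≤ D r) :
    ∫ r in (0:ℝ)..R, (Real.sinh r ^ (N - 1) * ζ r * ((u r b ^ (m + 1) - u r a ^ (m + 1)) / (m + 1))
      - ∫ τ in a..b, (u r τ ^ m) ^ 2 * D r / 2) ≤ 0 := by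
  have hI : Icc a b ⊆ Ioo 0 T := fun x hx => ⟨ha.trans_le hx.1, hx.2.trans_lt hb⟩
  have hIc : Icc a b ⊆ Icc 0 T := hI.trans Ioo_subset_Icc_self
  have hP : Ioi (0:ℝ) ×ˢ Icc a b ⊆ Ioi (0:ℝ) ×ˢ Ioo 0 T := prod_mono le_rfl hI
  have hP' : Ioi (0:ℝ) ×ˢ Icc a b ⊆ Ici (0:ℝ) ×ˢ Icc 0 T := prod_mono Ioi_subset_Ici_self hIc
  have hR0 : 0 < R := by linarith
  have cvr := h.c_vr.mono hP
  have cut := h.c_ut.mono hP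
  have cv := h.c_v.mono hP'
  have cfst : ∀ {g : ℝ → ℝ}, Continuous g → ContinuousOn (fun p : ℝ × ℝ => g p.1) (Ioi (0:ℝ) ×ˢ Icc a b) :=
    fun hg => (hg.comp continuous_fst).continuousOn
  have csh : Continuous (fun r => Real.sinh r ^ (N - 1)) := by fun_prop
  -- bounds
  have bd : ∀ {g : ℝ → ℝ}, Continuous g → ∃ M, 0 ≤ M ∧ ∀ r ∈ Icc 0 R, |g r| ≤ M := by
    intro g hg
    obtain ⟨M, hM⟩ := (isCompact_Icc (a := (0:ℝ)) (b := R)).exists_bound_of_continuousOn hg.continuousOn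
    exact ⟨M, (norm_nonneg _).trans (hM 0 ⟨le_rfl, hR0.le⟩), hM⟩
  obtain ⟨V, hV⟩ := (isCompact_Icc.prod isCompact_Icc : IsCompact (Icc (0:ℝ) R ×ˢ Icc 0 T)).exists_bound_of_continuousOn
    (h.c_v.mono (prod_mono (fun x hx => hx.1) le_rfl))
  have hV' : ∀ r ∈ Icc 0 R, ∀ τ ∈ Icc a b, |u r τ ^ m| ≤ V := fun r hr τ hτ => hV (r, τ) ⟨hr, hIc hτ⟩
  have hV0 : 0 ≤ V := (abs_nonneg _).trans (hV' 0 ⟨le_rfl, hR0.le⟩ a ⟨le_rfl, hab⟩)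
  obtain ⟨M1, hM1⟩ := h.bd0 a b ha hb
  obtain ⟨M2, hM2⟩ := (isCompact_Icc.prod isCompact_Icc : IsCompact (Icc (1:ℝ) R ×ˢ Icc a b)).exists_bound_of_continuousOn
    (cvr.mono (prod_mono (fun x hx => lt_of_lt_of_le one_pos hx.1) le_rfl))
  have hvrb : ∀ r ∈ Ioc 0 R, ∀ τ ∈ Icc a b, |vr r τ| ≤ max M1 M2 := by
    intro r hr τ hτ
    rcases le_total r 1 with h1 | h1
    · exact (hM1 r ⟨hr.1, h1⟩ τ hτ).trans (le_max_left _ _)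
    · exact (hM2 (r, τ) ⟨⟨h1, hr.2⟩, hτ⟩).trans (le_max_right _ _)
  set M := max M1 M2
  have hM0 : 0 ≤ M := (abs_nonneg _).trans (hvrb 1 ⟨one_pos, hR⟩ a ⟨le_rfl, hab⟩)
  have cK : ContinuousOn (fun p : ℝ × ℝ => Real.sinh p.1 ^ (N - 1) * ζ p.1 * vr p.1 p.2 ^ 2
      - (u p.1 p.2 ^ m) ^ 2 * G' p.1 / 2) (Ioi 0 ×ˢ Icc a b) :=
    (((cfst csh).mul (cfst cζ)).mul (cvr.pow 2)).sub (((cv.pow 2).mul (cfst cG')).div_const 2)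
  obtain ⟨Z, hZ0, hZ⟩ := bd (csh.mul cζ)
  obtain ⟨g1, hg10, hg1⟩ := bd cG'
  obtain ⟨d1, hd10, hd1⟩ := bd cD
  have iK := bdd_int_left (R := R) (K := fun r τ => Real.sinh r ^ (N - 1) * ζ r * vr r τ ^ 2
      - (u r τ ^ m) ^ 2 * G' r / 2) (M := Z * M ^ 2 + V ^ 2 * g1 / 2) hab hR0.le cK (by
    intro r hr τ hτ
    have hr' : r ∈ Icc 0 R := Ioc_subset_Icc_self hr
    exact abs_aux1 (hZ r hr') (hvrb r hr τ hτ) (hV' r hr' τ hτ) (hg1 r hr'))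
  have cvD : ContinuousOn (fun p : ℝ × ℝ => (u p.1 p.2 ^ m) ^ 2 * D p.1 / 2) (Ioi 0 ×ˢ Icc a b) :=
    ((cv.pow 2).mul (cfst cD)).div_const 2
  have iD := bdd_int_left (R := R) (K := fun r τ => (u r τ ^ m) ^ 2 * D r / 2) (M := V ^ 2 * d1 / 2)
    hab hR0.le cvD (by
    intro r hr τ hτ
    have hr' : r ∈ Icc 0 R := Ioc_subset_Icc_self hr
    rw [abs_div, abs_mul, abs_pow, abs_of_pos (two_pos : (0:ℝ) < 2)]
    have := hV' r hr' τ hτ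
    have := hd1 r hr'
    gcongr)
  have ium : ∀ t ∈ Icc 0 T, ContinuousOn (fun r => u r t ^ (m + 1)) (Ici 0) := fun t ht =>
    (u_sec h ht).rpow_const fun _ _ => Or.inr (by linarith)
  have iU : IntervalIntegrable (fun r => Real.sinh r ^ (N - 1) * ζ r *
      ((u r b ^ (m + 1) - u r a ^ (m + 1)) / (m + 1))) volume 0 R := by
    apply ContinuousOn.intervalIntegrable
    rw [uIcc_of_le hR0.le]
    refine (csh.mul cζ).continuousOn.mul (ContinuousOn.div_const ?_ _)
    exact ((ium b (hIc ⟨hab, le_rfl⟩)).sub (ium a (hIc ⟨le_rfl, hab⟩))).mono fun x hx => hx.1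
  have sec : ∀ {k : ℝ → ℝ → ℝ}, ContinuousOn (fun p : ℝ × ℝ => k p.1 p.2) (Ioi 0 ×ˢ Icc a b) →
      ∀ r > 0, IntervalIntegrable (fun τ => k r τ) volume a b := by
    intro k hk r hr
    apply ContinuousOn.intervalIntegrable
    rw [uIcc_of_le hab]
    exact hk.comp (f := fun τ : ℝ => (r, τ)) (by fun_prop) (fun τ hτ => ⟨hr, hτ⟩)
  have hsplit : ∀ r > 0, ∫ τ in a..b, (Real.sinh r ^ (N - 1) * ζ r * (ut r τ * u r τ ^ m) +
      (Real.sinh r ^ (N - 1) * ζ r * vr r τ ^ 2 - (u r τ ^ m) ^ 2 * G' r / 2)) =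
      Real.sinh r ^ (N - 1) * ζ r * ((u r b ^ (m + 1) - u r a ^ (m + 1)) / (m + 1)) +
      ∫ τ in a..b, (Real.sinh r ^ (N - 1) * ζ r * vr r τ ^ 2 - (u r τ ^ m) ^ 2 * G' r / 2) := by
    intro r hr
    rw [intervalIntegral.integral_add, intervalIntegral.integral_const_mul, um_time hm0 h ha hab hb hr]
    · exact (sec (k := fun r τ => ut r τ * u r τ ^ m) (cut.mul cv) r hr).const_mul _
    · exact sec (k := fun r τ => Real.sinh r ^ (N - 1) * ζ r * vr r τ ^ 2 - (u r τ ^ m) ^ 2 * G' r / 2) cK r hr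
  have iJ : IntervalIntegrable (fun r => ∫ τ in a..b, (Real.sinh r ^ (N - 1) * ζ r * (ut r τ * u r τ ^ m) +
      (Real.sinh r ^ (N - 1) * ζ r * vr r τ ^ 2 - (u r τ ^ m) ^ 2 * G' r / 2))) volume 0 R := by
    refine (iU.add iK).congr fun r hr => ?_
    rw [uIoc_of_le hR0.le] at hr
    exact (hsplit r hr.1).symm
  have key := div_lemma_compact (R := R)
    (F := fun r τ => Real.sinh r ^ (N - 1) * vr r τ * (ζ r * u r τ ^ m) - (u r τ ^ m) ^ 2 * G r / 2)
    (F' := fun r τ => Real.sinh r ^ (N - 1) * ζ r * (ut r τ * u r τ ^ m) +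
      (Real.sinh r ^ (N - 1) * ζ r * vr r τ ^ 2 - (u r τ ^ m) ^ 2 * G' r / 2)) hab hR0 ?_ ?_ ?_ ?_ ?_ iJ
  · refine le_of_le_of_eq ?_ key
    refine intervalIntegral.integral_mono_on_of_le_Ioo hR0.le (iU.sub iD) iJ fun r hr => ?_
    rw [hsplit r hr.1, sub_eq_add_neg, ← intervalIntegral.integral_neg]
    refine add_le_add_right ?_ _
    refine intervalIntegral.integral_mono_on hab
      (sec (k := fun r τ => (u r τ ^ m) ^ 2 * D r / 2) cvD r hr.1).neg
      (sec (k := fun r τ => Real.sinh r ^ (N - 1) * ζ r * vr r τ ^ 2 - (u r τ ^ m) ^ 2 * G' r / 2) cK r hr.1) fun τ hτ => ?_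
    have h1 := hD r ⟨hr.1, hr.2.le⟩
    have h2 := hζ0 r ⟨hr.1.le, hr.2.le⟩
    have h3 := pow_pos (sinh_pos' hr.1) (N - 1)
    have h4 : 0 ≤ Real.sinh r ^ (N - 1) * ζ r * vr r τ ^ 2 := by positivity
    have h5 := mul_le_mul_of_nonneg_left h1 (sq_nonneg (u r τ ^ m))
    linarith
  · intro r hr τ hτ
    have d1 := (h.hd_flux r hr τ (hI hτ)).mul ((hζ r hr).mul (h.hd_v r hr τ (hI hτ)))
    have d2 := (((h.hd_v r hr τ (hI hτ)).pow 2).mul (hG r hr)).div_const 2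
    refine (d1.sub d2).congr_deriv ?_
    simp only [Pi.mul_apply, Pi.pow_apply]
    rw [← hwz r hr]
    push_cast
    ring
  · exact (((cfst csh).mul cvr).mul ((cfst cζ).mul cv)).sub (((cv.pow 2).mul (cfst cG)).div_const 2)
  · exact ((((cfst csh).mul (cfst cζ)).mul (cut.mul cv))).add cK
  · have csh2 : Continuous (fun r => Real.sinh r ^ (N - 2)) := by fun_prop
    obtain ⟨A, hA0, hA⟩ := bd (csh2.mul cζ)
    obtain ⟨b1, hb10, hb1⟩ := bd cB
    refine ⟨A * M * V + V ^ 2 * b1 / 2, fun r hr τ hτ => ?_⟩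
    have hrR : r ∈ Icc 0 R := ⟨hr.1, hr.2.trans hR⟩
    have e : Real.sinh r ^ (N - 1) = Real.sinh r ^ (N - 2) * Real.sinh r := by
      rw [← pow_succ]; congr 1; omega
    rcases hr.1.eq_or_lt with h0 | h0
    · subst h0
      rw [e, hGB]; simp
    · have hs := sinh_pos' h0
      have e2 : Real.sinh r ^ (N - 1) * vr r τ * (ζ r * u r τ ^ m) - (u r τ ^ m) ^ 2 * G r / 2 =
        ((Real.sinh r ^ (N - 2) * ζ r) * vr r τ * u r τ ^ m - (u r τ ^ m) ^ 2 * B r / 2) * Real.sinh r := by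
        rw [e, hGB]; ring
      rw [e2, abs_mul, abs_of_pos hs]
      exact mul_le_mul_of_nonneg_right (abs_aux2 (hA r hrR) (hvrb r ⟨h0, hrR.2⟩ τ hτ)
        (hV' r hrR τ hτ) (hb1 r hrR)) hs.le
  · intro τ hτ
    simp only [hζR, hGR]; ring

end core4

lemma young_pk {m : ℝ} (hm0 : 0 < m) (hm1 : m < 1) {l : ℕ} (hl1 : 1 ≤ l)
    (hl : ((l : ℝ) + 2) * (2 * m / (m + 1)) ≤ l) {ε : ℝ} (hε : 0 < ε) :
    ∃ K, 0 ≤ K ∧ ∀ x p : ℝ, 0 ≤ x → 0 ≤ p → p ≤ 1 →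
      (x ^ m) ^ 2 * p ^ l ≤ ε + K * (x ^ (m + 1) * p ^ (l + 2)) := by
  set θ := 2 * m / (m + 1) with hθ
  have hθ0 : 0 < θ := by positivity
  have hθ1 : θ < 1 := by rw [hθ, div_lt_one (by linarith)]; linarith
  set y0 := ε ^ (1 / θ) with hy0
  have hy0p : 0 < y0 := Real.rpow_pos_of_pos hε _
  refine ⟨y0 ^ (θ - 1), (Real.rpow_pos_of_pos hy0p _).le, fun x p hx hp hp1 => ?_⟩
  set y := x ^ (m + 1) * p ^ (l + 2) with hy
  have hy00 : 0 ≤ y := by positivity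
  have h1 : (x ^ m) ^ 2 * p ^ l ≤ y ^ θ := by
    rw [hy, Real.mul_rpow (by positivity) (by positivity), ← Real.rpow_mul hx]
    have e : (m + 1) * θ = m * 2 := by rw [hθ]; field_simp
    rw [e, Real.rpow_mul hx]
    have e2 : (x ^ m) ^ (2:ℝ) = (x ^ m) ^ 2 := by norm_cast
    rw [e2]
    refine mul_le_mul_of_nonneg_left ?_ (by positivity)
    rcases hp.eq_or_lt with h0 | h0
    · rw [← h0, zero_pow (by omega)]; positivity
    · rw [← Real.rpow_natCast, ← Real.rpow_natCast, ← Real.rpow_mul hp]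
      refine Real.rpow_le_rpow_of_exponent_ge h0 hp1 ?_
      push_cast; exact hl
  refine h1.trans ?_
  rcases le_or_gt y y0 with h2 | h2
  · have : y ^ θ ≤ ε := by
      refine (Real.rpow_le_rpow hy00 h2 hθ0.le).trans ?_
      rw [hy0, ← Real.rpow_mul hε.le, one_div_mul_cancel hθ0.ne', Real.rpow_one]
    have h3 : 0 ≤ y0 ^ (θ - 1) * y := by positivity
    linarith
  · have hyp : 0 < y := hy0p.trans h2
    have : y ^ θ = y ^ (θ - 1) * y := by
      rw [← Real.rpow_add_one hyp.ne']; congr 1; ring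
    rw [this]
    have h3 : y ^ (θ - 1) ≤ y0 ^ (θ - 1) :=
      Real.rpow_le_rpow_of_nonpos hy0p h2.le (by linarith)
    have := mul_le_mul_of_nonneg_right h3 hy00
    linarith

noncomputable def qi (δ r : ℝ) : ℝ := (1 + δ * Real.cosh r)⁻¹

lemma q_pos {δ : ℝ} (hδ : 0 < δ) (r : ℝ) : 0 < 1 + δ * Real.cosh r := by
  have := Real.cosh_pos r; positivity

lemma qi_pos {δ : ℝ} (hδ : 0 < δ) (r : ℝ) : 0 < qi δ r := inv_pos.2 (q_pos hδ r)

lemma qi_mul {δ : ℝ} (hδ : 0 < δ) (r : ℝ) : qi δ r * (1 + δ * Real.cosh r) = 1 :=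
  inv_mul_cancel₀ (q_pos hδ r).ne'

lemma qi_cont {δ : ℝ} (hδ : 0 < δ) : Continuous (qi δ) := by
  unfold qi
  exact Continuous.inv₀ (by fun_prop) fun r => (q_pos hδ r).ne'

lemma qi_deriv {δ : ℝ} (hδ : 0 < δ) (r : ℝ) :
    HasDerivAt (qi δ) (-(δ * Real.sinh r * qi δ r ^ 2)) r := by
  have := (((Real.hasDerivAt_cosh r).const_mul δ).const_add 1).inv (q_pos hδ r).ne'
  refine this.congr_deriv ?_
  simp only [qi]; field_simp

noncomputable def sd (δ r : ℝ) : ℝ := Real.sinh r * qi δ r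
noncomputable def sd' (δ r : ℝ) : ℝ := Real.cosh r * qi δ r - δ * Real.sinh r ^ 2 * qi δ r ^ 2

lemma sd_deriv {δ : ℝ} (hδ : 0 < δ) (r : ℝ) : HasDerivAt (sd δ) (sd' δ r) r := by
  refine ((Real.hasDerivAt_sinh r).mul (qi_deriv hδ r)).congr_deriv ?_
  simp only [sd']; ring

lemma sd_cont {δ : ℝ} (hδ : 0 < δ) : Continuous (sd δ) := by
  have := qi_cont hδ; unfold sd; fun_prop

lemma sd'_cont {δ : ℝ} (hδ : 0 < δ) : Continuous (sd' δ) := by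
  have := qi_cont hδ; unfold sd'; fun_prop

lemma sd'_nonneg {δ : ℝ} (hδ : 0 < δ) (r : ℝ) : 0 ≤ sd' δ r := by
  have e : sd' δ r = qi δ r ^ 2 * (Real.cosh r + δ) := by
    have h1 := qi_mul hδ r
    have h2 := Real.cosh_sq r
    have h3 : qi δ r = qi δ r ^ 2 * (1 + δ * Real.cosh r) := by rw [sq, mul_assoc, h1, mul_one]
    have h4 : sd' δ r = Real.cosh r * (qi δ r ^ 2 * (1 + δ * Real.cosh r)) - δ * Real.sinh r ^ 2 * qi δ r ^ 2 := by
      rw [← h3]; rfl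
    rw [h4]; linear_combination (qi δ r ^ 2 * δ) * h2
  rw [e]
  have := Real.cosh_pos r
  positivity

lemma sd_nonneg {δ r : ℝ} (hδ : 0 < δ) (hr : 0 ≤ r) : 0 ≤ sd δ r :=
  mul_nonneg (Real.sinh_nonneg_iff.2 hr) (qi_pos hδ r).le

lemma sd_le {δ : ℝ} (hδ : 0 < δ) (r : ℝ) : δ * sd δ r ≤ 1 := by
  rw [← qi_mul hδ r, sd]
  have := qi_pos hδ r
  have h2 := Real.sinh_lt_cosh r
  nlinarith [mul_lt_mul_of_pos_left h2 (mul_pos hδ this)]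

noncomputable def pp (R r : ℝ) : ℝ := 1 - r / R
lemma pp_cont (R : ℝ) : Continuous (pp R) := by unfold pp; fun_prop
lemma pp_deriv (R r : ℝ) : HasDerivAt (pp R) (-(1 / R)) r := by
  have := ((hasDerivAt_id r).div_const R).const_sub 1
  exact this
lemma pp_nonneg {R r : ℝ} (hR : 0 < R) (hr : r ≤ R) : 0 ≤ pp R r := by
  have : r / R ≤ 1 := (div_le_one hR).2 hr
  unfold pp; linarith
lemma pp_le {R r : ℝ} (hR : 0 < R) (hr : 0 ≤ r) : pp R r ≤ 1 := by
  have : 0 ≤ r / R := by positivity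
  unfold pp; linarith

section core5
variable {m T : ℝ} {u vr ut : ℝ → ℝ → ℝ} {j l : ℕ}

lemma cutoff2 (hm0 : 0 < m) (h : CoreSol (j + 2) m T u vr ut) {δ R a b : ℝ} (hδ : 0 < δ)
    (hR : 1 ≤ R) (ha : 0 < a) (hab : a ≤ b) (hb : b < T) :
    ∫ r in (0:ℝ)..R, (sd δ r ^ (j + 1) * pp R r ^ (l + 2) * ((u r b ^ (m + 1) - u r a ^ (m + 1)) / (m + 1))
      - ∫ τ in a..b, (u r τ ^ m) ^ 2 *
        (sd δ r ^ (j + 1) * (((j + 1) * (l + 2) + (l + 2) * (l + 1)) / R) * pp R r ^ l) / 2) ≤ 0 := by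
  have hR0 : 0 < R := by linarith
  have cq := qi_cont hδ
  have cs := sd_cont hδ
  have cs' := sd'_cont hδ
  have cp := pp_cont R
  have hpR : pp R R = 0 := by simp [pp, hR0.ne']
  have := cutoff_ineq (N := j + 2) (by omega) hm0 h hR ha hab hb
    (ζ := fun r => qi δ r ^ (j + 1) * pp R r ^ (l + 2))
    (ζ' := fun r => ((j + 1 : ℝ) * qi δ r ^ j * (-(δ * Real.sinh r * qi δ r ^ 2))) * pp R r ^ (l + 2)
      + qi δ r ^ (j + 1) * ((l + 2 : ℝ) * pp R r ^ (l + 1) * (-(1 / R))))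
    (G := fun r => -((j + 1 : ℝ) * δ) * (sd δ r ^ (j + 2) * pp R r ^ (l + 2))
      - (l + 2 : ℝ) / R * (sd δ r ^ (j + 1) * pp R r ^ (l + 1)))
    (G' := fun r => -((j + 1 : ℝ) * δ) * (((j + 2 : ℝ) * sd δ r ^ (j + 1) * sd' δ r) * pp R r ^ (l + 2)
        + sd δ r ^ (j + 2) * ((l + 2 : ℝ) * pp R r ^ (l + 1) * (-(1 / R))))
      - (l + 2 : ℝ) / R * (((j + 1 : ℝ) * sd δ r ^ j * sd' δ r) * pp R r ^ (l + 1)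
        + sd δ r ^ (j + 1) * ((l + 1 : ℝ) * pp R r ^ l * (-(1 / R)))))
    (B := fun r => qi δ r * (-((j + 1 : ℝ) * δ) * (sd δ r ^ (j + 1) * pp R r ^ (l + 2))
      - (l + 2 : ℝ) / R * (sd δ r ^ j * pp R r ^ (l + 1))))
    (D := fun r => sd δ r ^ (j + 1) * (((j + 1) * (l + 2) + (l + 2) * (l + 1)) / R) * pp R r ^ l)
    ?_ ?_ ?_ ?_ ?_ ?_ ?_ ?_ ?_ ?_ ?_ ?_ ?_
  · refine le_of_eq_of_le ?_ this
    congr 1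
    funext r
    have e : sd δ r ^ (j + 1) * pp R r ^ (l + 2) =
        Real.sinh r ^ (j + 2 - 1) * (qi δ r ^ (j + 1) * pp R r ^ (l + 2)) := by
      have e : j + 2 - 1 = j + 1 := rfl
      simp only [e, sd, mul_pow]
      ring
    rw [e]
  · intro r _
    refine (((qi_deriv hδ r).pow (j + 1)).mul ((pp_deriv R r).pow (l + 2))).congr_deriv ?_
    simp only [Pi.pow_apply]; push_cast; simp
  · fun_prop
  · intro r _
    refine (((((sd_deriv hδ r).pow (j + 2)).mul ((pp_deriv R r).pow (l + 2))).const_mul _).sub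
      ((((sd_deriv hδ r).pow (j + 1)).mul ((pp_deriv R r).pow (l + 1))).const_mul _)).congr_deriv ?_
    simp only [Pi.pow_apply]; push_cast; simp
  · fun_prop
  · fun_prop
  · fun_prop
  · fun_prop
  · intro r _
    have e : j + 2 - 1 = j + 1 := rfl
    simp only [e, sd, mul_pow]
    ring
  · intro r
    simp only [sd, mul_pow]
    ring
  · simp [hpR]
  · simp [hpR]
  · intro r hr
    have := qi_pos hδ r
    have := pp_nonneg hR0 hr.2
    positivity
  · intro r hr
    have hs := sd_nonneg hδ hr.1.le
    have hs' := sd'_nonneg hδ r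
    have hp := pp_nonneg hR0 hr.2
    have hp1 := pp_le hR0 hr.1.le
    have hds := sd_le hδ r
    generalize sd δ r = s at *
    generalize sd' δ r = s' at *
    generalize pp R r = p at *
    have t1 : 0 ≤ ((j + 1 : ℝ) * δ) * (((j + 2 : ℝ) * s ^ (j + 1) * s') * p ^ (l + 2)) := by positivity
    have t2 : 0 ≤ (l + 2 : ℝ) / R * (((j + 1 : ℝ) * s ^ j * s') * p ^ (l + 1)) := by positivity
    have t3 : (δ * s) * p ≤ 1 := mul_le_one₀ hds hp hp1
    have t4 : (j + 1 : ℝ) * (l + 2) * s ^ (j + 1) / R * p ^ l * ((δ * s) * p) ≤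
      (j + 1 : ℝ) * (l + 2) * s ^ (j + 1) / R * p ^ l * 1 := mul_le_mul_of_nonneg_left t3 (by positivity)
    have t5 : 1 / R ≤ 1 := by rw [div_le_one hR0]; exact hR
    have t6 : (l + 2 : ℝ) / R * (s ^ (j + 1) * ((l + 1 : ℝ) * p ^ l)) * (1 / R) ≤
      (l + 2 : ℝ) / R * (s ^ (j + 1) * ((l + 1 : ℝ) * p ^ l)) * 1 := mul_le_mul_of_nonneg_left t5 (by positivity)
    have e1 : s ^ (j + 1) * (((j + 1) * (l + 2) + (l + 2) * (l + 1)) / R) * p ^ l =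
      (j + 1 : ℝ) * (l + 2) * s ^ (j + 1) / R * p ^ l * 1 +
      (l + 2 : ℝ) / R * (s ^ (j + 1) * ((l + 1 : ℝ) * p ^ l)) * 1 := by ring
    have e2 : -((j + 1 : ℝ) * δ) * (((j + 2 : ℝ) * s ^ (j + 1) * s') * p ^ (l + 2)
        + s ^ (j + 2) * ((l + 2 : ℝ) * p ^ (l + 1) * (-(1 / R))))
      - (l + 2 : ℝ) / R * (((j + 1 : ℝ) * s ^ j * s') * p ^ (l + 1)
        + s ^ (j + 1) * ((l + 1 : ℝ) * p ^ l * (-(1 / R)))) =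
      - (((j + 1 : ℝ) * δ) * (((j + 2 : ℝ) * s ^ (j + 1) * s') * p ^ (l + 2)))
      - (l + 2 : ℝ) / R * (((j + 1 : ℝ) * s ^ j * s') * p ^ (l + 1))
      + (j + 1 : ℝ) * (l + 2) * s ^ (j + 1) / R * p ^ l * ((δ * s) * p)
      + (l + 2 : ℝ) / R * (s ^ (j + 1) * ((l + 1 : ℝ) * p ^ l)) * (1 / R) := by ring
    rw [e1, e2]
    linarith
end core5

noncomputable def uext (T : ℝ) (u : ℝ → ℝ → ℝ) (r t : ℝ) : ℝ := u (max r 0) (max 0 (min t T))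

lemma uext_eq {T : ℝ} {u : ℝ → ℝ → ℝ} {r t : ℝ} (hr : 0 ≤ r) (ht : t ∈ Icc 0 T) : uext T u r t = u r t := by
  rw [uext, max_eq_left hr, min_eq_left ht.2, max_eq_right ht.1]

lemma swap_cont {f : ℝ → ℝ → ℝ} (hf : Continuous (Function.uncurry f)) {a b c d : ℝ} (hab : a ≤ b) (hcd : c ≤ d) :
    ∫ r in a..b, ∫ t in c..d, f r t = ∫ t in c..d, ∫ r in a..b, f r t := by
  simp_rw [intervalIntegral.integral_of_le hab, intervalIntegral.integral_of_le hcd]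
  refine integral_integral_swap ?_
  rw [Measure.prod_restrict]
  exact (hf.continuousOn.integrableOn_compact (isCompact_Icc.prod isCompact_Icc)).mono_set
    (prod_mono Ioc_subset_Icc_self Ioc_subset_Icc_self)

section core6
variable {m T : ℝ} {u vr ut : ℝ → ℝ → ℝ} {j l : ℕ} {N : ℕ}

lemma uext_cont (hT : 0 < T) (h : CoreSol N m T u vr ut) : Continuous (fun p : ℝ × ℝ => uext T u p.1 p.2) := by
  refine h.c_u.comp_continuous (f := fun p : ℝ × ℝ => (max p.1 0, max 0 (min p.2 T))) (by fun_prop) ?_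
  intro p
  exact ⟨mem_Ici.2 (le_max_right _ _), le_max_left _ _, max_le hT.le (min_le_right _ _)⟩

lemma uext_nonneg (hT : 0 < T) (h : CoreSol N m T u vr ut) (r t : ℝ) : 0 ≤ uext T u r t :=
  h.nonneg _ (mem_Ici.2 (le_max_right _ _)) _ ⟨le_max_left _ _, max_le hT.le (min_le_right _ _)⟩

noncomputable def YY (T m : ℝ) (u : ℝ → ℝ → ℝ) (j l : ℕ) (δ R t : ℝ) : ℝ :=
  ∫ r in (0:ℝ)..R, sd δ r ^ (j + 1) * pp R r ^ (l + 2) * uext T u r t ^ (m + 1)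

lemma YY_cont (hm0 : 0 < m) (hT : 0 < T) (h : CoreSol N m T u vr ut) {δ R : ℝ} (hδ : 0 < δ) :
    Continuous (YY T m u j l δ R) := by
  unfold YY
  refine intervalIntegral.continuous_parametric_intervalIntegral_of_continuous' ?_ _ _
  have c1 := uext_cont hT h
  have cs := sd_cont hδ
  have cp := pp_cont R
  have c2 : Continuous (fun p : ℝ × ℝ => uext T u p.2 p.1 ^ (m + 1)) :=
    (c1.comp continuous_swap).rpow_const fun _ => Or.inr (by linarith)
  change Continuous (fun p : ℝ × ℝ => sd δ p.2 ^ (j + 1) * pp R p.2 ^ (l + 2) * uext T u p.2 p.1 ^ (m + 1))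
  fun_prop

lemma YY_step (hm0 : 0 < m) (hT : 0 < T) (h : CoreSol (j + 2) m T u vr ut) {δ R a b ε K : ℝ} (hδ : 0 < δ)
    (hR : 1 ≤ R) (ha : 0 < a) (hab : a ≤ b) (hb : b < T)
    (hK : ∀ x p : ℝ, 0 ≤ x → 0 ≤ p → p ≤ 1 →
      (x ^ m) ^ 2 * p ^ l ≤ ε + K * (x ^ (m + 1) * p ^ (l + 2))) (hε : 0 < ε) {c : ℝ}
    (hc : c = ((j + 1) * (l + 2) + (l + 2) * (l + 1))) :
    YY T m u j l δ R b ≤ YY T m u j l δ R a + (m + 1) * (c / 2) * (ε * (1 / δ) ^ (j + 1) * (b - a)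
      + K / R * ∫ τ in a..b, YY T m u j l δ R τ) := by
  have hR0 : 0 < R := by linarith
  have hI : Icc a b ⊆ Icc 0 T := fun x hx => ⟨ha.le.trans hx.1, hx.2.trans hb.le⟩
  have hc0 : 0 ≤ c := by rw [hc]; positivity
  have c1 := uext_cont hT h
  have cs := sd_cont hδ
  have cp := pp_cont R
  have key := cutoff2 (l := l) hm0 h hδ hR ha hab hb
  rw [← hc] at key
  have c3 : Continuous (fun p : ℝ × ℝ => uext T u p.1 p.2 ^ (m + 1)) :=
    c1.rpow_const fun _ => Or.inr (by linarith)
  have c4 : Continuous (fun p : ℝ × ℝ => uext T u p.1 p.2 ^ m) :=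
    c1.rpow_const fun _ => Or.inr hm0.le
  have c3' : ∀ t, Continuous (fun r => uext T u r t ^ (m + 1)) := fun t =>
    c3.comp (f := fun r => (r, t)) (by fun_prop)
  have cX : Continuous (fun r => sd δ r ^ (j + 1) * pp R r ^ (l + 2)) := by fun_prop
  have cF : Continuous (fun p : ℝ × ℝ => (uext T u p.1 p.2 ^ m) ^ 2 *
        (sd δ p.1 ^ (j + 1) * (c / R) * pp R p.1 ^ l) / 2) := by fun_prop
  have cH : Continuous (fun p : ℝ × ℝ => c / (2 * R) * (ε * (1 / δ) ^ (j + 1) +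
      K * (sd δ p.1 ^ (j + 1) * pp R p.1 ^ (l + 2) * uext T u p.1 p.2 ^ (m + 1)))) := by fun_prop
  have key2 : ∫ r in (0:ℝ)..R, (sd δ r ^ (j + 1) * pp R r ^ (l + 2) *
      ((uext T u r b ^ (m + 1) - uext T u r a ^ (m + 1)) / (m + 1))
      - ∫ τ in a..b, (uext T u r τ ^ m) ^ 2 *
        (sd δ r ^ (j + 1) * (c / R) * pp R r ^ l) / 2) ≤ 0 := by
    refine le_of_eq_of_le (intervalIntegral.integral_congr fun r hr => ?_) key
    rw [uIcc_of_le hR0.le] at hr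
    beta_reduce
    rw [uext_eq hr.1 (hI ⟨hab, le_rfl⟩), uext_eq hr.1 (hI ⟨le_rfl, hab⟩)]
    congr 1
    refine intervalIntegral.integral_congr fun τ hτ => ?_
    rw [uIcc_of_le hab] at hτ
    beta_reduce
    rw [uext_eq hr.1 (hI hτ)]
  have cU : Continuous (fun r => sd δ r ^ (j + 1) * pp R r ^ (l + 2) *
      ((uext T u r b ^ (m + 1) - uext T u r a ^ (m + 1)) / (m + 1))) :=
    cX.mul (((c3' b).sub (c3' a)).div_const _)
  have par : ∀ {f : ℝ → ℝ → ℝ}, Continuous (fun p : ℝ × ℝ => f p.1 p.2) →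
      Continuous (fun r => ∫ τ in a..b, f r τ) := fun hf =>
    intervalIntegral.continuous_parametric_intervalIntegral_of_continuous' hf a b
  have cHi := par (f := fun r τ => c / (2 * R) * (ε * (1 / δ) ^ (j + 1) +
      K * (sd δ r ^ (j + 1) * pp R r ^ (l + 2) * uext T u r τ ^ (m + 1)))) cH
  have cFi := par (f := fun r τ => (uext T u r τ ^ m) ^ 2 *
        (sd δ r ^ (j + 1) * (c / R) * pp R r ^ l) / 2) cF
  have key3 : ∫ r in (0:ℝ)..R, (sd δ r ^ (j + 1) * pp R r ^ (l + 2) *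
      ((uext T u r b ^ (m + 1) - uext T u r a ^ (m + 1)) / (m + 1))
      - ∫ τ in a..b, c / (2 * R) * (ε * (1 / δ) ^ (j + 1) +
      K * (sd δ r ^ (j + 1) * pp R r ^ (l + 2) * uext T u r τ ^ (m + 1)))) ≤ 0 := by
    refine le_trans ?_ key2
    refine intervalIntegral.integral_mono_on hR0.le ((cU.sub cHi).intervalIntegrable _ _)
      ((cU.sub cFi).intervalIntegrable _ _) fun r hr => ?_
    refine sub_le_sub_left ?_ _
    refine intervalIntegral.integral_mono_on hab
      ((cF.comp (f := fun τ : ℝ => (r, τ)) (by fun_prop)).intervalIntegrable _ _)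
      ((cH.comp (f := fun τ : ℝ => (r, τ)) (by fun_prop)).intervalIntegrable _ _) fun τ hτ => ?_
    have hy := hK _ _ (uext_nonneg hT h r τ) (pp_nonneg hR0 hr.2) (pp_le hR0 hr.1)
    have hs := sd_nonneg hδ hr.1
    have hs1 : sd δ r ^ (j + 1) ≤ (1 / δ) ^ (j + 1) :=
      pow_le_pow_left₀ hs (by rw [le_div_iff₀ hδ, mul_comm]; exact sd_le hδ r) _
    have hy2 := mul_le_mul_of_nonneg_left hy (pow_nonneg hs (j + 1))
    have hy3 := mul_le_mul_of_nonneg_left hs1 hε.le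
    have hcR : 0 ≤ c / (2 * R) := by positivity
    calc (uext T u r τ ^ m) ^ 2 * (sd δ r ^ (j + 1) * (c / R) * pp R r ^ l) / 2
        = c / (2 * R) * (sd δ r ^ (j + 1) * ((uext T u r τ ^ m) ^ 2 * pp R r ^ l)) := by
          field_simp
      _ ≤ _ := mul_le_mul_of_nonneg_left (by linarith) hcR
  rw [intervalIntegral.integral_sub (cU.intervalIntegrable _ _) (cHi.intervalIntegrable _ _),
    swap_cont (f := fun r τ => c / (2 * R) * (ε * (1 / δ) ^ (j + 1) +
      K * (sd δ r ^ (j + 1) * pp R r ^ (l + 2) * uext T u r τ ^ (m + 1)))) cH hR0.le hab] at key3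
  have cXu : ∀ t, Continuous (fun r => sd δ r ^ (j + 1) * pp R r ^ (l + 2) * uext T u r t ^ (m + 1)) :=
    fun t => cX.mul (c3' t)
  have e1 : ∫ r in (0:ℝ)..R, (sd δ r ^ (j + 1) * pp R r ^ (l + 2) *
      ((uext T u r b ^ (m + 1) - uext T u r a ^ (m + 1)) / (m + 1))) =
      (YY T m u j l δ R b - YY T m u j l δ R a) / (m + 1) := by
    rw [YY, YY, ← intervalIntegral.integral_sub ((cXu b).intervalIntegrable _ _) ((cXu a).intervalIntegrable _ _),
      ← intervalIntegral.integral_div]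
    congr 1; funext r; ring
  have e2 : ∀ τ, ∫ r in (0:ℝ)..R, c / (2 * R) * (ε * (1 / δ) ^ (j + 1) +
      K * (sd δ r ^ (j + 1) * pp R r ^ (l + 2) * uext T u r τ ^ (m + 1))) =
      c / (2 * R) * (ε * (1 / δ) ^ (j + 1) * R + K * YY T m u j l δ R τ) := by
    intro τ
    rw [intervalIntegral.integral_const_mul, intervalIntegral.integral_add (by simp)
      (((cXu τ).const_mul K).intervalIntegrable _ _), intervalIntegral.integral_const_mul, YY]
    simp; ring_nf; simp
  rw [e1] at key3
  simp_rw [e2] at key3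
  have cY := YY_cont (j := j) (l := l) (R := R) hm0 hT h hδ
  rw [intervalIntegral.integral_const_mul, intervalIntegral.integral_add (by simp)
      ((cY.const_mul K).intervalIntegrable _ _)] at key3
  simp only [intervalIntegral.integral_const, intervalIntegral.integral_const_mul, smul_eq_mul] at key3
  have hm1 : 0 < m + 1 := by linarith
  have e3 : (YY T m u j l δ R b - YY T m u j l δ R a) / (m + 1) ≤ (c / 2) * (ε * (1 / δ) ^ (j + 1) * (b - a)
      + K / R * ∫ τ in a..b, YY T m u j l δ R τ) := by
    refine (sub_nonpos.1 key3).trans (le_of_eq ?_)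
    field_simp
  rw [div_le_iff₀ hm1] at e3
  linarith

lemma YY_le_init (hm0 : 0 < m) (hT : 0 < T) (h : CoreSol (j + 2) m T u vr ut) {δ R : ℝ} (hδ : 0 < δ)
    (hR : 1 ≤ R) : YY T m u j l δ R 0 ≤ II (j + 2) m u 0 := by
  have hR0 : 0 < R := by linarith
  have cs := sd_cont hδ
  have cp := pp_cont R
  have cX : Continuous (fun r => sd δ r ^ (j + 1) * pp R r ^ (l + 2)) := by fun_prop
  have c3 : Continuous (fun r => uext T u r 0 ^ (m + 1)) :=
    ((uext_cont hT h).comp (f := fun r => (r, (0:ℝ))) (by fun_prop)).rpow_const fun _ => Or.inr (by linarith)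
  have hi := h.init_int
  unfold YY II
  rw [intervalIntegral.integral_of_le hR0.le]
  refine (setIntegral_mono_on ((cX.mul c3).integrableOn_Ioc) (hi.mono_set Ioc_subset_Ioi_self) measurableSet_Ioc
    fun r hr => ?_).trans ?_
  · rw [Pi.mul_apply]; beta_reduce
    rw [uext_eq hr.1.le ⟨le_rfl, hT.le⟩, mul_comm]
    refine mul_le_mul_of_nonneg_left ?_ (Real.rpow_nonneg (h.nonneg r (le_of_lt hr.1) 0 ⟨le_rfl, hT.le⟩) _)
    have hq := qi_pos hδ r
    have hq1 : qi δ r ≤ 1 := by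
      have := Real.cosh_pos r
      refine inv_le_one_of_one_le₀ ?_
      have : 0 ≤ δ * Real.cosh r := by positivity
      linarith
    have hsh := sinh_pos' hr.1
    have hs : sd δ r ≤ Real.sinh r := mul_le_of_le_one_right hsh.le hq1
    have hp := pp_nonneg hR0 hr.2
    calc sd δ r ^ (j + 1) * pp R r ^ (l + 2) ≤ Real.sinh r ^ (j + 1) * 1 :=
          mul_le_mul (pow_le_pow_left₀ (sd_nonneg hδ hr.1.le) hs _) (pow_le_one₀ hp (pp_le hR0 hr.1.le))
            (by positivity) (by positivity)
      _ = Real.sinh r ^ (j + 2 - 1) := by rw [mul_one]; rfl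
  · refine setIntegral_mono_set hi (ae_Ioi fun r hr => ?_) (Eventually.of_forall Ioc_subset_Ioi_self)
    exact mul_nonneg (Real.rpow_nonneg (h.nonneg r (le_of_lt hr) 0 ⟨le_rfl, hT.le⟩) _) (pow_pos (sinh_pos' hr) _).le

lemma YY_bound (hm0 : 0 < m) (hT : 0 < T) (h : CoreSol (j + 2) m T u vr ut) {δ R ε K t : ℝ} (hδ : 0 < δ)
    (hR : 1 ≤ R) (ht : t ∈ Ioo 0 T)
    (hK : ∀ x p : ℝ, 0 ≤ x → 0 ≤ p → p ≤ 1 →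
      (x ^ m) ^ 2 * p ^ l ≤ ε + K * (x ^ (m + 1) * p ^ (l + 2))) (hε : 0 < ε) (hK0 : 0 ≤ K) {c : ℝ}
    (hc : c = ((j + 1) * (l + 2) + (l + 2) * (l + 1))) (hRK : (m + 1) * (c / 2) * T * K ≤ R) :
    (1 - (m + 1) * (c / 2) * T * K / R) * YY T m u j l δ R t ≤
      II (j + 2) m u 0 + (m + 1) * (c / 2) * T * (ε * (1 / δ) ^ (j + 1)) := by
  have hR0 : 0 < R := by linarith
  have hc0 : 0 ≤ c := by rw [hc]; positivity
  have cY := YY_cont (j := j) (l := l) (R := R) hm0 hT h hδ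
  obtain ⟨b0, hb0, hmax⟩ := (isCompact_Icc (a := (0:ℝ)) (b := t)).exists_isMaxOn ⟨0, le_rfl, ht.1.le⟩ cY.continuousOn
  set S := YY T m u j l δ R b0 with hS
  have hmax' : ∀ τ ∈ Icc 0 t, YY T m u j l δ R τ ≤ S := hmax
  have hY0 : 0 ≤ YY T m u j l δ R t := by
    refine intervalIntegral.integral_nonneg hR0.le fun r hr => ?_
    have := sd_nonneg hδ hr.1
    have := pp_nonneg hR0 hr.2
    have := uext_nonneg hT h r t
    positivity
  have hS0 : 0 ≤ S := hY0.trans (hmax' t ⟨ht.1.le, le_rfl⟩)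
  have hSS : S ≤ YY T m u j l δ R 0 + (m + 1) * (c / 2) * (ε * (1 / δ) ^ (j + 1) * T + K / R * (T * S)) := by
    rcases hb0.1.eq_or_lt with h0 | h0
    · rw [hS, ← h0]
      have : 0 ≤ (m + 1) * (c / 2) * (ε * (1 / δ) ^ (j + 1) * T + K / R * (T * S)) := by positivity
      rw [hS, ← h0] at this
      linarith
    · have hl : Tendsto (fun a => YY T m u j l δ R a + (m + 1) * (c / 2) * (ε * (1 / δ) ^ (j + 1) * T + K / R * (T * S)))
          (𝓝[>] 0) (𝓝 (YY T m u j l δ R 0 + (m + 1) * (c / 2) * (ε * (1 / δ) ^ (j + 1) * T + K / R * (T * S)))) :=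
        ((cY.tendsto 0).mono_left nhdsWithin_le_nhds).add_const _
      refine ge_of_tendsto hl ?_
      filter_upwards [Ioo_mem_nhdsGT h0] with a ha
      refine (YY_step hm0 hT h hδ hR ha.1 ha.2.le (hb0.2.trans_lt ht.2) hK hε hc).trans ?_
      have hbaT : b0 - a ≤ T := by linarith [ha.1, hb0.2, ht.2]
      have hint : ∫ τ in a..b0, YY T m u j l δ R τ ≤ T * S := by
        refine (intervalIntegral.integral_mono_on ha.2.le (cY.intervalIntegrable _ _)
          ((continuous_const (y := S)).intervalIntegrable _ _) fun τ hτ => hmax' τ ⟨ha.1.le.trans hτ.1, hτ.2.trans hb0.2⟩).trans ?_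
        simp only [intervalIntegral.integral_const, smul_eq_mul]
        exact mul_le_mul_of_nonneg_right hbaT hS0
      gcongr
  have h0 := YY_le_init (l := l) hm0 hT h hδ hR
  have h1 : (1 - (m + 1) * (c / 2) * T * K / R) * YY T m u j l δ R t ≤ (1 - (m + 1) * (c / 2) * T * K / R) * S := by
    refine mul_le_mul_of_nonneg_left (hmax' t ⟨ht.1.le, le_rfl⟩) ?_
    rw [sub_nonneg, div_le_one hR0]; exact hRK
  refine h1.trans ?_
  have e : (1 - (m + 1) * (c / 2) * T * K / R) * S = S - (m + 1) * (c / 2) * (K / R * (T * S)) := by ring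
  rw [e]; nlinarith [hSS, h0]

lemma YY_lower (hm0 : 0 < m) (hT : 0 < T) (h : CoreSol (j + 2) m T u vr ut) {δ R L t : ℝ} (hδ : 0 < δ)
    (hL : 0 < L) (hLR : L ≤ R) (ht : t ∈ Ioo 0 T) :
    ((1 + δ * Real.cosh L)⁻¹) ^ (j + 1) * (1 - L / R) ^ (l + 2) *
      (∫ r in (0:ℝ)..L, u r t ^ (m + 1) * Real.sinh r ^ (j + 1)) ≤ YY T m u j l δ R t := by
  have hR0 : 0 < R := by linarith
  have cs := sd_cont hδ
  have cp := pp_cont R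
  have htc : t ∈ Icc 0 T := Ioo_subset_Icc_self ht
  have cX : Continuous (fun r => sd δ r ^ (j + 1) * pp R r ^ (l + 2)) := by fun_prop
  have c3 : Continuous (fun r => uext T u r t ^ (m + 1)) :=
    ((uext_cont hT h).comp (f := fun r => (r, t)) (by fun_prop)).rpow_const fun _ => Or.inr (by linarith)
  have cXu : Continuous (fun r => sd δ r ^ (j + 1) * pp R r ^ (l + 2) * uext T u r t ^ (m + 1)) := cX.mul c3
  have hnn : ∀ r ∈ Icc 0 R, 0 ≤ sd δ r ^ (j + 1) * pp R r ^ (l + 2) * uext T u r t ^ (m + 1) := by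
    intro r hr
    have := sd_nonneg hδ hr.1
    have := pp_nonneg hR0 hr.2
    have := uext_nonneg hT h r t
    positivity
  have h1 : ∫ r in (0:ℝ)..L, sd δ r ^ (j + 1) * pp R r ^ (l + 2) * uext T u r t ^ (m + 1) ≤ YY T m u j l δ R t := by
    rw [YY, ← intervalIntegral.integral_add_adjacent_intervals (a := 0) (b := L) (c := R) (cXu.intervalIntegrable _ _)
      (cXu.intervalIntegrable _ _)]
    have := intervalIntegral.integral_nonneg (μ := volume) hLR fun r hr => hnn r ⟨hL.le.trans hr.1, hr.2⟩
    linarith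
  refine le_trans ?_ h1
  rw [← intervalIntegral.integral_const_mul]
  have cl : Continuous (fun r => ((1 + δ * Real.cosh L)⁻¹) ^ (j + 1) * (1 - L / R) ^ (l + 2) *
      (uext T u r t ^ (m + 1) * Real.sinh r ^ (j + 1))) := by fun_prop
  refine le_of_eq_of_le (intervalIntegral.integral_congr (g := fun r =>
    ((1 + δ * Real.cosh L)⁻¹) ^ (j + 1) * (1 - L / R) ^ (l + 2) *
      (uext T u r t ^ (m + 1) * Real.sinh r ^ (j + 1))) fun r hr => ?_) ?_
  · rw [uIcc_of_le hL.le] at hr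
    beta_reduce
    rw [uext_eq hr.1 htc]
  · refine intervalIntegral.integral_mono_on hL.le (cl.intervalIntegrable _ _) (cXu.intervalIntegrable _ _)
      fun r hr => ?_
    have hsh : 0 ≤ Real.sinh r := Real.sinh_nonneg_iff.2 hr.1
    have hu := Real.rpow_nonneg (uext_nonneg hT h r t) (m + 1)
    have hq : (1 + δ * Real.cosh L)⁻¹ ≤ qi δ r := by
      refine inv_anti₀ (q_pos hδ r) ?_
      have : Real.cosh r ≤ Real.cosh L := by
        rw [Real.cosh_le_cosh, abs_of_nonneg hr.1, abs_of_pos hL]; exact hr.2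
      gcongr
    have hp : 1 - L / R ≤ pp R r := by
      have := div_le_div_of_nonneg_right hr.2 hR0.le
      unfold pp; linarith
    have hp0 : 0 ≤ 1 - L / R := pp_nonneg hR0 hLR
    have hq0 : 0 < (1 + δ * Real.cosh L)⁻¹ := inv_pos.2 (q_pos hδ L)
    have := mul_le_mul (pow_le_pow_left₀ hq0.le hq (j + 1)) (pow_le_pow_left₀ hp0 hp (l + 2)) (by positivity)
      (pow_nonneg (qi_pos hδ r).le _)
    calc _ ≤ qi δ r ^ (j + 1) * pp R r ^ (l + 2) * (uext T u r t ^ (m + 1) * Real.sinh r ^ (j + 1)) :=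
          mul_le_mul_of_nonneg_right this (by positivity)
      _ = _ := by simp only [sd, mul_pow]; ring

lemma I_le_init (hN : 2 ≤ N) (hm0 : 0 < m) (hm1 : m < 1) (hT : 0 < T) (h : CoreSol N m T u vr ut)
    {H : ℝ → ℝ} (hH : SobH N m H) {t : ℝ} (ht : t ∈ Ioo 0 T) : II N m u t ≤ II N m u 0 := by
  obtain ⟨j, rfl⟩ : ∃ j, N = j + 2 := ⟨N - 2, by omega⟩
  obtain ⟨l0, hl0⟩ := exists_nat_ge (4 * m / (1 - m))
  set l := l0 + 1 with hldef
  have hl1 : 1 ≤ l := by omega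
  have hl : ((l : ℝ) + 2) * (2 * m / (m + 1)) ≤ l := by
    have h1 : 4 * m / (1 - m) ≤ l := hl0.trans (by rw [hldef]; push_cast; linarith)
    rw [div_le_iff₀ (by linarith)] at h1
    rw [← mul_div_assoc, div_le_iff₀ (by linarith)]
    linarith
  have hfin : ∀ L > 0, ∫ r in (0:ℝ)..L, u r t ^ (m + 1) * Real.sinh r ^ (j + 1) ≤ II (j + 2) m u 0 := by
    intro L hL
    set A := ∫ r in (0:ℝ)..L, u r t ^ (m + 1) * Real.sinh r ^ (j + 1) with hA
    have h1 : ∀ δ > 0, ∀ ε > 0, ((1 + δ * Real.cosh L)⁻¹) ^ (j + 1) * A ≤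
        II (j + 2) m u 0 + (m + 1) * (((j + 1) * (l + 2) + (l + 2) * (l + 1) : ℝ) / 2) * T * (ε * (1 / δ) ^ (j + 1)) := by
      intro δ hδ ε hε
      obtain ⟨K, hK0, hK⟩ := young_pk hm0 hm1 hl1 hl hε
      set c : ℝ := ((j + 1) * (l + 2) + (l + 2) * (l + 1) : ℝ) with hc
      have hlim : Tendsto (fun R : ℝ => (1 - (m + 1) * (c / 2) * T * K / R) *
          (((1 + δ * Real.cosh L)⁻¹) ^ (j + 1) * (1 - L / R) ^ (l + 2) * A)) atTop
          (𝓝 ((1 - 0) * (((1 + δ * Real.cosh L)⁻¹) ^ (j + 1) * (1 - 0) ^ (l + 2) * A))) := by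
        have t1 : ∀ x : ℝ, Tendsto (fun R : ℝ => x / R) atTop (𝓝 0) := fun x => tendsto_const_nhds.div_atTop tendsto_id
        exact ((t1 _).const_sub 1).mul (((((t1 L).const_sub 1).pow _).const_mul _).mul_const _)
      have := le_of_tendsto hlim (b := II (j + 2) m u 0 + (m + 1) * (c / 2) * T * (ε * (1 / δ) ^ (j + 1))) (by
        filter_upwards [eventually_ge_atTop 1, eventually_ge_atTop L,
          eventually_ge_atTop ((m + 1) * (c / 2) * T * K)] with R hR1 hR2 hR3
        refine le_trans ?_ (YY_bound (l := l) hm0 hT h hδ hR1 ht hK hε hK0 hc hR3)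
        refine mul_le_mul_of_nonneg_left (YY_lower hm0 hT h hδ hL hR2 ht) ?_
        rw [sub_nonneg, div_le_one (by linarith)]; exact hR3)
      simpa using this
    have h2 : ∀ δ > 0, ((1 + δ * Real.cosh L)⁻¹) ^ (j + 1) * A ≤ II (j + 2) m u 0 := by
      intro δ hδ
      have hlim : Tendsto (fun ε : ℝ => II (j + 2) m u 0 + (m + 1) * (((j + 1) * (l + 2) + (l + 2) * (l + 1) : ℝ) / 2) * T * (ε * (1 / δ) ^ (j + 1)))
          (𝓝[>] 0) (𝓝 (II (j + 2) m u 0 + (m + 1) * (((j + 1) * (l + 2) + (l + 2) * (l + 1) : ℝ) / 2) * T * (0 * (1 / δ) ^ (j + 1)))) := by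
        refine Tendsto.mono_left ?_ nhdsWithin_le_nhds
        exact Continuous.tendsto (by fun_prop) 0
      have := ge_of_tendsto hlim (eventually_mem_nhdsWithin.mono fun ε hε => h1 δ hδ ε hε)
      simpa using this
    have hlim : Tendsto (fun δ : ℝ => ((1 + δ * Real.cosh L)⁻¹) ^ (j + 1) * A) (𝓝[>] 0)
        (𝓝 (((1 + 0 * Real.cosh L)⁻¹) ^ (j + 1) * A)) := by
      refine Tendsto.mono_left ?_ nhdsWithin_le_nhds
      have : ContinuousAt (fun δ : ℝ => (1 + δ * Real.cosh L)⁻¹) 0 :=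
        ContinuousAt.inv₀ (by fun_prop) (by simp)
      exact (this.tendsto.pow _).mul_const _
    have := le_of_tendsto hlim (eventually_mem_nhdsWithin.mono fun δ hδ => h2 δ hδ)
    simpa using this
  have hint := I_int hm0 h hH ht
  have := intervalIntegral_tendsto_integral_Ioi 0 hint tendsto_id
  refine le_of_tendsto this ?_
  filter_upwards [eventually_gt_atTop 0] with L hL using hfin L hL

end core6

lemma LpNorm_eq_II {N : ℕ} {m t : ℝ} {u : ℝ → ℝ → ℝ} (hu : ∀ r ∈ Ioi (0:ℝ), 0 ≤ u r t) :
    LpNormRad N (m + 1) (fun r => u r t) = II N m u t ^ (1 / (m + 1)) := by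
  unfold LpNormRad II
  congr 1
  refine setIntegral_congr_fun measurableSet_Ioi fun r hr => ?_
  beta_reduce
  rw [abs_of_nonneg (hu r hr)]

lemma LpNorm_two {N : ℕ} {g : ℝ → ℝ} :
    LpNormRad N 2 g = Real.sqrt (∫ r in Ioi (0:ℝ), g r ^ 2 * Real.sinh r ^ (N - 1)) := by
  unfold LpNormRad
  rw [Real.sqrt_eq_rpow]
  congr 1
  refine setIntegral_congr_fun measurableSet_Ioi fun r hr => ?_
  beta_reduce
  have : |g r| ^ (2:ℝ) = |g r| ^ 2 := by norm_cast
  rw [this, sq_abs]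

/-- Two-sided bounds for the `L^{m+1}` norm of the solution, with lower constant depending
only on `m` and `N`, and monotonicity of the energy ratio along the evolution. -/
theorem norm_estimates_and_ratio_monotone
    (N : ℕ) (hN : 2 ≤ N) (m : ℝ)
    (hm : m ∈ Set.Ioo (((N : ℝ) - 2) / ((N : ℝ) + 2)) 1) :
    (∃ C > (0:ℝ), ∀ T > (0:ℝ), ∀ u : ℝ → ℝ → ℝ, IsRadialEnergySolution N m T u →
      ∀ t ∈ Set.Ioo (0:ℝ) T,
        C * (T - t) ^ (1 / (1 - m)) ≤ LpNormRad N (m + 1) (fun r => u r t)) ∧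
    (∀ T > (0:ℝ), ∀ u : ℝ → ℝ → ℝ, IsRadialEnergySolution N m T u →
      (∀ t ∈ Set.Ioo (0:ℝ) T,
        LpNormRad N (m + 1) (fun r => u r t) ≤
          (1 - t / T) ^ (1 / (1 - m)) * LpNormRad N (m + 1) (fun r => u r 0)) ∧
      (∀ t₁ ∈ Set.Ioo (0:ℝ) T, ∀ t₂ ∈ Set.Ioo (0:ℝ) T, t₁ ≤ t₂ →
        LpNormRad N 2 (deriv (fun ρ => u ρ t₂ ^ m)) /
            (LpNormRad N (m + 1) (fun r => u r t₂)) ^ m ≤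
          LpNormRad N 2 (deriv (fun ρ => u ρ t₁ ^ m)) /
            (LpNormRad N (m + 1) (fun r => u r t₁)) ^ m)) := by
  have hN2 : (2:ℝ) ≤ N := by exact_mod_cast hN
  have hm0 : 0 < m := lt_of_le_of_lt (div_nonneg (by linarith) (by linarith)) hm.1
  have hm1 : m < 1 := hm.2
  obtain ⟨H, hH0⟩ := sobolev_pt hN hm
  have hH : SobH N m H := hH0
  have hLp : ∀ {T : ℝ} {u : ℝ → ℝ → ℝ}, IsRadialEnergySolution N m T u → ∀ t ∈ Icc 0 T,
      LpNormRad N (m + 1) (fun r => u r t) = II N m u t ^ (1 / (m + 1)) := fun hu t ht =>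
    LpNorm_eq_II fun r hr => hu.nonneg r (Ioi_subset_Ici_self hr) t ht
  constructor
  · obtain ⟨C, hC0, hC⟩ := lower_bound hN hm0 hm1 hH
    refine ⟨C, hC0, fun T hT u hu t ht => ?_⟩
    rw [hLp hu t (Ioo_subset_Icc_self ht)]
    exact hC (coreSol_of hN hm0 hm1 hT hu) t ht
  · intro T hT u hu
    have h := coreSol_of hN hm0 hm1 hT hu
    constructor
    · intro t ht
      rw [hLp hu t (Ioo_subset_Icc_self ht), hLp hu 0 ⟨le_rfl, hT.le⟩]
      exact upper_bound hN hm0 hm1 hT h hH (fun t ht => I_le_init hN hm0 hm1 hT h hH ht) ht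
    · intro t₁ h1 t₂ h2 h12
      have key := Q_anti hN hm0 h hH h1.1 h12 h2.2
      have e : ∀ t ∈ Ioo 0 T, LpNormRad N 2 (deriv (fun ρ => u ρ t ^ m)) /
            (LpNormRad N (m + 1) (fun r => u r t)) ^ m =
            QQ N m u (fun r t => deriv (fun ρ => u ρ t ^ m) r) t := by
        intro t ht
        have hp := I_pos hm0 h hH ht
        rw [LpNorm_two, hLp hu t (Ioo_subset_Icc_self ht), ← Real.rpow_mul hp.le, QQ, EE,
          Real.rpow_neg hp.le, div_eq_mul_inv, mul_comm, one_div_mul_eq_div]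
      rw [e t₁ h1, e t₂ h2]
      exact key
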